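/- Let X be a graph-like continuum with vertex set V. The following are equivalent: (i) X has an open Eulerian path; (ii) precisely two vertices of X are odd and every other vertex of X is even; (iii) there exist vertices x ≠ y such that for every separation (A,B) of V, the cut E(A,B) has even cardinality if and only if x and y lie in the same part of the separation; (iv) there exist an arc A in X containing at least one edge and a family (C_i) of circles in X, such that no edge of X lies in two of these sets and every edge of X is contained in A or in exactly one C_i. -/

import Mathlib

open Set Topology Filter Function

universe u

/-- A compact graph-like space structure on a topological space `X`:
a closed zero-dimensional vertex set `V` together with an index type `E`
(carrying the discrete topology) such that `X \ V ≅ E × (0,1)`. -/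
structure GraphLike (X : Type u) [TopologicalSpace X] where
  V : Set X
  closedV : IsClosed V
  zeroDimV : TotallyDisconnectedSpace V
  E : Type
  homeo :
    letI : TopologicalSpace E := ⊥
    Nonempty ((Vᶜ : Set X) ≃ₜ (E × ↥(Set.Ioo (0 : ℝ) 1)))

variable {X : Type u} [TopologicalSpace X]

/-- An edge of a graph-like space: a connected component of `X \ V`. -/
def GraphLike.IsEdge (G : GraphLike X) (e : Set X) : Prop :=
  ∃ x, x ∈ (G.V)ᶜ ∧ e = connectedComponentIn (G.V)ᶜ x

/-- A subset of the vertex set which is clopen in the subspace `V`. -/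
def GraphLike.ClopenIn (G : GraphLike X) (C : Set X) : Prop :=
  C ⊆ G.V ∧ IsClosed C ∧ IsClosed (G.V \ C)

/-- A separation of a graph-like space: a partition of the vertex set into
two disjoint clopen pieces. -/
structure GraphLike.Separation (G : GraphLike X) where
  A : Set X
  B : Set X
  clopenA : G.ClopenIn A
  clopenB : G.ClopenIn B
  disjoint : A ∩ B = ∅
  union : A ∪ B = G.V

/-- The cut induced by a pair of vertex sets: all edges whose closure meets both. -/
def GraphLike.cut (G : GraphLike X) (A B : Set X) : Set (Set X) :=
  {e | G.IsEdge e ∧ (closure e ∩ A).Nonempty ∧ (closure e ∩ B).Nonempty}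

/-- A cut is even if it is finite of even cardinality. -/
def GraphLike.EvenCut (G : GraphLike X) (A B : Set X) : Prop :=
  (G.cut A B).Finite ∧ Even (G.cut A B).ncard

/-- A (standard) path in a graph-like space: a continuous map from `[0,1]` sending the
endpoints to vertices, injective on the preimage of each edge, and such that the
preimage of the vertex set has empty interior. -/
def GraphLike.IsPath (G : GraphLike X) (f : unitInterval → X) : Prop :=
  Continuous f ∧ f 0 ∈ G.V ∧ f 1 ∈ G.V ∧
    (∀ e, G.IsEdge e → Set.InjOn f (f ⁻¹' e)) ∧
    interior (f ⁻¹' G.V) = ∅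

/-- An Eulerian loop: a closed path whose image contains every edge. -/
def GraphLike.IsEulerianLoop (G : GraphLike X) (f : unitInterval → X) : Prop :=
  G.IsPath f ∧ f 0 = f 1 ∧ ∀ e, G.IsEdge e → e ⊆ Set.range f

/-- An open Eulerian path: a path with distinct endpoints whose image contains
every edge. -/
def GraphLike.IsOpenEulerianPath (G : GraphLike X) (f : unitInterval → X) : Prop :=
  G.IsPath f ∧ f 0 ≠ f 1 ∧ ∀ e, G.IsEdge e → e ⊆ Set.range f

/-- A vertex is even if it has a clopen neighbourhood `A` in `V` such that every clopen
`C` with `v ∈ C ⊆ A` induces an even cut `E(C, V ∖ C)`. -/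
def GraphLike.EvenVertex (G : GraphLike X) (v : X) : Prop :=
  ∃ A, G.ClopenIn A ∧ v ∈ A ∧
    ∀ C, G.ClopenIn C → v ∈ C → C ⊆ A →
      (G.cut C (G.V \ C)).Finite ∧ Even (G.cut C (G.V \ C)).ncard

/-- A vertex is odd if it has a clopen neighbourhood `A` in `V` such that every clopen
`C` with `v ∈ C ⊆ A` induces an odd cut `E(C, V ∖ C)`. -/
def GraphLike.OddVertex (G : GraphLike X) (v : X) : Prop :=
  ∃ A, G.ClopenIn A ∧ v ∈ A ∧
    ∀ C, G.ClopenIn C → v ∈ C → C ⊆ A →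
      (G.cut C (G.V \ C)).Finite ∧ Odd (G.cut C (G.V \ C)).ncard

section
open Set Topology Filter Function

namespace GLP

/-- start of a directed edge -/
def st {W E : Type*} (s t : E → W) (e : E) (d : Bool) : W := if d then s e else t e
/-- walk predicate -/
def Tr {W E : Type*} (s t : E → W) : W → List (E × Bool) → W → Prop
  | x, [], y => x = y
  | x, p :: l, y => st s t p.1 p.2 = x ∧ Tr s t (st s t p.1 (!p.2)) l y

theorem Tr_append {W E : Type*} {s t : E → W} {x z : W} {l1 l2 : List (E × Bool)} :
    Tr s t x (l1 ++ l2) z ↔ ∃ y, Tr s t x l1 y ∧ Tr s t y l2 z := by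
  induction l1 generalizing x with
  | nil => simp [Tr]
  | cons p l ih => simp [Tr, ih, and_assoc]

open Classical in
/-- parity -/
def FP {W E : Type*} (s t : E → W) (F : Finset E) (x y : W) : Prop :=
  ∀ w, ∑ e ∈ F, ((if s e = w then (1 : ZMod 2) else 0) + (if t e = w then 1 else 0))
    = (if x = w then 1 else 0) + (if y = w then 1 else 0)

theorem z2 (a : ZMod 2) : a + a = 0 := CharTwo.add_self_eq_zero a

open Classical in
theorem FP_erase {W E : Type*} {s t : E → W} {F : Finset E} {x y : W}
    (h : FP s t F x y) (e : E) (he : e ∈ F) (d : Bool) (hx : st s t e d = x) :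
    FP s t (F.erase e) (st s t e (!d)) y := by
  intro w
  have h1 := h w
  rw [← Finset.add_sum_erase _ _ he] at h1
  subst hx
  cases d <;> simp only [st, Bool.not_false, Bool.not_true, if_true, Bool.false_eq_true, if_false] at h1 ⊢
  · linear_combination h1 - z2 (if s e = w then (1 : ZMod 2) else 0)
  · linear_combination h1 - z2 (if t e = w then (1 : ZMod 2) else 0)

open Classical in
theorem FP_list {W E : Type*} {s t : E → W} (l : List (E × Bool)) {F : Finset E} {x y z : W}
    (h : FP s t F x y) (hl : Tr s t x l z) (hn : (l.map Prod.fst).Nodup)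
    (hF : ∀ e ∈ l.map Prod.fst, e ∈ F) :
    FP s t (F \ (l.map Prod.fst).toFinset) z y := by
  induction l generalizing F x with
  | nil => simp only [Tr] at hl; subst hl; simpa using h
  | cons p l ih =>
    simp only [Tr] at hl
    simp only [List.map_cons, List.nodup_cons] at hn
    have h1 := FP_erase h p.1 (hF _ (by simp)) p.2 hl.1
    have h2 := ih h1 hl.2 hn.2 (by
      intro e he
      refine Finset.mem_erase.2 ⟨?_, hF e (by simp only [List.map_cons, List.mem_cons]; exact Or.inr he)⟩
      rintro rfl; exact hn.1 he)
    convert h2 using 1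
    ext e
    simp only [Finset.mem_sdiff, List.mem_toFinset, Finset.mem_erase, List.map_cons, List.mem_cons]
    tauto

open Classical in
theorem trail_exists {W E : Type*} {s t : E → W} (n : ℕ) (F : Finset E) (hn : F.card = n) (x y : W)
    (h : FP s t F x y) :
    ∃ l : List (E × Bool), Tr s t x l y ∧ (l.map Prod.fst).Nodup ∧ ∀ e ∈ l.map Prod.fst, e ∈ F := by
  induction n generalizing F x with
  | zero =>
    have : F = ∅ := Finset.card_eq_zero.1 hn
    subst this
    refine ⟨[], ?_, by simp, by simp⟩
    simp only [Tr]
    by_contra hxy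
    have := h x
    simp [Ne.symm hxy] at this
  | succ n ih =>
    by_cases hxy : x = y
    · exact ⟨[], hxy, by simp, by simp⟩
    · have h1 := h x
      have : ∃ e ∈ F, (s e = x ∨ t e = x) := by
        by_contra hc
        push Not at hc
        rw [Finset.sum_eq_zero] at h1
        · simp [Ne.symm hxy] at h1
        · intro e he
          simp [hc e he]
      obtain ⟨e, he, hst⟩ := this
      have : ∃ d, st s t e d = x := by
        rcases hst with h | h
        · exact ⟨true, by simpa [st] using h⟩
        · exact ⟨false, by simpa [st] using h⟩
      obtain ⟨d, hd⟩ := this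
      obtain ⟨l, hl1, hl2, hl3⟩ := ih (F.erase e) (by rw [Finset.card_erase_of_mem he, hn]; rfl) _
        (FP_erase h e he d hd)
      refine ⟨(e, d) :: l, ⟨hd, hl1⟩, ?_, ?_⟩
      · simp only [List.map_cons, List.nodup_cons]
        exact ⟨fun hh => by simpa using hl3 e hh, hl2⟩
      · intro e' he'
        simp only [List.map_cons, List.mem_cons] at he'
        rcases he' with rfl | h'
        · exact he
        · exact Finset.mem_of_mem_erase (hl3 _ h')

open Classical in
theorem finite_euler {W E : Type*} {s t : E → W} (F : Finset E) (x y : W)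
    (h : FP s t F x y)
    (hc : ∀ S : Set W, x ∈ S → (∀ e ∈ F, (s e ∈ S ↔ t e ∈ S)) → ∀ e ∈ F, s e ∈ S) :
    ∃ l : List (E × Bool), Tr s t x l y ∧ (l.map Prod.fst).Nodup ∧
      ∀ e, e ∈ l.map Prod.fst ↔ e ∈ F := by
  let P : ℕ → Prop := fun n => ∃ l : List (E × Bool), Tr s t x l y ∧ (l.map Prod.fst).Nodup ∧
      (∀ e ∈ l.map Prod.fst, e ∈ F) ∧ l.length = n
  have hb : ∀ n, P n → n ≤ F.card := by
    rintro n ⟨l, -, h2, h3, rfl⟩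
    have : (l.map Prod.fst).toFinset ⊆ F := fun e he => h3 e (List.mem_toFinset.1 he)
    have := Finset.card_le_card this
    rw [List.toFinset_card_of_nodup h2] at this
    simpa using this
  obtain ⟨l0, a1, a2, a3⟩ := trail_exists _ F rfl x y h
  have hP := Nat.findGreatest_spec (P := P) (hb _ ⟨l0, a1, a2, a3, rfl⟩) ⟨l0, a1, a2, a3, rfl⟩
  have hmax : ∀ n, P n → n ≤ Nat.findGreatest P F.card := fun n hn => Nat.le_findGreatest (hb n hn) hn
  obtain ⟨l, b1, b2, b3, b4⟩ := hP
  refine ⟨l, b1, b2, fun e => ⟨b3 e, ?_⟩⟩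
  by_contra hcon
  push Not at hcon
  obtain ⟨heF, hel⟩ := hcon
  let S : Set W := {w | ∃ l1 l2, l = l1 ++ l2 ∧ Tr s t x l1 w ∧ Tr s t w l2 y}
  have hxS : x ∈ S := ⟨[], l, rfl, rfl, b1⟩
  have hused : ∀ e ∈ l.map Prod.fst, s e ∈ S ∧ t e ∈ S := by
    intro e he
    obtain ⟨⟨e', d⟩, hp, rfl⟩ := List.mem_map.1 he
    obtain ⟨l1, l2, rfl⟩ := List.append_of_mem hp
    obtain ⟨z, hz1, hz2⟩ := Tr_append.1 b1
    have A : st s t e' d ∈ S := by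
      refine ⟨l1, _, rfl, ?_, ?_⟩
      · rw [hz2.1]; exact hz1
      · exact ⟨rfl, hz2.2⟩
    have B : st s t e' (!d) ∈ S := by
      refine ⟨l1 ++ [(e', d)], l2, by simp, ?_, hz2.2⟩
      exact Tr_append.2 ⟨z, hz1, hz2.1, rfl⟩
    cases d
    · exact ⟨by simpa [st] using B, by simpa [st] using A⟩
    · exact ⟨by simpa [st] using A, by simpa [st] using B⟩
  have htouch : ∃ e ∈ F, e ∉ l.map Prod.fst ∧ ∃ d, st s t e d ∈ S := by
    by_contra hno
    push Not at hno
    have := hc S hxS (by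
      intro e' he'
      by_cases hel' : e' ∈ l.map Prod.fst
      · exact ⟨fun _ => (hused e' hel').2, fun _ => (hused e' hel').1⟩
      · exact ⟨fun hh => absurd (by simpa [st] using hh) (hno e' he' hel' true),
          fun hh => absurd (by simpa [st] using hh) (hno e' he' hel' false)⟩) e heF
    exact hno e heF hel true (by simpa [st] using this)
  obtain ⟨e1, he1F, he1l, d, l1, l2, hl12, hw1, hw2⟩ := htouch
  have p1 := FP_list l h b1 b2 b3
  set U := F \ (l.map Prod.fst).toFinset with hU
  have p2 : FP s t U (st s t e1 d) (st s t e1 d) := by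
    intro w
    rw [p1 w, z2, z2]
  have he1U : e1 ∈ U := by
    rw [hU, Finset.mem_sdiff, List.mem_toFinset]; exact ⟨he1F, he1l⟩
  obtain ⟨l', c1, c2, c3⟩ := trail_exists _ _ rfl _ _ (FP_erase p2 e1 he1U d rfl)
  have key : P (l.length + (l'.length + 1)) := by
    refine ⟨l1 ++ ((e1, d) :: l' ++ l2), ?_, ?_, ?_, ?_⟩
    · refine Tr_append.2 ⟨_, hw1, ?_⟩
      exact Tr_append.2 ⟨_, ⟨rfl, c1⟩, hw2⟩
    · have hperm : (l1 ++ ((e1, d) :: l' ++ l2)).Perm (((e1, d) :: l') ++ l) := by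
        rw [hl12]
        refine (List.perm_append_comm_assoc _ _ _)
      refine ((hperm.map Prod.fst).nodup_iff).2 ?_
      rw [List.map_append, List.nodup_append']
      refine ⟨?_, b2, ?_⟩
      · simp only [List.map_cons, List.nodup_cons]
        exact ⟨fun hh => by simpa using c3 _ hh, c2⟩
      · intro e he hel'
        simp only [List.map_cons, List.mem_cons] at he
        have : e ∈ U := by
          rcases he with rfl | h'
          · exact he1U
          · exact Finset.mem_of_mem_erase (c3 _ h')
        rw [hU, Finset.mem_sdiff, List.mem_toFinset] at this
        exact this.2 hel'
    · intro e he
      simp only [List.map_append, List.map_cons, List.mem_append, List.mem_cons] at he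
      have hl : ∀ e, e ∈ l1.map Prod.fst ∨ e ∈ l2.map Prod.fst → e ∈ F := by
        intro e h; apply b3; rw [hl12, List.map_append, List.mem_append]; exact h
      rcases he with h' | (h' | h') | h'
      · exact hl _ (Or.inl h')
      · exact h' ▸ he1F
      · exact (Finset.mem_sdiff.1 (Finset.mem_of_mem_erase (c3 _ h'))).1
      · exact hl _ (Or.inr h')
    · rw [hl12]; simp; omega
  have := hmax _ key
  omega

end GLP
end

section
open Set Topology Filter Function

namespace GLP

/-- edges crossing `A` -/
def cu {V E : Type*} (s t : E → V) (A : Set V) : Set E := {e | ¬ (s e ∈ A ↔ t e ∈ A)}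

open Classical in
/-- indicator -/
noncomputable def ind {V : Type*} (A : Set V) (v : V) : ℝ := if v ∈ A then 1 else 0

/-- increment along directed edge -/
noncomputable def df {V E : Type*} (s t : E → V) (A : Set V) (e : E) (d : Bool) : ℝ :=
  ind A (st s t e (!d)) - ind A (st s t e d)

theorem df_zero {V E : Type*} {s t : E → V} {A : Set V} {e : E} (h : e ∉ cu s t A) (d : Bool) :
    df s t A e d = 0 := by
  simp only [cu, mem_ofPred_eq, not_not] at h
  by_cases h2 : t e ∈ A <;> cases d <;> simp [df, st, ind, h, h2]

theorem Tr_sum {W E : Type*} {s t : E → W} (g : W → ℝ) {x z : W} {l : List (E × Bool)}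
    (h : Tr s t x l z) :
    (l.map (fun p => g (st s t p.1 (!p.2)) - g (st s t p.1 p.2))).sum = g z - g x := by
  induction l generalizing x with
  | nil => simp only [Tr] at h; simp [h]
  | cons p l ih =>
    simp only [Tr] at h
    rw [List.map_cons, List.sum_cons, ih h.2, h.1]; ring

open Classical in
theorem finite_level {V E : Type*} [TopologicalSpace V] [Countable E] (s t : E → V)
    (hfin : ∀ A, IsClopen A → (cu s t A).Finite) (x y : V)
    (hpar : ∀ A, IsClopen A → (Even (cu s t A).ncard ↔ (x ∈ A ↔ y ∈ A)))
    (hconn : ∀ A, IsClopen A → x ∈ A → cu s t A = ∅ → ∀ e, s e ∈ A)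
    (𝒜 : Finset (Set V)) (F0 : Finset E) :
    ∃ (k : E → ℕ) (d : E → Bool), Injective k ∧ ∀ e ∈ F0, ∀ A ∈ 𝒜, ∀ hA : IsClopen A,
      ind A (st s t e (d e)) = ind A x +
        ∑ e' ∈ (hfin A hA).toFinset with k e' < k e, df s t A e' (d e') := by
  let ι := {A // A ∈ 𝒜.filter (fun A => IsClopen A)}
  letI : Fintype ι := inferInstanceAs (Fintype {A // A ∈ 𝒜.filter (fun A => IsClopen A)})
  have hι : ∀ A : ι, IsClopen A.1 := fun A => (Finset.mem_filter.1 A.2).2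
  let π : V → Set ι := fun v => {A | v ∈ A.1}
  have hπ1 : ∀ w : Set ι, IsClopen (π ⁻¹' {w}) := by
    intro w
    have : π ⁻¹' {w} = ⋂ A : ι, (if A ∈ w then A.1 else (A.1)ᶜ) := by
      ext v
      simp only [mem_preimage, mem_singleton_iff, mem_iInter]
      constructor
      · rintro rfl A
        by_cases h : v ∈ A.1
        · have : A ∈ π v := h
          simp [this, h]
        · have : A ∉ π v := h
          simp [this, h]
      · intro h
        ext A
        have := h A
        by_cases hA : A ∈ w
        · simp only [hA, if_true] at this; exact ⟨fun _ => hA, fun _ => this⟩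
        · simp only [hA, if_false] at this; exact ⟨fun hh => absurd hh this, fun hh => absurd hh hA⟩
    rw [this]
    refine isClopen_iInter_of_finite (fun A => ?_)
    split_ifs
    · exact hι A
    · exact (hι A).compl
  have hπ : ∀ S : Set (Set ι), IsClopen (π ⁻¹' S) := by
    intro S
    have : π ⁻¹' S = ⋃ w ∈ S, π ⁻¹' {w} := by ext v; simp
    rw [this]
    exact S.toFinite.isClopen_biUnion (fun w _ => hπ1 w)
  let F : Finset E := F0 ∪ Finset.univ.biUnion (fun A : ι => (hfin A.1 (hι A)).toFinset)
  have hFc : ∀ A ∈ 𝒜, IsClopen A → ∀ e ∈ cu s t A, e ∈ F := by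
    intro A hA hA' e he
    refine Finset.mem_union_right _ (Finset.mem_biUnion.2 ⟨⟨A, Finset.mem_filter.2 ⟨hA, hA'⟩⟩, Finset.mem_univ _, ?_⟩)
    simpa using he
  have hF : ∀ e, e ∉ F → π (s e) = π (t e) := by
    intro e he
    ext A
    by_contra hc
    exact he (hFc A.1 (Finset.mem_filter.1 A.2).1 (hι A) e hc)
  have hFP : FP (fun e => π (s e)) (fun e => π (t e)) F (π x) (π y) := by
    intro w
    set A := π ⁻¹' {w} with hAdef
    have hAc : IsClopen A := hπ1 w
    have hmem : ∀ v, π v = w ↔ v ∈ A := fun v => by simp [hAdef]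
    have h1 : ∀ e, ((if π (s e) = w then (1 : ZMod 2) else 0) + (if π (t e) = w then 1 else 0))
        = if e ∈ cu s t A then 1 else 0 := by
      intro e
      simp only [hmem, cu, mem_ofPred_eq]
      by_cases a : s e ∈ A <;> by_cases b : t e ∈ A <;> simp [a, b, z2]
    refine (Finset.sum_congr rfl (g := fun e => if e ∈ cu s t A then (1 : ZMod 2) else 0)
      (fun e _ => by convert h1 e)).trans ?_
    rw [← Finset.sum_filter, Finset.sum_const, nsmul_eq_mul, mul_one]
    have h2 : (F.filter (· ∈ cu s t A)).card = (cu s t A).ncard := by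
      rw [← Set.ncard_coe_finset]
      congr 1
      ext e
      simp only [Finset.coe_filter, mem_ofPred_eq, and_iff_right_iff_imp]
      intro he
      by_contra hc
      apply he
      rw [← hmem, ← hmem, hF e hc]
    rw [h2]
    simp only [hmem]
    have := hpar A hAc
    by_cases hev : Even (cu s t A).ncard
    · rw [(ZMod.natCast_eq_zero_iff_even).2 hev]
      have := this.1 hev
      by_cases a : x ∈ A
      · simp [a, this.1 a, z2]
      · have b : y ∉ A := fun b => a (this.2 b)
        simp [a, b]
    · have h3 := mt this.2 hev
      rw [(ZMod.natCast_eq_one_iff_odd).2 (Nat.not_even_iff_odd.1 hev)]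
      by_cases a : x ∈ A <;> by_cases b : y ∈ A <;> simp [a, b] at h3 ⊢
  obtain ⟨l, hl, hnd, hlF⟩ := finite_euler F (π x) (π y) hFP (by
    intro S hx hS e _
    refine hconn (π ⁻¹' S) (hπ S) hx ?_ e
    ext e'
    simp only [cu, mem_ofPred_eq, mem_empty_iff_false, iff_false, not_not, mem_preimage]
    by_cases h : e' ∈ F
    · exact hS e' h
    · rw [hF e' h])
  obtain ⟨ν, hν⟩ := exists_injective_nat E
  set L := l.map Prod.fst with hL
  let k : E → ℕ := fun e => if e ∈ L then L.idxOf e else L.length + ν e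
  let d : E → Bool := fun e => if h : ∃ d, (e, d) ∈ l then h.choose else true
  have hd : ∀ p ∈ l, d p.1 = p.2 := by
    rintro ⟨e, b⟩ hp
    have hex : ∃ d, (e, d) ∈ l := ⟨b, hp⟩
    have : d e = hex.choose := by simp only [d]; rw [dif_pos hex]
    simp only [this]
    have h2 := hex.choose_spec
    have := List.inj_on_of_nodup_map hnd h2 hp rfl
    simpa using this
  have hk : Injective k := by
    intro a b hab
    simp only [k] at hab
    split_ifs at hab with h1 h2 h2
    · exact (List.idxOf_inj h1).1 hab
    · have := List.idxOf_lt_length_iff.2 h1; omega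
    · have := List.idxOf_lt_length_iff.2 h2; omega
    · exact hν (by omega)
  refine ⟨k, d, hk, ?_⟩
  intro e he A hA hAc
  have heL : e ∈ L := (hlF e).2 (Finset.mem_union_left _ he)
  obtain ⟨⟨e1, b⟩, hp, rfl⟩ := List.mem_map.1 heL
  have hdb := hd _ hp
  simp only at hdb he heL ⊢
  obtain ⟨l1, l2, hsplit⟩ := List.append_of_mem hp
  rw [hsplit] at hl
  obtain ⟨z, hz1, hz2⟩ := Tr_append.1 hl
  let A' : ι := ⟨A, Finset.mem_filter.2 ⟨hA, hAc⟩⟩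
  let g : Set ι → ℝ := fun w => if A' ∈ w then 1 else 0
  have hg : ∀ v, g (π v) = ind A v := fun v => rfl
  have hst : ∀ e d, st (fun e => π (s e)) (fun e => π (t e)) e d = π (st s t e d) := by
    intro e d; cases d <;> simp [st]
  have hsum := Tr_sum g hz1
  simp only [hst, hg] at hsum
  have hz : g z = ind A (st s t e1 (d e1)) := by
    rw [← hz2.1, hst, hg, hdb]
  have hLs : L = l1.map Prod.fst ++ e1 :: l2.map Prod.fst := by rw [hL, hsplit]; simp
  have hn1 : e1 ∉ l1.map Prod.fst := by
    rw [hLs] at hnd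
    intro hh
    exact (List.nodup_append'.1 hnd).2.2 hh (by simp)
  have hnd1 : (l1.map Prod.fst).Nodup := by
    rw [hLs] at hnd; exact (List.nodup_append'.1 hnd).1
  have hke : k e1 = l1.length := by
    simp only [k, heL, if_true]
    rw [hLs, List.idxOf_append_of_notMem hn1]; simp
  have hlt : ∀ e', k e' < k e1 ↔ e' ∈ l1.map Prod.fst := by
    intro e'
    rw [hke]
    constructor
    · intro h
      by_contra hc
      simp only [k] at h
      split_ifs at h with h1
      · rw [hLs, List.idxOf_append_of_notMem hc] at h
        simp at h
      · rw [hLs] at h; simp at h; omega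
    · intro h
      have h1 : e' ∈ L := by rw [hLs]; simp only [List.mem_append]; exact Or.inl h
      simp only [k, h1, if_true]
      rw [hLs, List.idxOf_append_of_mem h]
      simpa using List.idxOf_lt_length_iff.2 h
  have hfs : ∑ e' ∈ (hfin A hAc).toFinset with k e' < k e1, df s t A e' (d e')
      = ∑ e' ∈ (l1.map Prod.fst).toFinset, df s t A e' (d e') := by
    refine Finset.sum_subset ?_ ?_
    · intro e' h'
      simp only [Finset.mem_filter] at h'
      exact List.mem_toFinset.2 ((hlt e').1 h'.2)
    · intro e' h' h''
      apply df_zero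
      intro hcu
      apply h''
      simp only [Finset.mem_filter, Finite.mem_toFinset]
      exact ⟨hcu, (hlt e').2 (List.mem_toFinset.1 h')⟩
  rw [hfs, List.sum_toFinset _ hnd1, List.map_map]
  have : l1.map ((fun e' => df s t A e' (d e')) ∘ Prod.fst) =
      l1.map (fun p => ind A (st s t p.1 (!p.2)) - ind A (st s t p.1 p.2)) := by
    apply List.map_congr_left
    intro p hpl
    simp only [comp, df]
    rw [hd p (by rw [hsplit]; simp [hpl])]
  rw [this, hsum, hz]
  have : g (π x) = ind A x := rfl
  linarith

open Classical in
theorem order_exists {V E : Type*} [TopologicalSpace V] [Countable E] (s t : E → V)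
    (hfin : ∀ A, IsClopen A → (cu s t A).Finite) (x y : V)
    (hpar : ∀ A, IsClopen A → (Even (cu s t A).ncard ↔ (x ∈ A ↔ y ∈ A)))
    (hconn : ∀ A, IsClopen A → x ∈ A → cu s t A = ∅ → ∀ e, s e ∈ A) :
    ∃ (lt : E → E → Prop) (d : E → Bool), (∀ e, ¬ lt e e) ∧
      (∀ a b c, lt a b → lt b c → lt a c) ∧ (∀ a b, a ≠ b → lt a b ∨ lt b a) ∧
      ∀ e A, ∀ hA : IsClopen A,
      ind A (st s t e (d e)) = ind A x +
        ∑ e' ∈ (hfin A hA).toFinset with lt e' e, df s t A e' (d e') := by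
  choose k d hk hs using fun Φ : Finset (Set V) × Finset E =>
    finite_level s t hfin x y hpar hconn Φ.1 Φ.2
  let U : Ultrafilter (Finset (Set V) × Finset E) := Ultrafilter.of atTop
  have hU : ∀ p : Finset (Set V) × Finset E → Prop, (∀ᶠ Φ in atTop, p Φ) → ∀ᶠ Φ in U, p Φ :=
    fun p hp => (Ultrafilter.of_le atTop) hp
  refine ⟨fun a b => ∀ᶠ Φ in U, k Φ a < k Φ b, fun e => decide (∀ᶠ Φ in U, d Φ e = true),
    ?_, ?_, ?_, ?_⟩
  · intro e h
    obtain ⟨Φ, h⟩ := h.exists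
    exact lt_irrefl _ h
  · intro a b c h1 h2
    filter_upwards [h1, h2] with Φ h1 h2 using h1.trans h2
  · intro a b hab
    rw [← Ultrafilter.eventually_or]
    exact Eventually.of_forall (fun Φ => lt_or_gt_of_ne (fun h => hab (hk Φ h)))
  · intro e A hA
    have hdd : ∀ e', ∀ᶠ Φ in U, d Φ e' = decide (∀ᶠ Φ in U, d Φ e' = true) := by
      intro e'
      by_cases h : ∀ᶠ Φ in U, d Φ e' = true
      · simpa [h] using h
      · have h2 := Ultrafilter.eventually_not.2 h
        filter_upwards [h2] with Φ h3
        simp only [h, decide_false]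
        simpa using h3
    have hll : ∀ e', ∀ᶠ Φ in U, (k Φ e' < k Φ e ↔ ∀ᶠ Φ in U, k Φ e' < k Φ e) := by
      intro e'
      by_cases h : ∀ᶠ Φ in U, k Φ e' < k Φ e
      · filter_upwards [h] with Φ h3
        simp [h, h3]
      · have h2 := Ultrafilter.eventually_not.2 h
        filter_upwards [h2] with Φ h3
        simp [h, h3]
    have h1 : ∀ᶠ Φ in U, ∀ e' ∈ (hfin A hA).toFinset,
        d Φ e' = decide (∀ᶠ Φ in U, d Φ e' = true) ∧
        (k Φ e' < k Φ e ↔ ∀ᶠ Φ in U, k Φ e' < k Φ e) := by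
      rw [Filter.eventually_all_finset]
      intro e' _
      exact (hdd e').and (hll e')
    have h2 : ∀ᶠ Φ : Finset (Set V) × Finset E in U, A ∈ Φ.1 ∧ e ∈ Φ.2 := by
      apply hU
      filter_upwards [eventually_ge_atTop (({A} : Finset (Set V)), ({e} : Finset E))] with Φ hΦ
      exact ⟨hΦ.1 (by simp), hΦ.2 (by simp)⟩
    obtain ⟨Φ, h1, h2, h3⟩ := (h1.and (h2.and (hdd e))).exists
    have := hs Φ e h2.2 A h2.1 hA
    rw [h3] at this
    rw [this]
    congr 1
    refine Finset.sum_congr ?_ ?_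
    · ext e'
      simp only [Finset.mem_filter]
      constructor
      · rintro ⟨a, b⟩; exact ⟨a, (h1 e' a).2.1 b⟩
      · rintro ⟨a, b⟩; exact ⟨a, (h1 e' a).2.2 b⟩
    · intro e' he'
      rw [(h1 e' (Finset.mem_filter.1 he').1).1]

end GLP
end

section
open Set Topology Filter Function

namespace GLP

/-- parity condition -/
def Par {V E : Type*} [TopologicalSpace V] (s t : E → V) (C : Set E) (x y : V) : Prop :=
  ∀ A, IsClopen A → (Even (cu s t A ∩ C).ncard ↔ (x ∈ A ↔ y ∈ A))
/-- connectivity condition -/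
def Conn {V E : Type*} [TopologicalSpace V] (s t : E → V) (C : Set E) (x : V) : Prop :=
  ∀ A, IsClopen A → x ∈ A → cu s t A ∩ C = ∅ → ∀ e ∈ C, s e ∈ A
/-- bond condition -/
def Bond {V E : Type*} [TopologicalSpace V] (s t : E → V) (C : Set E) : Prop :=
  ∀ e₁ ∈ C, ∀ e₂ ∈ C, e₁ ≠ e₂ → ∃ A, IsClopen A ∧ cu s t A ∩ C = {e₁, e₂}

theorem even_family {E ι : Type*} (D : ι → Set E) (n : ℕ) (K : Set E) (hK : K.Finite)
    (hn : K.ncard = n)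
    (h1 : ∀ e ∈ K, ∃! i, e ∈ D i) (h2 : ∀ i, Even (K ∩ D i).ncard) : Even K.ncard := by
  induction n using Nat.strong_induction_on generalizing K with
  | _ n ih =>
    rcases K.eq_empty_or_nonempty with rfl | ⟨e, he⟩
    · simp
    · obtain ⟨i, hi, -⟩ := h1 e he
      have hu := Set.ncard_inter_add_ncard_sdiff_eq_ncard K (D i) hK
      have hpos : 0 < (K ∩ D i).ncard := (Set.ncard_pos (hK.inter_of_left _)).2 ⟨e, he, hi⟩
      rw [← hu]
      refine (h2 i).add (ih (K \ D i).ncard (by omega) _ (hK.sdiff) rfl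
        (fun e' he' => h1 e' he'.1) (fun j => ?_))
      by_cases hij : j = i
      · subst hij
        have : (K \ D j) ∩ D j = ∅ := by ext; simp
        rw [this]; simp
      · have : (K \ D i) ∩ D j = K ∩ D j := by
          ext e'
          simp only [mem_inter_iff, Set.mem_sdiff]
          constructor
          · rintro ⟨⟨a, b⟩, c⟩; exact ⟨a, c⟩
          · rintro ⟨a, c⟩; exact ⟨⟨a, fun b => hij ((h1 e' a).unique c b)⟩, c⟩
        rw [this]; exact h2 j

theorem chain_finite {E : Type*} (c : Set (Set E)) (hc : IsChain (· ⊆ ·) c) (hne : c.Nonempty)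
    (K : Set E) (hK : K.Finite) (h : ∀ e ∈ K, ∃ C ∈ c, e ∉ C) : ∃ C ∈ c, ∀ e ∈ K, e ∉ C := by
  induction K, hK using Set.Finite.induction_on with
  | empty => obtain ⟨C, hC⟩ := hne; exact ⟨C, hC, by simp⟩
  | @insert e K _ _ ih =>
    obtain ⟨C1, h1, h1'⟩ := ih (fun e he => h e (mem_insert_of_mem _ he))
    obtain ⟨C2, h2, h2'⟩ := h e (mem_insert _ _)
    rcases hc.total h1 h2 with hh | hh
    · refine ⟨C1, h1, ?_⟩
      rintro a (rfl | ha)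
      · exact fun hb => h2' (hh hb)
      · exact h1' a ha
    · refine ⟨C2, h2, ?_⟩
      rintro a (rfl | ha)
      · exact h2'
      · exact fun hb => h1' a ha (hh hb)

theorem cu_compl {V E : Type*} (s t : E → V) (A : Set V) : cu s t Aᶜ = cu s t A := by
  ext e; simp only [cu, mem_ofPred_eq, mem_compl_iff]; tauto

theorem cu_symmDiff {V E : Type*} (s t : E → V) (A B : Set V) (e : E) :
    e ∈ cu s t (symmDiff A B) ↔ ¬ (e ∈ cu s t A ↔ e ∈ cu s t B) := by
  simp only [cu, mem_ofPred_eq, mem_symmDiff]; tauto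

theorem clopen_symmDiff {V : Type*} [TopologicalSpace V] {A B : Set V} (hA : IsClopen A)
    (hB : IsClopen B) : IsClopen (symmDiff A B) := by
  rw [Set.symmDiff_def]; exact (hA.diff hB).union (hB.diff hA)

section
variable {V E : Type*} [TopologicalSpace V] {s t : E → V}

theorem comb1 
    (hfin : ∀ A, IsClopen A → (cu s t A).Finite) (U : Set E) (x y : V)
    (hU : ∀ A, IsClopen A → cu s t A ∩ U = ∅ → (x ∈ A ↔ y ∈ A)) :
    ∃ C ⊆ U, Par s t C x y ∧ Conn s t C x ∧
      ∀ e ∈ C, ∃ A, IsClopen A ∧ x ∈ A ∧ y ∉ A ∧ cu s t A ∩ C = {e} := by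
  obtain ⟨C, hC⟩ := zorn_superset
    {C : Set E | C ⊆ U ∧ ∀ A, IsClopen A → cu s t A ∩ C = ∅ → (x ∈ A ↔ y ∈ A)} (by
      intro c hcS hc
      rcases c.eq_empty_or_nonempty with rfl | hne
      · exact ⟨U, ⟨subset_rfl, hU⟩, by simp⟩
      · refine ⟨⋂₀ c, ⟨?_, ?_⟩, fun C hC => sInter_subset_of_mem hC⟩
        · obtain ⟨C, hC⟩ := hne
          exact (sInter_subset_of_mem hC).trans (hcS hC).1
        · intro A hA hAc
          obtain ⟨C, hC, hC'⟩ := chain_finite c hc hne (cu s t A) (hfin A hA) (by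
            intro e he
            by_contra hcon
            push Not at hcon
            have : e ∈ cu s t A ∩ ⋂₀ c := ⟨he, fun C hC => hcon C hC⟩
            rw [hAc] at this; exact this)
          refine (hcS hC).2 A hA ?_
          ext e
          simp only [mem_inter_iff, mem_empty_iff_false, iff_false, not_and]
          exact hC' e)
  have hCU := hC.prop.1
  have hCs := hC.prop.2
  have hbr : ∀ e ∈ C, ∃ A, IsClopen A ∧ x ∈ A ∧ y ∉ A ∧ cu s t A ∩ C = {e} := by
    intro e he
    have hn : ¬ ∀ A, IsClopen A → cu s t A ∩ (C \ {e}) = ∅ → (x ∈ A ↔ y ∈ A) := by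
      intro hcon
      have := hC.le_of_le (y := C \ {e}) ⟨sdiff_subset.trans hCU, hcon⟩ sdiff_subset
      exact (this he).2 rfl
    push Not at hn
    obtain ⟨A, hA, hA1, hA2⟩ := hn
    have hcut : cu s t A ∩ C = {e} := by
      have hne : (cu s t A ∩ C).Nonempty := by
        rw [nonempty_iff_ne_empty]
        intro h0
        have := hCs A hA h0
        tauto
      have hsub : cu s t A ∩ C ⊆ {e} := by
        rintro e' ⟨h1, h2⟩
        by_contra h3
        have : e' ∈ cu s t A ∩ (C \ {e}) := ⟨h1, h2, h3⟩
        rw [hA1] at this; exact this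
      exact (hne.subset_singleton_iff).1 hsub
    by_cases hx : x ∈ A
    · refine ⟨A, hA, hx, ?_, hcut⟩
      tauto
    · refine ⟨Aᶜ, hA.compl, hx, ?_, by rw [cu_compl]; exact hcut⟩
      simp only [mem_compl_iff, not_not]; tauto
  refine ⟨C, hCU, ?_, ?_, hbr⟩
  · have key : ∀ n, ∀ A, IsClopen A → (cu s t A ∩ C).ncard = n → (Even n ↔ (x ∈ A ↔ y ∈ A)) := by
      intro n
      induction n with
      | zero =>
        intro A hA h0
        rw [Set.ncard_eq_zero ((hfin A hA).inter_of_left _)] at h0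
        have := hCs A hA h0
        simp [this]
      | succ n ih =>
        intro A hA h0
        have hne : (cu s t A ∩ C).Nonempty := by
          rw [← Set.ncard_pos ((hfin A hA).inter_of_left _)]; omega
        obtain ⟨e, he⟩ := hne
        obtain ⟨B, hB, hxB, hyB, hBc⟩ := hbr e he.2
        have h1 : cu s t (symmDiff A B) ∩ C = (cu s t A ∩ C) \ {e} := by
          ext e'
          have : e' ∈ cu s t B ∩ C ↔ e' = e := by rw [hBc]; simp
          simp only [mem_inter_iff, cu_symmDiff, Set.mem_sdiff, mem_singleton_iff] at this ⊢
          by_cases hee : e' = e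
          · subst hee; have := he.1; have := he.2; tauto
          · have h5 : ¬ (e' ∈ cu s t B ∧ e' ∈ C) := fun h => hee (this.1 h)
            clear * - h5 hee
            by_cases h6 : e' ∈ C <;> by_cases h7 : e' ∈ cu s t A <;> by_cases h8 : e' ∈ cu s t B <;> simp_all
        have h2 := ih (symmDiff A B) (clopen_symmDiff hA hB) (by
          rw [h1, Set.ncard_sdiff_singleton_of_mem he, h0]; rfl)
        rw [Nat.even_add_one, h2]
        simp only [mem_symmDiff]
        tauto
    exact fun A hA => key _ A hA rfl
  · intro A hA hxA hAc e he
    by_contra hs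
    obtain ⟨B, hB, hxB, hyB, hBc⟩ := hbr e he
    have hno : ∀ e' ∈ C, (s e' ∈ A ↔ t e' ∈ A) := by
      intro e' he'
      by_contra hcon
      have : e' ∈ cu s t A ∩ C := ⟨hcon, he'⟩
      rw [hAc] at this; exact this
    have hyA := (hCs A hA hAc).1 hxA
    have := hCs (B ∪ Aᶜ) (hB.union hA.compl) (by
      ext e'
      simp only [mem_inter_iff, mem_empty_iff_false, iff_false, not_and]
      intro h1 h2
      have h3 : e' ∈ cu s t B ∩ C ↔ e' = e := by rw [hBc]; simp
      have h4 := hno e' h2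
      simp only [cu, mem_inter_iff, mem_ofPred_eq, mem_union, mem_compl_iff] at h1 h3
      by_cases hee : e' = e
      · subst hee; tauto
      · tauto)
    simp only [mem_union, mem_compl_iff] at this
    tauto

theorem bond_of_bridge {C : Set E} {x y : V}
    (h : ∀ e ∈ C, ∃ A, IsClopen A ∧ x ∈ A ∧ y ∉ A ∧ cu s t A ∩ C = {e}) : Bond s t C := by
  intro e₁ h1 e₂ h2 hne
  obtain ⟨A, hA, -, -, hA'⟩ := h e₁ h1
  obtain ⟨B, hB, -, -, hB'⟩ := h e₂ h2
  refine ⟨symmDiff A B, clopen_symmDiff hA hB, ?_⟩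
  ext e
  have a : e ∈ cu s t A ∩ C ↔ e = e₁ := by rw [hA']; simp
  have b : e ∈ cu s t B ∩ C ↔ e = e₂ := by rw [hB']; simp
  simp only [mem_inter_iff, cu_symmDiff, mem_insert_iff, mem_singleton_iff] at a b ⊢
  by_cases e = e₁
  · subst e; tauto
  · by_cases e = e₂
    · subst e; tauto
    · tauto

theorem comb2 
    (hfin : ∀ A, IsClopen A → (cu s t A).Finite) (U : Set E)
    (hU : ∀ A, IsClopen A → Even (cu s t A ∩ U).ncard) (e : E) (he : e ∈ U) :
    ∃ C ⊆ U, e ∈ C ∧ Par s t C (s e) (s e) ∧ Conn s t C (s e) ∧ Bond s t C := by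
  by_cases hst : s e = t e
  · refine ⟨{e}, by simpa using he, rfl, ?_, ?_, ?_⟩
    · intro A hA
      have : cu s t A ∩ {e} = ∅ := by
        ext e'
        simp only [mem_inter_iff, mem_empty_iff_false, iff_false, not_and, mem_singleton_iff]
        rintro h rfl
        simp [cu, hst] at h
      simp [this]
    · rintro A hA h1 - e' rfl; exact h1
    · rintro e₁ rfl e₂ rfl h; exact absurd rfl h
  · obtain ⟨C, hCU, hP, hC, hbr⟩ := comb1 hfin (U \ {e}) (s e) (t e) (by
      intro A hA h0
      by_contra hcon
      have : cu s t A ∩ U = {e} := by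
        ext e'
        simp only [mem_inter_iff, mem_singleton_iff]
        constructor
        · rintro ⟨h1, h2⟩
          by_contra h3
          have : e' ∈ cu s t A ∩ (U \ {e}) := ⟨h1, h2, h3⟩
          rw [h0] at this; exact this
        · rintro rfl; exact ⟨hcon, he⟩
      have h2 := hU A hA
      rw [this] at h2
      simp at h2)
    have heC : e ∉ C := fun h => (hCU h).2 rfl
    have hcut1 : ∀ A, e ∈ cu s t A → cu s t A ∩ insert e C = insert e (cu s t A ∩ C) := by
      intro A h; rw [Set.inter_insert_of_mem h]
    have hcut2 : ∀ A, e ∉ cu s t A → cu s t A ∩ insert e C = cu s t A ∩ C := by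
      intro A h; rw [Set.inter_insert_of_notMem h]
    refine ⟨insert e C, ?_, mem_insert _ _, ?_, ?_, ?_⟩
    · exact insert_subset he (fun a ha => (hCU ha).1)
    · intro A hA
      simp only [iff_self, iff_true]
      by_cases h : e ∈ cu s t A
      · rw [hcut1 A h, Set.ncard_insert_of_notMem (fun hh => heC hh.2) ((hfin A hA).inter_of_left _),
          Nat.even_add_one, hP A hA]
        exact h
      · rw [hcut2 A h, hP A hA]
        simpa [cu] using h
    · intro A hA hs h0 e' he'
      rcases he' with rfl | he'
      · exact hs
      · refine hC A hA hs ?_ e' he'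
        rw [← subset_empty_iff] at h0 ⊢
        exact (inter_subset_inter_right _ (subset_insert _ _)).trans h0
    · have hb := bond_of_bridge hbr
      have h1 : ∀ e' ∈ C, ∃ A, IsClopen A ∧ cu s t A ∩ insert e C = {e, e'} := by
        intro e' he'
        obtain ⟨A, hA, hx, hy, hA'⟩ := hbr e' he'
        refine ⟨A, hA, ?_⟩
        rw [hcut1 A (by simp [cu, hx, hy]), hA']
      rintro e₁ (rfl | h₁) e₂ (rfl | h₂) hne
      · exact absurd rfl hne
      · exact h1 e₂ h₂
      · obtain ⟨A, hA, h⟩ := h1 e₁ h₁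
        exact ⟨A, hA, by rw [h, pair_comm]⟩
      · obtain ⟨A, hA, -, -, hA'⟩ := hbr e₁ h₁
        obtain ⟨B, hB, hxB, hyB, hB'⟩ := hbr e₂ h₂
        obtain ⟨A, hA, hxA, hyA, hA'⟩ := hbr e₁ h₁
        refine ⟨symmDiff A B, clopen_symmDiff hA hB, ?_⟩
        rw [hcut2]
        · ext e'
          have a : e' ∈ cu s t A ∩ C ↔ e' = e₁ := by rw [hA']; simp
          have b : e' ∈ cu s t B ∩ C ↔ e' = e₂ := by rw [hB']; simp
          simp only [mem_inter_iff, cu_symmDiff, mem_insert_iff, mem_singleton_iff] at a b ⊢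
          by_cases e' = e₁
          · subst e'; tauto
          · by_cases e' = e₂
            · subst e'; tauto
            · tauto
        · simp [cu, mem_symmDiff, hxA, hyA, hxB, hyB]

theorem comb3 
    (hfin : ∀ A, IsClopen A → (cu s t A).Finite) (U : Set E)
    (hU : ∀ A, IsClopen A → Even (cu s t A ∩ U).ncard) :
    ∃ 𝒞 : Set (Set E), (∀ C ∈ 𝒞, C ⊆ U ∧ C.Nonempty ∧ ∃ v, Par s t C v v ∧ Conn s t C v ∧ Bond s t C) ∧
      (∀ e ∈ U, ∃! C : 𝒞, e ∈ C.1) := by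
  let Q : Set E → Prop := fun C => C ⊆ U ∧ C.Nonempty ∧ ∃ v, Par s t C v v ∧ Conn s t C v ∧ Bond s t C
  obtain ⟨𝒞, hmax⟩ := zorn_subset
    {𝒞 : Set (Set E) | (∀ C ∈ 𝒞, Q C) ∧ ∀ C ∈ 𝒞, ∀ D ∈ 𝒞, ∀ e, e ∈ C → e ∈ D → C = D} (by
      intro c hcS hc
      refine ⟨⋃₀ c, ⟨?_, ?_⟩, fun C hC => subset_sUnion_of_mem hC⟩
      · rintro C ⟨K, hK, hCK⟩; exact (hcS hK).1 C hCK
      · rintro C ⟨K, hK, hCK⟩ D ⟨L, hL, hDL⟩ e h1 h2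
        rcases hc.total hK hL with h | h
        · exact (hcS hL).2 C (h hCK) D hDL e h1 h2
        · exact (hcS hK).2 C hCK D (h hDL) e h1 h2)
  have hQ := hmax.prop.1
  have hD := hmax.prop.2
  have hcover : ∀ e ∈ U, ∃ C ∈ 𝒞, e ∈ C := by
    by_contra hcon
    push Not at hcon
    obtain ⟨e, heU, he⟩ := hcon
    obtain ⟨C, hC1, hC2, hC3⟩ := comb2 hfin (U \ ⋃₀ 𝒞) (by
      intro A hA
      have hfA := hfin A hA
      have e1 : Even ((cu s t A ∩ U) ∩ ⋃₀ 𝒞).ncard := by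
        refine even_family (fun C : 𝒞 => C.1) _ _ ((hfA.inter_of_left _).inter_of_left _) rfl ?_ ?_
        · rintro e ⟨h1, C, hC, heC⟩
          exact ⟨⟨C, hC⟩, heC, fun D hD' => Subtype.ext (hD _ D.2 _ hC e hD' heC)⟩
        · rintro ⟨C, hC⟩
          obtain ⟨h1, h2, v, h3, -⟩ := hQ C hC
          have : ((cu s t A ∩ U) ∩ ⋃₀ 𝒞) ∩ C = cu s t A ∩ C := by
            ext e
            constructor
            · rintro ⟨⟨⟨a, -⟩, -⟩, b⟩; exact ⟨a, b⟩
            · rintro ⟨a, b⟩; exact ⟨⟨⟨a, h1 b⟩, C, hC, b⟩, b⟩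
          simp only [this]
          exact (h3 A hA).2 Iff.rfl
      have e2 := Set.ncard_inter_add_ncard_sdiff_eq_ncard (cu s t A ∩ U) (⋃₀ 𝒞) (hfA.inter_of_left _)
      have e3 := hU A hA
      rw [← e2, Nat.even_add] at e3
      rw [← inter_sdiff_assoc]
      exact e3.1 e1) e ⟨heU, fun ⟨C, hC, h⟩ => he C hC h⟩
    have := hmax.le_of_ge (y := insert C 𝒞) ⟨?_, ?_⟩ (subset_insert _ _)
    · exact he C (this (mem_insert _ _)) hC2
    · rintro D (rfl | hD')
      · exact ⟨hC1.trans sdiff_subset, ⟨e, hC2⟩, _, hC3⟩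
      · exact hQ D hD'
    · rintro D (rfl | h1) D' (rfl | h2) e' a b
      · rfl
      · exact absurd ⟨D', h2, b⟩ (hC1 a).2
      · exact absurd ⟨D, h1, a⟩ (hC1 b).2
      · exact hD D h1 D' h2 e' a b
  refine ⟨𝒞, hQ, fun e he => ?_⟩
  obtain ⟨C, hC, heC⟩ := hcover e he
  exact ⟨⟨C, hC⟩, heC, fun D hD' => Subtype.ext (hD _ D.2 _ hC e hD' heC)⟩
end

end GLP
end

section
open Set Topology Filter Function

namespace GLP

/-- edge system -/
structure ES (X : Type*) [TopologicalSpace X] (V : Set X) (E : Type*) where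
  γ : E → ℝ → X
  cont : ∀ e, Continuous (γ e)
  g0 : ∀ e, γ e 0 ∈ V
  g1 : ∀ e, γ e 1 ∈ V
  inV : ∀ e, ∀ s ∈ Ioo (0:ℝ) 1, γ e s ∉ V
  surj : ∀ p, p ∉ V → ∃ e, ∃ s ∈ Ioo (0:ℝ) 1, γ e s = p
  inj : ∀ e e' s s', s ∈ Ioo (0:ℝ) 1 → s' ∈ Ioo (0:ℝ) 1 → γ e s = γ e' s' → e = e' ∧ s = s'
  op : ∀ e, IsOpen (γ e '' Ioo 0 1)

theorem ind_01 {V : Type*} (A : Set V) (v : V) : ind A v = 0 ∨ ind A v = 1 := by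
  unfold ind; split_ifs <;> simp

theorem urys {X : Type*} [TopologicalSpace X] [CompactSpace X] [T2Space X] {V : Set X}
    (hV : IsClosed V) (A : Set V) (hA : IsClopen A) :
    ∃ h : X → ℝ, Continuous h ∧ ∀ v : V, h v = ind A v := by
  have c1 : IsClosed (Subtype.val '' A : Set X) := hV.isClosedMap_subtype_val _ hA.1
  have c2 : IsClosed (Subtype.val '' Aᶜ : Set X) := hV.isClosedMap_subtype_val _ hA.compl.1
  obtain ⟨h, h0, h1, -⟩ := exists_continuous_zero_one_of_isClosed c2 c1 (by
    rw [Set.disjoint_left]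
    rintro p ⟨a, ha, rfl⟩ ⟨b, hb, hab⟩
    have := Subtype.ext hab
    subst this
    exact ha hb)
  refine ⟨h, h.continuous, fun v => ?_⟩
  by_cases hv : v ∈ A
  · rw [h1 ⟨v, hv, rfl⟩]; simp [ind, hv]
  · rw [h0 ⟨v, hv, rfl⟩]; simp [ind, hv]

theorem sep {V : Type*} [TopologicalSpace V] [CompactSpace V] [T2Space V]
    [TotallyDisconnectedSpace V] {p q : V} (h : p ≠ q) : ∃ A : Set V, IsClopen A ∧ p ∈ A ∧ q ∉ A := by
  obtain ⟨U, h1, h2, h3⟩ := exists_isClopen_of_totally_separated h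
  exact ⟨U, h1, h2, h3⟩

theorem end_lim {X : Type*} [TopologicalSpace X] [CompactSpace X] [T2Space X] {V : Set X}
    (hV : IsClosed V) [TotallyDisconnectedSpace V] (ψ : ℝ → X) (hψ : ContinuousOn ψ (Ioo 0 1))
    (hcl : ∀ p, MapClusterPt p (𝓝[>] (0:ℝ)) ψ → p ∈ V) :
    ∃ l ∈ V, Tendsto ψ (𝓝[>] (0:ℝ)) (𝓝 l) := by
  haveI : CompactSpace V := isCompact_iff_compactSpace.1 hV.isCompact
  obtain ⟨p, hp⟩ := exists_clusterPt_of_compactSpace (map ψ (𝓝[>] (0:ℝ)))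
  refine ⟨p, hcl p hp, le_nhds_of_unique_clusterPt (fun q hq => ?_)⟩
  by_contra hqp
  obtain ⟨A, hA, hpA, hqA⟩ := sep (V := V) (p := ⟨p, hcl p hp⟩) (q := ⟨q, hcl q hq⟩)
    (fun h => hqp (congrArg Subtype.val h).symm)
  obtain ⟨h, hc, hh⟩ := urys hV A hA
  have hp1 : h p = 1 := by rw [hh ⟨p, hcl p hp⟩]; simp [ind, hpA]
  have hq0 : h q = 0 := by rw [hh ⟨q, hcl q hq⟩]; simp [ind, hqA]
  have hfreq : ∃ᶠ s in 𝓝[>] (0:ℝ), ψ s ∈ {r | h r = 1/2} := by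
    rw [(nhdsGT_basis (0:ℝ)).frequently_iff]
    intro ε hε
    have hI : Ioo (0:ℝ) (min ε 1) ∈ 𝓝[>] (0:ℝ) := Ioo_mem_nhdsGT (by positivity)
    have f1 : ∃ᶠ s in 𝓝[>] (0:ℝ), h (ψ s) > 1/2 :=
      MapClusterPt.frequently hp ((isOpen_lt continuous_const hc).mem_nhds (by simp [hp1]; norm_num))
    have f2 : ∃ᶠ s in 𝓝[>] (0:ℝ), h (ψ s) < 1/2 :=
      MapClusterPt.frequently hq ((isOpen_lt hc continuous_const).mem_nhds (by simp [hq0]))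
    obtain ⟨s1, hs1, hs1'⟩ := (f1.and_eventually hI).exists
    obtain ⟨s2, hs2, hs2'⟩ := (f2.and_eventually hI).exists
    have hcont : ContinuousOn (fun s => h (ψ s)) (Ioo 0 (min ε 1)) :=
      hc.comp_continuousOn (hψ.mono (Ioo_subset_Ioo_right (min_le_right _ _)))
    obtain ⟨s, hs, hs'⟩ := isPreconnected_Ioo.intermediate_value hs2' hs1' hcont ⟨hs2.le, hs1.le⟩
    exact ⟨s, ⟨hs.1, hs.2.trans_le (min_le_left _ _)⟩, hs'⟩
  have hK : IsCompact {r | h r = 1/2} := (isClosed_eq hc continuous_const).isCompact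
  obtain ⟨r, hr, hr'⟩ := hK.exists_mapClusterPt_of_frequently hfreq
  have := hh ⟨r, hcl r hr'⟩
  simp only [mem_ofPred_eq] at hr
  rcases ind_01 A ⟨r, hcl r hr'⟩ with h' | h' <;> rw [h'] at this <;> simp only at this <;> linarith

set_option maxHeartbeats 1000000 in
theorem ES_exists {X : Type*} [TopologicalSpace X] [CompactSpace X] [T2Space X] {V : Set X}
    (hV : IsClosed V) [TotallyDisconnectedSpace V] {E : Type*} [TopologicalSpace E]
    [DiscreteTopology E] (H : (Vᶜ : Set X) ≃ₜ (E × ↥(Set.Ioo (0 : ℝ) 1))) :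
    ∃ S : ES X V E, ∀ e s (hs : s ∈ Ioo (0:ℝ) 1), S.γ e s = (H.symm (e, ⟨s, hs⟩)).1 := by
  classical
  let m : Ioo (0:ℝ) 1 := ⟨1/2, by norm_num, by norm_num⟩
  let φ : E → ℝ → X := fun e s => if hs : s ∈ Ioo (0:ℝ) 1 then (H.symm (e, ⟨s, hs⟩)).1 else (H.symm (e, m)).1
  have hφ : ∀ e s (hs : s ∈ Ioo (0:ℝ) 1), φ e s = (H.symm (e, ⟨s, hs⟩)).1 := by
    intro e s hs; simp only [φ, dif_pos hs]
  have hφV : ∀ e s, s ∈ Ioo (0:ℝ) 1 → φ e s ∉ V := by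
    intro e s hs; rw [hφ e s hs]; exact (H.symm (e, ⟨s, hs⟩)).2
  have hφinj : ∀ e e' s s', s ∈ Ioo (0:ℝ) 1 → s' ∈ Ioo (0:ℝ) 1 → φ e s = φ e' s' → e = e' ∧ s = s' := by
    intro e e' s s' hs hs' h
    rw [hφ e s hs, hφ e' s' hs'] at h
    have := H.symm.injective (Subtype.ext h)
    simpa using this
  have hφsurj : ∀ p, p ∉ V → ∃ e, ∃ s ∈ Ioo (0:ℝ) 1, φ e s = p := by
    intro p hp
    refine ⟨(H ⟨p, hp⟩).1, (H ⟨p, hp⟩).2.1, (H ⟨p, hp⟩).2.2, ?_⟩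
    rw [hφ _ _ (H ⟨p, hp⟩).2.2]
    have : ((H ⟨p, hp⟩).1, (⟨(H ⟨p, hp⟩).2.1, (H ⟨p, hp⟩).2.2⟩ : Ioo (0:ℝ) 1)) = H ⟨p, hp⟩ := rfl
    rw [this, H.symm_apply_apply]
  have hφopen : ∀ e a b, 0 ≤ a → b ≤ 1 → IsOpen (φ e '' Ioo a b) := by
    intro e a b ha hb
    have : φ e '' Ioo a b = Subtype.val '' (H ⁻¹' ({e} ×ˢ (Subtype.val ⁻¹' Ioo a b))) := by
      ext p
      constructor
      · rintro ⟨s, hs, rfl⟩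
        have hs' : s ∈ Ioo (0:ℝ) 1 := ⟨ha.trans_lt hs.1, hs.2.trans_le hb⟩
        refine ⟨H.symm (e, ⟨s, hs'⟩), ?_, (hφ e s hs').symm⟩
        simp only [mem_preimage, H.apply_symm_apply]
        exact ⟨rfl, hs⟩
      · rintro ⟨q, ⟨hq1, hq2⟩, rfl⟩
        refine ⟨(H q).2.1, hq2, ?_⟩
        rw [hφ e _ (H q).2.2]
        have h1 : (H q).1 = e := hq1
        rw [← h1]
        have : ((H q).1, (⟨(H q).2.1, (H q).2.2⟩ : Ioo (0:ℝ) 1)) = H q := rfl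
        rw [this, H.symm_apply_apply]
    rw [this]
    refine (hV.isOpen_compl.isOpenMap_subtype_val) _ (H.continuous.isOpen_preimage _ ?_)
    exact (isOpen_discrete _).prod (isOpen_Ioo.preimage continuous_subtype_val)
  have hφc : ∀ e, ContinuousOn (φ e) (Ioo 0 1) := by
    intro e
    rw [continuousOn_iff_continuous_domRestrict]
    have : (Ioo (0:ℝ) 1).domRestrict (φ e) = fun s => (H.symm (e, s)).1 := by
      ext s; exact hφ e s.1 s.2
    rw [this]
    exact continuous_subtype_val.comp (H.symm.continuous.comp (by fun_prop))
  have L0 : ∀ e, ∃ l ∈ V, Tendsto (φ e) (𝓝[>] (0:ℝ)) (𝓝 l) := by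
    intro e
    refine end_lim hV (φ e) (hφc e) (fun p hp => ?_)
    by_contra hpV
    obtain ⟨e', s', hs', rfl⟩ := hφsurj p hpV
    have hO := (hφopen e' (s'/2) 1 (by linarith [hs'.1]) le_rfl).mem_nhds
      (mem_image_of_mem _ ⟨by linarith [hs'.1], hs'.2⟩)
    have := (MapClusterPt.frequently hp hO).and_eventually
      (Ioo_mem_nhdsGT (show (0:ℝ) < s'/2 by linarith [hs'.1]))
    obtain ⟨s, ⟨s2, hs2, he⟩, hs⟩ := this.exists
    have := hφinj e' e s2 s ⟨by linarith [hs2.1, hs'.1], hs2.2⟩ ⟨hs.1, by linarith [hs.2, hs'.2]⟩ he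
    linarith [this.2, hs2.1, hs.2]
  have L1 : ∀ e, ∃ l ∈ V, Tendsto (φ e) (𝓝[<] (1:ℝ)) (𝓝 l) := by
    intro e
    have hrev : Tendsto (fun s : ℝ => 1 - s) (𝓝[<] (1:ℝ)) (𝓝[>] (0:ℝ)) := by
      refine tendsto_nhdsWithin_iff.2 ⟨?_, ?_⟩
      · have : Tendsto (fun s : ℝ => 1 - s) (𝓝 1) (𝓝 (1 - 1)) := (by fun_prop : Continuous fun s : ℝ => 1 - s).tendsto 1
        rw [sub_self] at this
        exact this.mono_left nhdsWithin_le_nhds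
      · filter_upwards [self_mem_nhdsWithin] with s hs
        simpa using hs
    obtain ⟨l, hl, hl'⟩ := end_lim hV (fun s => φ e (1 - s)) ((hφc e).comp (by fun_prop)
      (fun s hs => ⟨by linarith [hs.2], by linarith [hs.1]⟩)) (fun p hp => by
        by_contra hpV
        obtain ⟨e', s', hs', rfl⟩ := hφsurj p hpV
        have hO := (hφopen e' 0 ((1+s')/2) le_rfl (by linarith [hs'.2])).mem_nhds
          (mem_image_of_mem _ ⟨hs'.1, by linarith [hs'.2]⟩)
        have := (MapClusterPt.frequently hp hO).and_eventually
          (Ioo_mem_nhdsGT (show (0:ℝ) < (1-s')/2 by linarith [hs'.2]))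
        obtain ⟨s, ⟨s2, hs2, he⟩, hs⟩ := this.exists
        have := hφinj e' e s2 (1-s) ⟨hs2.1, by linarith [hs2.2, hs'.2]⟩
          ⟨by linarith [hs.2, hs'.1], by linarith [hs.1]⟩ he
        linarith [this.2, hs2.2, hs.2])
    refine ⟨l, hl, ?_⟩
    have := hl'.comp hrev
    simpa [comp_def] using this
  choose l0 hl0 hl0' using L0
  choose l1 hl1 hl1' using L1
  let γ0 : E → ℝ → X := fun e => extendFrom (Ioo 0 1) (φ e)
  have c0 : ∀ e, ContinuousOn (γ0 e) (Icc 0 1) := fun e =>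
    continuousOn_Icc_extendFrom_Ioo (hφc e) (hl0' e) (hl1' e)
  let γ : E → ℝ → X := fun e s => γ0 e (projIcc (0:ℝ) 1 zero_le_one s)
  have hγ : ∀ e, ∀ s ∈ Icc (0:ℝ) 1, γ e s = γ0 e s := by
    intro e s hs; simp only [γ]; rw [projIcc_of_mem _ hs]
  have hγφ : ∀ e, ∀ s ∈ Ioo (0:ℝ) 1, γ e s = φ e s := by
    intro e s hs
    rw [hγ e s (Ioo_subset_Icc_self hs)]
    exact extendFrom_extends (hφc e) s hs
  have im : ∀ e, γ e '' Ioo 0 1 = φ e '' Ioo 0 1 := fun e => image_congr (hγφ e)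
  refine ⟨⟨γ, ?_, ?_, ?_, ?_, ?_, ?_, ?_⟩, fun e s hs => (hγφ e s hs).trans (hφ e s hs)⟩
  · intro e
    exact (c0 e).comp_continuous (continuous_subtype_val.comp continuous_projIcc) (fun s => (projIcc (0:ℝ) 1 zero_le_one s).2)
  · intro e
    rw [hγ e 0 (by simp)]
    simp only [γ0]
    rw [eq_lim_at_left_extendFrom_Ioo (by norm_num) (hl0' e)]
    exact hl0 e
  · intro e
    rw [hγ e 1 (by simp)]
    simp only [γ0]
    rw [eq_lim_at_right_extendFrom_Ioo (by norm_num) (hl1' e)]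
    exact hl1 e
  · intro e s hs; rw [hγφ e s hs]; exact hφV e s hs
  · intro p hp
    obtain ⟨e, s, hs, h⟩ := hφsurj p hp
    exact ⟨e, s, hs, by rw [hγφ e s hs, h]⟩
  · intro e e' s s' hs hs' h
    rw [hγφ e s hs, hγφ e' s' hs'] at h
    exact hφinj e e' s s' hs hs' h
  · intro e; rw [im e]; exact hφopen e 0 1 le_rfl le_rfl

end GLP
end

section
open Set Topology Filter Function

namespace GLP

variable {X : Type*} [TopologicalSpace X] {V : Set X} {E : Type*}

def ES.s (S : ES X V E) (e : E) : V := ⟨S.γ e 0, S.g0 e⟩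
def ES.t (S : ES X V E) (e : E) : V := ⟨S.γ e 1, S.g1 e⟩
def ES.ed (S : ES X V E) (e : E) : Set X := S.γ e '' Ioo 0 1

theorem ES.ed_V (S : ES X V E) {e : E} {p : X} (h : p ∈ S.ed e) : p ∉ V := by
  obtain ⟨s, hs, rfl⟩ := h
  exact S.inV e s hs

theorem ES.ed_ed (S : ES X V E) {e e' : E} {p : X} (h : p ∈ S.ed e) (h' : p ∈ S.ed e') : e = e' := by
  obtain ⟨s, hs, rfl⟩ := h
  obtain ⟨s', hs', hh⟩ := h'
  exact (S.inj _ _ _ _ hs' hs hh).1.symm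

theorem ES.ed_surj (S : ES X V E) {p : X} (h : p ∉ V) : ∃ e, p ∈ S.ed e := by
  obtain ⟨e, s, hs, rfl⟩ := S.surj p h
  exact ⟨e, s, hs, rfl⟩

theorem Icc_cases {s : ℝ} (h : s ∈ Icc (0:ℝ) 1) : s = 0 ∨ s = 1 ∨ s ∈ Ioo (0:ℝ) 1 := by
  rcases eq_or_lt_of_le h.1 with h0 | h0
  · exact Or.inl h0.symm
  · rcases eq_or_lt_of_le h.2 with h1 | h1
    · exact Or.inr (Or.inl h1)
    · exact Or.inr (Or.inr ⟨h0, h1⟩)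

theorem half_finite [CompactSpace X] (S : ES X V E) (h : X → ℝ) (hc : Continuous h)
    (hv : ∀ v ∈ V, h v ≠ 1/2) : {e | ∃ s ∈ Ioo (0:ℝ) 1, h (S.γ e s) = 1/2}.Finite := by
  have hK : IsCompact {r | h r = 1/2} := (isClosed_eq hc continuous_const).isCompact
  obtain ⟨F, hF⟩ := hK.elim_finite_subcover (fun e => S.ed e) S.op (fun p hp => by
    have : p ∉ V := fun hpV => hv p hpV hp
    obtain ⟨e, he⟩ := S.ed_surj this
    exact mem_iUnion.2 ⟨e, he⟩)
  refine F.finite_toSet.subset ?_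
  rintro e ⟨s, hs, hh⟩
  have := hF hh
  simp only [mem_iUnion] at this
  obtain ⟨e', he', hm⟩ := this
  have : e = e' := S.ed_ed ⟨s, hs, rfl⟩ hm
  rw [this]; exact he'

theorem ivt_half (φ : ℝ → ℝ) (hc : Continuous φ) {a b : ℝ} (ha : a ∈ Icc (0:ℝ) 1) (hb : b ∈ Icc (0:ℝ) 1)
    (h1 : φ a ≤ 1/2) (h2 : 1/2 ≤ φ b) (h0 : φ 0 ≠ 1/2) (h1' : φ 1 ≠ 1/2) :
    ∃ s ∈ Ioo (0:ℝ) 1, φ s = 1/2 := by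
  obtain ⟨s, hs, hs'⟩ := isPreconnected_Icc.intermediate_value ha hb hc.continuousOn ⟨h1, h2⟩
  rcases Icc_cases hs with rfl | rfl | h
  · exact absurd hs' h0
  · exact absurd hs' h1'
  · exact ⟨s, h, hs'⟩

theorem ind_ne (A : Set V) (v : V) : ind A v ≠ 1/2 := by
  rcases ind_01 A v with h | h <;> rw [h] <;> norm_num

theorem hfin_of [CompactSpace X] [T2Space X] (hV : IsClosed V) (S : ES X V E) (A : Set V) (hA : IsClopen A) :
    (cu S.s S.t A).Finite := by
  obtain ⟨h, hc, hh⟩ := urys hV A hA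
  refine (half_finite S h hc (fun v hv => by rw [hh ⟨v, hv⟩]; exact ind_ne _ _)).subset ?_
  intro e he
  have e0 : h (S.γ e 0) = ind A (S.s e) := hh (S.s e)
  have e1 : h (S.γ e 1) = ind A (S.t e) := hh (S.t e)
  have c : Continuous fun s => h (S.γ e s) := hc.comp (S.cont e)
  have n0 : h (S.γ e 0) ≠ 1/2 := by rw [e0]; exact ind_ne _ _
  have n1 : h (S.γ e 1) ≠ 1/2 := by rw [e1]; exact ind_ne _ _
  simp only [cu, mem_ofPred_eq] at he
  by_cases h1 : S.s e ∈ A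
  · have h2 : S.t e ∉ A := fun h => he ⟨fun _ => h, fun _ => h1⟩
    exact ivt_half (fun s => h (S.γ e s)) c (a := 1) (b := 0) (by simp) (by simp)
      (by rw [e1]; simp [ind, h2]) (by rw [e0]; simp [ind, h1]; norm_num) n0 n1
  · have h2 : S.t e ∈ A := by by_contra h; exact he ⟨fun h' => absurd h' h1, fun h' => absurd h' h⟩
    exact ivt_half (fun s => h (S.γ e s)) c (a := 0) (b := 1) (by simp) (by simp)
      (by rw [e0]; simp [ind, h1]) (by rw [e1]; simp [ind, h2]; norm_num) n0 n1

theorem hA_exists [CompactSpace X] [T2Space X] (hV : IsClosed V) (S : ES X V E) (A : Set V) (hA : IsClopen A) :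
    ∃ h : X → ℝ, Continuous h ∧ (∀ v : V, h v = ind A v) ∧
      ∀ e ∉ cu S.s S.t A, ∀ s ∈ Icc (0:ℝ) 1, h (S.γ e s) = ind A (S.s e) := by
  classical
  obtain ⟨g, hc, hh⟩ := urys hV A hA
  have hD := half_finite S g hc (fun v hv => by rw [hh ⟨v, hv⟩]; exact ind_ne _ _)
  set D := {e | ∃ s ∈ Ioo (0:ℝ) 1, g (S.γ e s) = 1/2} with hDdef
  have hgV : ∀ v ∈ V, g v ≠ 1/2 := fun v hv => by rw [hh ⟨v, hv⟩]; exact ind_ne _ _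
  have g0 : ∀ e, g (S.γ e 0) = ind A (S.s e) := fun e => hh (S.s e)
  have g1 : ∀ e, g (S.γ e 1) = ind A (S.t e) := fun e => hh (S.t e)
  have gt : ∀ e ∉ cu S.s S.t A, ind A (S.t e) = ind A (S.s e) := by
    intro e he
    simp only [cu, mem_ofPred_eq, not_not] at he
    simp [ind, he]
  -- for non-cut edges: point of closed edge is in open edge or a vertex with value ind
  have gcl : ∀ e ∉ cu S.s S.t A, ∀ s ∈ Icc (0:ℝ) 1, S.γ e s ∈ S.ed e ∨
      (S.γ e s ∈ V ∧ g (S.γ e s) = ind A (S.s e)) := by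
    intro e he s hs
    rcases Icc_cases hs with rfl | rfl | h
    · exact Or.inr ⟨S.g0 e, g0 e⟩
    · exact Or.inr ⟨S.g1 e, (g1 e).trans (gt e he)⟩
    · exact Or.inl ⟨s, h, rfl⟩
  set P : Set X := {p | 1/2 ≤ g p} ∩ (⋃ e ∈ D, S.ed e)ᶜ ∪
    ⋃ e ∈ {e ∈ D | e ∉ cu S.s S.t A ∧ S.s e ∈ A}, S.γ e '' Icc 0 1 with hP
  set Q : Set X := {p | g p ≤ 1/2} ∩ (⋃ e ∈ D, S.ed e)ᶜ ∪
    ⋃ e ∈ {e ∈ D | e ∉ cu S.s S.t A ∧ S.s e ∉ A}, S.γ e '' Icc 0 1 with hQ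
  have oU : IsClosed (⋃ e ∈ D, S.ed e)ᶜ :=
    (isOpen_biUnion (fun e _ => S.op e)).isClosed_compl
  have cP : IsClosed P := by
    refine IsClosed.union ((isClosed_le continuous_const hc).inter oU) ?_
    refine Set.Finite.isClosed_biUnion (hD.subset (fun e he => he.1)) (fun e _ => ?_)
    exact (isCompact_Icc.image (S.cont e)).isClosed
  have cQ : IsClosed Q := by
    refine IsClosed.union ((isClosed_le hc continuous_const).inter oU) ?_
    refine Set.Finite.isClosed_biUnion (hD.subset (fun e he => he.1)) (fun e _ => ?_)
    exact (isCompact_Icc.image (S.cont e)).isClosed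
  have i1 : ∀ v ∈ A, ind A v = 1 := fun v hv => by simp [ind, hv]
  have i0 : ∀ v ∉ A, ind A v = 0 := fun v hv => by simp [ind, hv]
  have dis : Disjoint Q P := by
    rw [Set.disjoint_left]
    rintro p (⟨hq1, hq2⟩ | hq) (⟨hp1, hp2⟩ | hp)
    · have hp12 : g p = 1/2 := le_antisymm hq1 hp1
      obtain ⟨e, s, hs, rfl⟩ := S.surj p (fun h => hgV p h hp12)
      exact hp2 (mem_biUnion (show e ∈ D from ⟨s, hs, hp12⟩) ⟨s, hs, rfl⟩)
    · simp only [mem_iUnion] at hp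
      obtain ⟨e, ⟨heD, he, hes⟩, s, hs, rfl⟩ := hp
      rcases gcl e he s hs with h | ⟨_, h⟩
      · exact hq2 (mem_biUnion heD h)
      · rw [i1 _ hes] at h; simp only [mem_ofPred_eq] at hq1; linarith
    · simp only [mem_iUnion] at hq
      obtain ⟨e, ⟨heD, he, hes⟩, s, hs, rfl⟩ := hq
      rcases gcl e he s hs with h | ⟨_, h⟩
      · exact hp2 (mem_biUnion heD h)
      · rw [i0 _ hes] at h; simp only [mem_ofPred_eq] at hp1; linarith
    · simp only [mem_iUnion] at hp hq
      obtain ⟨e, ⟨heD, he, hes⟩, s, hs, rfl⟩ := hp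
      obtain ⟨e', ⟨heD', he', hes'⟩, s', hs', hss⟩ := hq
      have a1 := gcl e he s hs
      have a2 := gcl e' he' s' hs'
      rw [hss] at a2
      rcases a1 with a1 | ⟨a1, b1⟩ <;> rcases a2 with a2 | ⟨a2, b2⟩
      · have := S.ed_ed a1 a2; subst this; exact hes' hes
      · exact S.ed_V a1 a2
      · exact S.ed_V a2 a1
      · rw [i1 _ hes] at b1; rw [i0 _ hes', b1] at b2; norm_num at b2
  obtain ⟨h, h0, h1, -⟩ := exists_continuous_zero_one_of_isClosed cQ cP dis
  have vU : ∀ v ∈ V, v ∈ (⋃ e ∈ D, S.ed e)ᶜ := by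
    intro v hv hm
    simp only [mem_iUnion] at hm
    obtain ⟨e, _, he⟩ := hm
    exact S.ed_V he hv
  have hv : ∀ v : V, h v = ind A v := by
    intro v
    by_cases hvA : v ∈ A
    · rw [i1 v hvA]
      exact h1 (Or.inl ⟨by simp only [mem_ofPred_eq]; rw [hh v, i1 v hvA]; norm_num, vU v v.2⟩)
    · rw [i0 v hvA]
      exact h0 (Or.inl ⟨by simp only [mem_ofPred_eq]; rw [hh v, i0 v hvA]; norm_num, vU v v.2⟩)
  refine ⟨h, h.continuous, hv, ?_⟩
  intro e he s hs
  by_cases heD : e ∈ D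
  · by_cases heA : S.s e ∈ A
    · rw [i1 _ heA]
      exact h1 (Or.inr (mem_biUnion (⟨heD, he, heA⟩ : e ∈ {e ∈ D | e ∉ cu S.s S.t A ∧ S.s e ∈ A}) ⟨s, hs, rfl⟩))
    · rw [i0 _ heA]
      exact h0 (Or.inr (mem_biUnion (⟨heD, he, heA⟩ : e ∈ {e ∈ D | e ∉ cu S.s S.t A ∧ S.s e ∉ A}) ⟨s, hs, rfl⟩))
  · have hU : S.γ e s ∈ (⋃ e ∈ D, S.ed e)ᶜ := by
      intro hm
      simp only [mem_iUnion] at hm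
      obtain ⟨e', he', hm⟩ := hm
      rcases gcl e he s hs with h | ⟨h, _⟩
      · have := S.ed_ed h hm; subst this; exact heD he'
      · exact S.ed_V hm h
    have c : Continuous fun s => g (S.γ e s) := hc.comp (S.cont e)
    have n0 : g (S.γ e 0) ≠ 1/2 := hgV _ (S.g0 e)
    have n1 : g (S.γ e 1) ≠ 1/2 := hgV _ (S.g1 e)
    by_cases heA : S.s e ∈ A
    · rw [i1 _ heA]
      refine h1 (Or.inl ⟨?_, hU⟩)
      by_contra hlt
      simp only [mem_ofPred_eq, not_le] at hlt
      exact heD (ivt_half (fun s => g (S.γ e s)) c hs (b := 0) (by simp) hlt.le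
        (by rw [g0, i1 _ heA]; norm_num) n0 n1)
    · rw [i0 _ heA]
      refine h0 (Or.inl ⟨?_, hU⟩)
      by_contra hlt
      simp only [mem_ofPred_eq, not_le] at hlt
      exact heD (ivt_half (fun s => g (S.γ e s)) c (a := 0) (by simp) hs
        (by rw [g0, i0 _ heA]; norm_num) hlt.le n0 n1)

theorem kappa [CompactSpace X] [T2Space X] (S : ES X V E) (e : E) (k : ℝ → ℝ) (hk : Continuous k)
    (k0 : k 0 = 0) (k1 : k 1 = 0) :
    ∃ κ : X → ℝ, Continuous κ ∧ (∀ s ∈ Ioo (0:ℝ) 1, κ (S.γ e s) = k s) ∧ ∀ p ∉ S.ed e, κ p = 0 := by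
  classical
  let κ : X → ℝ := fun p => if h : p ∈ S.ed e then k h.choose else 0
  have hκ : ∀ s ∈ Ioo (0:ℝ) 1, κ (S.γ e s) = k s := by
    intro s hs
    have h : S.γ e s ∈ S.ed e := ⟨s, hs, rfl⟩
    simp only [κ, dif_pos h]
    rw [(S.inj e e _ _ h.choose_spec.1 hs h.choose_spec.2).2]
  have hκ0 : ∀ p ∉ S.ed e, κ p = 0 := fun p hp => by simp only [κ, dif_neg hp]
  have nV : ∀ s, S.γ e s ∈ V → S.γ e s ∉ S.ed e := fun s hs h => S.ed_V h hs
  have hκI : ∀ s ∈ Icc (0:ℝ) 1, κ (S.γ e s) = k s := by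
    intro s hs
    rcases Icc_cases hs with rfl | rfl | h
    · rw [hκ0 _ (nV _ (S.g0 e)), k0]
    · rw [hκ0 _ (nV _ (S.g1 e)), k1]
    · exact hκ s h
  refine ⟨κ, ?_, hκ, hκ0⟩
  rw [continuous_iff_isClosed]
  intro K hK
  have c1 : IsClosed (S.γ e '' (Icc 0 1 ∩ k ⁻¹' K)) :=
    ((isCompact_Icc.inter_right (hK.preimage hk)).image (S.cont e)).isClosed
  have c2 : IsClosed (S.ed e)ᶜ := (S.op e).isClosed_compl
  have : κ ⁻¹' K = S.γ e '' (Icc 0 1 ∩ k ⁻¹' K) ∪ (if (0:ℝ) ∈ K then (S.ed e)ᶜ else ∅) := by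
    ext p
    constructor
    · intro hp
      by_cases hpe : p ∈ S.ed e
      · obtain ⟨s, hs, rfl⟩ := hpe
        refine Or.inl ⟨s, ⟨Ioo_subset_Icc_self hs, ?_⟩, rfl⟩
        rw [mem_preimage, hκ s hs] at hp; exact hp
      · right
        rw [mem_preimage, hκ0 p hpe] at hp
        rw [if_pos hp]; exact hpe
    · rintro (⟨s, ⟨hs, hsK⟩, rfl⟩ | hp)
      · rw [mem_preimage, hκI s hs]; exact hsK
      · split_ifs at hp with h
        · rw [mem_preimage, hκ0 p hp]; exact h
        · exact absurd hp (notMem_empty _)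
  rw [this]
  refine c1.union ?_
  split_ifs
  · exact c2
  · exact isClosed_empty

theorem cont_crit [CompactSpace X] [T2Space X] (hV : IsClosed V) [TotallyDisconnectedSpace V]
    (S : ES X V E) {T : Type*} [TopologicalSpace T] (f : T → X)
    (H1 : ∀ (A : Set V), IsClopen A → ∀ h : X → ℝ, Continuous h → (∀ v : V, h v = ind A v) →
      (∀ e ∉ cu S.s S.t A, ∀ s ∈ Icc (0:ℝ) 1, h (S.γ e s) = ind A (S.s e)) →
      Continuous fun τ => h (f τ))
    (H2 : ∀ e (k : ℝ → ℝ) (κ : X → ℝ), Continuous k → k 0 = 0 → k 1 = 0 → Continuous κ →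
      (∀ s ∈ Ioo (0:ℝ) 1, κ (S.γ e s) = k s) → (∀ p ∉ S.ed e, κ p = 0) →
      Continuous fun τ => κ (f τ)) : Continuous f := by
  haveI : CompactSpace V := isCompact_iff_compactSpace.1 hV.isCompact
  let ι := {g : X → ℝ // Continuous g ∧ Continuous fun τ => g (f τ)}
  let Φ : X → ι → ℝ := fun p g => g.1 p
  have hΦ : Continuous Φ := continuous_pi fun g => g.2.1
  have key : ∀ e s, s ∈ Ioo (0:ℝ) 1 → ∀ q, Φ (S.γ e s) = Φ q → S.γ e s = q := by
    intro e s hs q hq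
    have kk : ∀ k : ℝ → ℝ, Continuous k → k 0 = 0 → k 1 = 0 →
        (q ∉ S.ed e → k s = 0) ∧ ∀ s' ∈ Ioo (0:ℝ) 1, q = S.γ e s' → k s = k s' := by
      intro k hk k0 k1
      obtain ⟨κ, κc, κ1, κ2⟩ := kappa S e k hk k0 k1
      have := congrFun hq ⟨κ, κc, H2 e k κ hk k0 k1 κc κ1 κ2⟩
      simp only [Φ] at this
      rw [κ1 s hs] at this
      refine ⟨fun h => by rw [this, κ2 q h], fun s' hs' h => by rw [this, h, κ1 s' hs']⟩
    have r1 := kk (fun s => s * (1 - s)) (by fun_prop) (by simp) (by simp)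
    have r2 := kk (fun s => s * (s * (1 - s))) (by fun_prop) (by simp) (by simp)
    have pos : 0 < s * (1 - s) := mul_pos hs.1 (by linarith [hs.2])
    by_cases hqe : q ∈ S.ed e
    · obtain ⟨s', hs', rfl⟩ := hqe
      have e1 := r1.2 s' hs' rfl
      have e2 := r2.2 s' hs' rfl
      rw [← e1] at e2
      rw [mul_right_cancel₀ pos.ne' e2]
    · have := r1.1 hqe
      exact absurd this pos.ne'
  have inj : Injective Φ := by
    intro p q hpq
    by_cases hp : p ∈ V
    · by_cases hq : q ∈ V
      · by_contra hne
        obtain ⟨A, hA, hpA, hqA⟩ := sep (V := V) (p := ⟨p, hp⟩) (q := ⟨q, hq⟩)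
          (fun h => hne (congrArg Subtype.val h))
        obtain ⟨h, hc, hh, hcon⟩ := hA_exists hV S A hA
        have := congrFun hpq ⟨h, hc, H1 A hA h hc hh hcon⟩
        simp only [Φ] at this
        rw [hh ⟨p, hp⟩, hh ⟨q, hq⟩] at this
        simp [ind, hpA, hqA] at this
      · obtain ⟨e, s, hs, rfl⟩ := S.surj q hq
        exact (key e s hs p hpq.symm).symm
    · obtain ⟨e, s, hs, rfl⟩ := S.surj p hp
      exact key e s hs q hpq
  have emb := hΦ.isClosedEmbedding inj
  rw [emb.isInducing.continuous_iff]
  exact continuous_pi fun g => g.2.2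

theorem E_countable [CompactSpace X] [TopologicalSpace.MetrizableSpace X] (S : ES X V E) : Countable E := by
  letI := TopologicalSpace.metrizableSpaceMetric X
  have h : (univ : Set E).PairwiseDisjoint S.ed := by
    intro e _ e' _ hne
    simp only [Function.onFun]
    rw [Set.disjoint_left]
    intro p hp hp'
    exact hne (S.ed_ed hp hp')
  have := h.countable_of_isOpen (fun e _ => S.op e) (fun e _ => ⟨S.γ e (1/2), 1/2, by norm_num, rfl⟩)
  exact countable_univ_iff.1 this

end GLP
end

section
open Set Topology Filter Function

namespace GLP

theorem intervals {F : Type*} [Countable F] [Nonempty F] (lt : F → F → Prop) (irr : ∀ e, ¬ lt e e)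
    (tr : ∀ a b c, lt a b → lt b c → lt a c) (tot : ∀ a b, a ≠ b → lt a b ∨ lt b a) :
    ∃ a w : F → ℝ, (∀ e, 0 < w e) ∧ (∀ e, 0 ≤ a e) ∧ (∀ e, a e + w e ≤ 1) ∧
      (∀ e e', lt e e' → a e + w e ≤ a e') ∧
      ∀ s t, 0 ≤ s → s < t → t ≤ 1 → ∃ e, ∃ r ∈ Ioo s t, r ∈ Ioo (a e) (a e + w e) := by
  classical
  have hF := Encodable.ofCountable F
  obtain ⟨w', hw', c, hc, -⟩ := posSumOfEncodable (ε := 1) one_pos F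
  have cpos : 0 < c := hc.tsum_eq ▸ hc.summable.tsum_pos (fun i => (hw' i).le) (Classical.arbitrary F) (hw' _)
  let w : F → ℝ := fun e => w' e / c
  have hw : ∀ e, 0 < w e := fun e => div_pos (hw' e) cpos
  have hs : HasSum w 1 := by
    have := hc.div_const c
    rwa [div_self cpos.ne'] at this
  let a : F → ℝ := fun e => ∑' e', if lt e' e then w e' else 0
  have sm : ∀ e, Summable fun e' => if lt e' e then w e' else 0 := fun e =>
    Summable.of_nonneg_of_le (fun i => by split_ifs <;> simp [(hw i).le])
      (fun i => by split_ifs <;> simp [(hw i).le]) hs.summable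
  have smJ : ∀ J : Finset F, HasSum (fun e' => if e' ∈ J then w e' else 0) (∑ e ∈ J, w e) := by
    intro J
    have : ∑ e ∈ J, w e = ∑ e ∈ J, (if e ∈ J then w e else 0) :=
      Finset.sum_congr rfl (fun e he => by simp [he])
    rw [this]
    exact hasSum_sum_of_ne_finset_zero (fun e he => by simp [he])
  have a0 : ∀ e, 0 ≤ a e := fun e => tsum_nonneg (fun i => by split_ifs <;> simp [(hw i).le])
  -- lower-type sums
  have key1 : ∀ e (J : Finset F) (B : ℝ) (G : F → ℝ), HasSum G B →
      (∀ i, (if lt i e then w i else 0) + (if i ∈ J then w i else 0) ≤ G i) → a e + ∑ e ∈ J, w e ≤ B :=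
    fun e J B G hG h => hasSum_le h ((sm e).hasSum.add (smJ J)) hG
  have ab1 : ∀ e, a e + w e ≤ 1 := by
    intro e
    have := key1 e {e} 1 w hs (fun i => by
      by_cases h : i = e
      · subst h; simp [irr]
      · simp [h]; split_ifs <;> simp [(hw i).le])
    simpa using this
  have abl : ∀ e e', lt e e' → a e + w e ≤ a e' := by
    intro e e' hl
    have := key1 e {e} (a e') _ (sm e').hasSum (fun i => by
      by_cases h : i = e
      · subst h; simp [irr, hl]
      · simp only [Finset.mem_singleton, h, if_false, add_zero]
        by_cases h1 : lt i e
        · simp [h1, tr _ _ _ h1 hl]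
        · simp only [h1, if_false]; split_ifs <;> simp [(hw i).le])
    simpa using this
  have alt : ∀ e e', lt e e' → a e < a e' := fun e e' h => by linarith [abl e e' h, hw e]
  refine ⟨a, w, hw, a0, ab1, abl, ?_⟩
  intro s t hs0 hst ht1
  by_contra hcon
  push Not at hcon
  have hcase : ∀ e, a e + w e ≤ s ∨ t ≤ a e := by
    intro e
    by_contra h
    push Not at h
    have h3 : max (a e) s < min (a e + w e) t :=
      max_lt (lt_min (by linarith [hw e]) h.2) (lt_min h.1 hst)
    obtain ⟨r, hr1, hr2⟩ := exists_between h3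
    rw [max_lt_iff] at hr1; rw [lt_min_iff] at hr2
    exact hcon e r ⟨hr1.2, hr2.2⟩ ⟨hr1.1, hr2.1⟩
  have bL : ∀ J : Finset F, (∀ e ∈ J, a e + w e ≤ s) → ∑ e ∈ J, w e ≤ s := by
    intro J hJ
    rcases J.eq_empty_or_nonempty with rfl | hne
    · simpa using hs0
    obtain ⟨m, hm, hmax⟩ := J.exists_max_image a hne
    have h1 : ∑ e ∈ J, w e ≤ a m + w m := by
      have : HasSum (fun i => (if lt i m then w i else 0) + (if i ∈ ({m} : Finset F) then w i else 0))
        (a m + w m) := by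
        have := (sm m).hasSum.add (smJ {m})
        simpa using this
      refine hasSum_le ?_ (smJ J) this
      intro i
      by_cases hi : i ∈ J
      · by_cases him : i = m
        · subst him; simp [irr, hi]
        · rcases tot i m him with h | h
          · simp [hi, h, him]
          · exact absurd (alt _ _ h) (not_lt.2 (hmax i hi))
      · simp only [hi, if_false]
        split_ifs <;> simp [(hw i).le]
    exact h1.trans (hJ m hm)
  have bR : ∀ J : Finset F, (∀ e ∈ J, t ≤ a e) → ∑ e ∈ J, w e ≤ 1 - t := by
    intro J hJ
    rcases J.eq_empty_or_nonempty with rfl | hne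
    · simpa using ht1
    obtain ⟨m, hm, hmin⟩ := J.exists_min_image a hne
    have := key1 m J 1 w hs (fun i => by
      by_cases hi : i ∈ J
      · have : ¬ lt i m := fun h => absurd (alt _ _ h) (not_lt.2 (hmin i hi))
        simp [hi, this]
      · simp [hi]; split_ifs <;> simp [(hw i).le])
    linarith [hJ m hm]
  have : (1:ℝ) ≤ s + (1 - t) := by
    refine hasSum_le_of_sum_le hs (fun J => ?_)
    rw [← Finset.sum_filter_add_sum_filter_not J (fun e => a e + w e ≤ s)]
    refine add_le_add (bL _ (fun e he => (Finset.mem_filter.1 he).2)) (bR _ (fun e he => ?_))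
    exact (hcase e).resolve_left (Finset.mem_filter.1 he).2
  linarith

theorem par_sum {F : Type*} (K : Finset F) (g : F → ℝ) (hg : ∀ e ∈ K, g e = 1 ∨ g e = -1) :
    ∃ n : ℤ, ∑ e ∈ K, g e = n ∧ (Even n ↔ Even K.card) := by
  classical
  induction K using Finset.induction_on with
  | empty => exact ⟨0, by simp⟩
  | insert e K he ih =>
    obtain ⟨n, hn, hp⟩ := ih (fun e he => hg e (Finset.mem_insert_of_mem he))
    rw [Finset.sum_insert he, Finset.card_insert_of_notMem he, hn]
    rcases hg e (Finset.mem_insert_self _ _) with h | h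
    · refine ⟨n + 1, by rw [h]; push_cast; ring, ?_⟩
      rw [Int.even_add_one, Nat.even_add_one, hp]
    · refine ⟨n - 1, by rw [h]; push_cast; ring, ?_⟩
      rw [Int.even_sub_one, Nat.even_add_one, hp]

theorem df_pm {V E : Type*} {s t : E → V} {A : Set V} {e : E} (h : e ∈ cu s t A) (d : Bool) :
    df s t A e d = 1 ∨ df s t A e d = -1 := by
  simp only [cu, mem_ofPred_eq] at h
  by_cases h1 : s e ∈ A <;> by_cases h2 : t e ∈ A <;> cases d <;> simp [df, st, ind, h1, h2] at h ⊢

theorem ind_eq_iff {V : Type*} {A : Set V} {u v : V} : ind A u = ind A v ↔ (u ∈ A ↔ v ∈ A) := by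
  by_cases h1 : u ∈ A <;> by_cases h2 : v ∈ A <;> simp [ind, h1, h2]

theorem ind_sep {V : Type*} [TopologicalSpace V] [CompactSpace V] [T2Space V]
    [TotallyDisconnectedSpace V] {p q : V} (h : ∀ A, IsClopen A → ind A p = ind A q) : p = q := by
  by_contra hne
  obtain ⟨A, hA, h1, h2⟩ := sep hne
  exact h2 ((ind_eq_iff.1 (h A hA)).1 h1)

open Classical in
/-- the limit vertex -/
theorem limit_vertex {V F : Type*} [TopologicalSpace V] [CompactSpace V]
    (s t : F → V) (hfin : ∀ A, IsClopen A → (cu s t A).Finite) (x : V) (d : F → Bool)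
    (a w : F → ℝ) (lt : F → F → Prop) (irr : ∀ e, ¬ lt e e) (tot : ∀ a b, a ≠ b → lt a b ∨ lt b a)
    (hw : ∀ e, 0 < w e) (hab : ∀ e e', lt e e' → a e + w e ≤ a e')
    (hst : ∀ e A, ∀ hA : IsClopen A, ind A (st s t e (d e)) = ind A x +
        ∑ e' ∈ (hfin A hA).toFinset with lt e' e, df s t A e' (d e')) (τ : ℝ) :
    ∃ v : V, ∀ A, ∀ hA : IsClopen A, ind A v = ind A x +
        ∑ e' ∈ (hfin A hA).toFinset with a e' + w e' ≤ τ, df s t A e' (d e') := by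
  let R : {A : Set V // IsClopen A} → ℝ := fun A => ind A.1 x +
        ∑ e' ∈ (hfin A.1 A.2).toFinset with a e' + w e' ≤ τ, df s t A.1 e' (d e')
  have hcl : ∀ A : {A : Set V // IsClopen A}, IsClosed {v | ind A.1 v = R A} := by
    intro A
    have : Continuous (fun v => ind A.1 v) := by
      rw [continuous_iff_continuousAt]
      intro v
      by_cases hv : v ∈ A.1
      · refine ContinuousAt.congr (f := fun _ => (1:ℝ)) continuousAt_const ?_
        filter_upwards [A.2.isOpen.mem_nhds hv] with u hu
        simp [ind, hu]
      · refine ContinuousAt.congr (f := fun _ => (0:ℝ)) continuousAt_const ?_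
        filter_upwards [A.2.compl.isOpen.mem_nhds hv] with u hu
        have : u ∉ A.1 := hu
        simp [ind, this]
    exact isClosed_eq this continuous_const
  obtain ⟨v, -, hv⟩ := isCompact_univ.inter_iInter_nonempty _ hcl (fun U => by
    let M : Finset F := (U.biUnion (fun A => (hfin A.1 A.2).toFinset)).filter (fun e => a e + w e ≤ τ)
    rcases M.eq_empty_or_nonempty with hM | hM
    · refine ⟨x, mem_univ _, ?_⟩
      simp only [mem_iInter, mem_ofPred_eq]
      intro A hA
      have : ((hfin A.1 A.2).toFinset.filter (fun e => a e + w e ≤ τ)) = ∅ := by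
        rw [Finset.eq_empty_iff_forall_notMem] at hM ⊢
        intro e he
        refine hM e ?_
        rw [Finset.mem_filter] at he ⊢
        exact ⟨Finset.mem_biUnion.2 ⟨A, hA, he.1⟩, he.2⟩
      simp only [R]
      rw [this]; simp
    · obtain ⟨m, hm, hmax⟩ := M.exists_max_image a hM
      refine ⟨st s t m (!d m), mem_univ _, ?_⟩
      simp only [mem_iInter, mem_ofPred_eq]
      intro A hA
      have e1 : ind A.1 (st s t m (!d m)) = ind A.1 (st s t m (d m)) + df s t A.1 m (d m) := by
        simp [df]
      have hmτ := (Finset.mem_filter.1 hm).2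
      have iff1 : ∀ e ∈ (hfin A.1 A.2).toFinset, (a e + w e ≤ τ ↔ (lt e m ∨ e = m)) := by
        intro e he
        constructor
        · intro h
          have : e ∈ M := Finset.mem_filter.2 ⟨Finset.mem_biUnion.2 ⟨A, hA, he⟩, h⟩
          by_contra hh
          push Not at hh
          rcases tot e m hh.2 with h1 | h1
          · exact hh.1 h1
          · linarith [hab _ _ h1, hw m, hmax e this]
        · rintro (h | rfl)
          · linarith [hab _ _ h, hw m]
          · exact hmτ
      simp only [R]
      rw [e1, hst m A.1 A.2, add_assoc]
      congr 1
      have : ((hfin A.1 A.2).toFinset.filter (fun e => a e + w e ≤ τ)) =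
        ((hfin A.1 A.2).toFinset.filter (fun e => lt e m ∨ e = m)) := Finset.filter_congr iff1
      rw [this, Finset.filter_or, Finset.sum_union (by
        rw [Finset.disjoint_filter]
        rintro e _ h rfl
        exact irr _ h)]
      congr 1
      rw [Finset.sum_filter, Finset.sum_eq_single m]
      · rw [if_pos rfl]
      · intro b _ hb; rw [if_neg hb]
      · intro hmc
        rw [if_pos rfl]
        exact df_zero (by simpa using hmc) _)
  refine ⟨v, fun A hA => ?_⟩
  have := mem_iInter.1 hv ⟨A, hA⟩
  exact this

end GLP
end

section
open Set Topology Filter Function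

namespace GLP

def orr (d : Bool) (u : ℝ) : ℝ := if d then u else 1 - u
def clm (u : ℝ) : ℝ := max 0 (min 1 u)

theorem orr_cont (d : Bool) : Continuous (orr d) := by
  unfold orr; cases d
  · simp only [Bool.false_eq_true, if_false]; fun_prop
  · simp only [if_true]; fun_prop
theorem clm_cont : Continuous clm := by unfold clm; fun_prop
theorem clm_le {u : ℝ} (h : u ≤ 0) : clm u = 0 := by
  unfold clm; rw [min_eq_right (by linarith), max_eq_left h]
theorem clm_ge {u : ℝ} (h : 1 ≤ u) : clm u = 1 := by
  unfold clm; rw [min_eq_left h]; simp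
theorem clm_mem {u : ℝ} (h : u ∈ Ioo (0:ℝ) 1) : clm u = u := by
  unfold clm; rw [min_eq_right h.2.le, max_eq_right h.1.le]
theorem orr_Ioo (d : Bool) {u : ℝ} (h : u ∈ Ioo (0:ℝ) 1) : orr d u ∈ Ioo (0:ℝ) 1 := by
  obtain ⟨h1, h2⟩ := h
  cases d <;> simp [orr, h1, h2]
theorem orr_orr (d : Bool) (u : ℝ) : orr d (orr d u) = u := by cases d <;> simp [orr]

set_option maxHeartbeats 1000000 in
open Classical in
theorem thmT {X : Type*} [TopologicalSpace X] {V : Set X} {E : Type*} [CompactSpace X] [T2Space X]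
    (hV : IsClosed V) [TotallyDisconnectedSpace V]
    [Countable E] (S : ES X V E) (C : Set E) (hC : C.Nonempty) (x y : V)
    (hpar : Par S.s S.t C x y) (hconn : Conn S.s S.t C x) :
    ∃ f : ℝ → X, Continuous f ∧ f 0 = x ∧ f 1 = y ∧ ∃ a b : C → ℝ,
      (∀ e, 0 ≤ a e ∧ a e < b e ∧ b e ≤ 1) ∧ (∀ e t, f t ∈ S.ed e.1 ↔ t ∈ Ioo (a e) (b e)) ∧
      (∀ e, InjOn f (Ioo (a e) (b e))) ∧ (∀ e, S.ed e.1 ⊆ f '' Ioo (a e) (b e)) ∧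
      (∀ e ∉ C, ∀ t, f t ∉ S.ed e) ∧
      ∀ s t, 0 ≤ s → s < t → t ≤ 1 → ∃ r ∈ Ioo s t, ∃ e ∈ C, f r ∈ S.ed e := by
  have : CompactSpace V := isCompact_iff_compactSpace.1 hV.isCompact
  have : Nonempty C := hC.to_subtype
  let s' : C → V := fun e => S.s e.1
  let t' : C → V := fun e => S.t e.1
  have hcu : ∀ A, cu s' t' A = Subtype.val ⁻¹' (cu S.s S.t A) := fun A => rfl
  have hcuim : ∀ A, Subtype.val '' (cu s' t' A) = cu S.s S.t A ∩ C := fun A => by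
    rw [hcu, Subtype.image_preimage_coe, inter_comm]
  have hfin : ∀ A, IsClopen A → (cu s' t' A).Finite := fun A hA =>
    (hfin_of hV S A hA).preimage Subtype.val_injective.injOn
  have hnc : ∀ A, (cu s' t' A).ncard = (cu S.s S.t A ∩ C).ncard := fun A => by
    rw [← hcuim, ncard_image_of_injective _ Subtype.val_injective]
  have hpar' : ∀ A, IsClopen A → (Even (cu s' t' A).ncard ↔ (x ∈ A ↔ y ∈ A)) := fun A hA => by
    rw [hnc]; exact hpar A hA
  have hconn' : ∀ A, IsClopen A → x ∈ A → cu s' t' A = ∅ → ∀ e, s' e ∈ A := by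
    intro A hA hx h e
    refine hconn A hA hx ?_ e.1 e.2
    rw [← hcuim, h, image_empty]
  obtain ⟨lt, d, irr, tr, tot, hst⟩ := order_exists s' t' hfin x y hpar' hconn'
  obtain ⟨a, w, hw, ha0, hab1, hab, hden⟩ := intervals lt irr tr tot
  choose p hp using limit_vertex s' t' hfin x d a w lt irr tot hw hab hst
  let go : C → ℝ → X := fun e u => S.γ e.1 (orr (d e) u)
  have go0 : ∀ e, go e 0 = (st s' t' e (d e)).1 := by
    intro e; simp only [go, orr, st]; cases d e <;> simp [s', t', ES.s, ES.t]
  have go1 : ∀ e, go e 1 = (st s' t' e (!d e)).1 := by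
    intro e; simp only [go, orr, st]; cases d e <;> simp [s', t', ES.s, ES.t]
  have uniq : ∀ e e' τ, τ ∈ Ioo (a e) (a e + w e) → τ ∈ Ioo (a e') (a e' + w e') → e = e' := by
    intro e e' τ h h'
    by_contra hne
    rcases tot e e' hne with h1 | h1
    · linarith [hab _ _ h1, h.2, h'.1]
    · linarith [hab _ _ h1, h.1, h'.2]
  let f : ℝ → X := fun τ => if h : ∃ e, τ ∈ Ioo (a e) (a e + w e) then
    go h.choose ((τ - a h.choose) / w h.choose) else p τ
  have f1 : ∀ e τ, τ ∈ Ioo (a e) (a e + w e) → f τ = go e ((τ - a e) / w e) := by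
    intro e τ h
    have hh : ∃ e, τ ∈ Ioo (a e) (a e + w e) := ⟨e, h⟩
    simp only [f, dif_pos hh]
    rw [uniq _ _ τ hh.choose_spec h]
  have f2 : ∀ τ, (∀ e, τ ∉ Ioo (a e) (a e + w e)) → f τ = p τ := by
    intro τ h
    have hh : ¬ ∃ e, τ ∈ Ioo (a e) (a e + w e) := fun ⟨e, he⟩ => h e he
    simp only [f, dif_neg hh]
  have u01 : ∀ e τ, τ ∈ Ioo (a e) (a e + w e) → (τ - a e) / w e ∈ Ioo (0:ℝ) 1 := by
    intro e τ h
    refine ⟨div_pos (by linarith [h.1]) (hw e), ?_⟩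
    rw [div_lt_one (hw e)]; linarith [h.2]
  have ule : ∀ e τ, τ ≤ a e → clm ((τ - a e) / w e) = 0 := fun e τ h =>
    clm_le (div_nonpos_of_nonpos_of_nonneg (by linarith) (hw e).le)
  have uge : ∀ e τ, a e + w e ≤ τ → clm ((τ - a e) / w e) = 1 := fun e τ h =>
    clm_ge (by rw [le_div_iff₀ (hw e)]; linarith)
  have f1ed : ∀ e τ, τ ∈ Ioo (a e) (a e + w e) → f τ ∈ S.ed e.1 := fun e τ h => by
    rw [f1 e τ h]; exact ⟨_, orr_Ioo (d e) (u01 e τ h), rfl⟩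
  have fed : ∀ e : C, ∀ τ, f τ ∈ S.ed e.1 ↔ τ ∈ Ioo (a e) (a e + w e) := by
    intro e τ
    refine ⟨fun h => ?_, f1ed e τ⟩
    by_cases hh : ∃ e, τ ∈ Ioo (a e) (a e + w e)
    · obtain ⟨e', he'⟩ := hh
      have := Subtype.ext (S.ed_ed h (f1ed e' τ he'))
      rw [this]; exact he'
    · push Not at hh
      rw [f2 τ hh] at h
      exact absurd (p τ).2 (S.ed_V h)
  have fnot : ∀ e ∉ C, ∀ τ, f τ ∉ S.ed e := by
    intro e he τ h
    by_cases hh : ∃ e, τ ∈ Ioo (a e) (a e + w e)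
    · obtain ⟨e', he'⟩ := hh
      have := S.ed_ed h (f1ed e' τ he')
      rw [this] at he; exact he e'.2
    · push Not at hh
      rw [f2 τ hh] at h
      exact absurd (p τ).2 (S.ed_V h)
  have fcont : Continuous f := by
    refine cont_crit hV S f ?_ ?_
    · intro A hA h hc hh hcon
      have goh0 : ∀ e, h (go e 0) = ind A (st s' t' e (d e)) := fun e => by rw [go0]; exact hh _
      have goh1 : ∀ e, h (go e 1) = ind A (st s' t' e (!d e)) := fun e => by rw [go1]; exact hh _
      have form : (fun τ => h (f τ)) = fun τ => ind A x + ∑ e ∈ (hfin A hA).toFinset,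
          (h (go e (clm ((τ - a e) / w e))) - ind A (st s' t' e (d e))) := by
        funext τ
        by_cases hex : ∃ e, τ ∈ Ioo (a e) (a e + w e)
        · obtain ⟨e0, he0⟩ := hex
          have q1 : h (f τ) = ind A (st s' t' e0 (d e0)) +
              (if e0 ∈ (hfin A hA).toFinset then (h (go e0 (clm ((τ - a e0) / w e0))) - ind A (st s' t' e0 (d e0))) else 0) := by
            rw [f1 e0 τ he0]
            split_ifs with hm
            · rw [clm_mem (u01 e0 τ he0)]; ring
            · have hn : e0.1 ∉ cu S.s S.t A := by simpa [hcu] using hm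
              rw [add_zero]
              simp only [go]
              rw [hcon e0.1 hn _ (Ioo_subset_Icc_self (orr_Ioo _ (u01 e0 τ he0)))]
              simp only [cu, mem_ofPred_eq, not_not] at hn
              rw [ind_eq_iff]
              simp only [st, s', t']
              cases d e0 <;> simp [hn]
          have q2 : (if e0 ∈ (hfin A hA).toFinset then (h (go e0 (clm ((τ - a e0) / w e0))) - ind A (st s' t' e0 (d e0))) else 0)
             = ∑ e ∈ (hfin A hA).toFinset, if e = e0 then (h (go e0 (clm ((τ - a e0) / w e0))) - ind A (st s' t' e0 (d e0))) else 0 := by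
            split_ifs with hm
            · rw [Finset.sum_eq_single e0]
              · rw [if_pos rfl]
              · intro b _ hb; rw [if_neg hb]
              · intro hmm; exact absurd hm hmm
            · rw [Finset.sum_eq_zero]
              intro b hb
              rw [if_neg]; rintro rfl; exact hm hb
          rw [q2] at q1
          generalize hZ : h (go e0 (clm ((τ - a e0) / w e0))) - ind A (st s' t' e0 (d e0)) = Z at q1
          rw [q1, hst e0 A hA, add_assoc]
          congr 1
          rw [Finset.sum_filter, ← Finset.sum_add_distrib]
          refine Finset.sum_congr rfl (fun e he => ?_)
          by_cases hee : e = e0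
          · subst hee; rw [hZ]; simp [irr]
          · rw [if_neg hee, add_zero]
            rcases tot e e0 hee with h1 | h1
            · rw [if_pos h1, uge e τ (by linarith [hab _ _ h1, he0.1]), goh1]; rfl
            · have : ¬ lt e e0 := fun h2 => irr _ (tr _ _ _ h1 h2)
              rw [if_neg this, ule e τ (by linarith [hab _ _ h1, he0.2]), goh0, sub_self]
        · push Not at hex
          rw [f2 τ hex, hh, hp τ A hA]
          congr 1
          rw [Finset.sum_filter]
          refine Finset.sum_congr rfl (fun e he => ?_)
          split_ifs with h1
          · rw [uge e τ h1, goh1]; rfl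
          · rw [ule e τ (by by_contra h2; exact hex e ⟨not_le.1 h2, not_le.1 h1⟩), goh0, sub_self]
      rw [form]
      refine continuous_const.add (continuous_finsetSum _ (fun e _ => ?_))
      refine Continuous.sub (hc.comp ((S.cont e.1).comp ((orr_cont _).comp (clm_cont.comp ?_)))) continuous_const
      fun_prop
    · intro e k κ hk k0 k1 hκ κ1 κ2
      by_cases he : e ∈ C
      · have form : (fun τ => κ (f τ)) = fun τ => k (orr (d ⟨e, he⟩) (clm ((τ - a ⟨e, he⟩) / w ⟨e, he⟩))) := by
          funext τ
          have ko : ∀ b, k (orr b 0) = 0 ∧ k (orr b 1) = 0 := by intro b; cases b <;> simp [orr, k0, k1]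
          by_cases hτ : τ ∈ Ioo (a ⟨e, he⟩) (a ⟨e, he⟩ + w ⟨e, he⟩)
          · rw [f1 _ τ hτ, clm_mem (u01 _ τ hτ)]
            exact κ1 _ (orr_Ioo _ (u01 _ τ hτ))
          · rw [κ2 _ (fun h => hτ ((fed ⟨e, he⟩ τ).1 h))]
            rcases le_or_gt τ (a ⟨e, he⟩) with h1 | h1
            · rw [ule _ τ h1, (ko _).1]
            · rw [uge _ τ (by by_contra h2; exact hτ ⟨h1, not_le.1 h2⟩), (ko _).2]
        rw [form]
        refine hk.comp ((orr_cont _).comp (clm_cont.comp ?_))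
        fun_prop
      · have : (fun τ => κ (f τ)) = fun _ => 0 := by
          funext τ; exact κ2 _ (fnot e he τ)
        rw [this]; exact continuous_const
  refine ⟨f, fcont, ?_, ?_, a, fun e => a e + w e, ?_, fed, ?_, ?_, fnot, ?_⟩
  · rw [f2 0 (fun e h => by linarith [h.1, ha0 e])]
    congr 1
    refine ind_sep (fun A hA => ?_)
    rw [hp 0 A hA]
    rw [Finset.sum_filter, Finset.sum_eq_zero, add_zero]
    intro e _
    rw [if_neg]; linarith [ha0 e, hw e]
  · rw [f2 1 (fun e h => by linarith [h.2, hab1 e])]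
    congr 1
    refine ind_sep (fun A hA => ?_)
    have h1 := hp 1 A hA
    rw [Finset.filter_true_of_mem (fun e _ => hab1 e)] at h1
    obtain ⟨n, hn, hnp⟩ := par_sum (hfin A hA).toFinset (fun e => df s' t' A e (d e))
      (fun e he => df_pm (by simpa using he) _)
    rw [hn] at h1
    have h2 := hpar' A hA
    rw [ncard_eq_toFinset_card _ (hfin A hA), ← hnp, ← ind_eq_iff] at h2
    by_cases hev : Even n
    · have h3 := h2.1 hev
      rw [← h3, h1]
      have : n = 0 := by
        have : (n:ℝ) = ind A (p 1) - ind A x := by linarith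
        have h4 : (n:ℝ) < 2 ∧ (-2:ℝ) < n := by
          rw [this]
          rcases ind_01 A (p 1) with h | h <;> rcases ind_01 A x with h' | h' <;> rw [h, h'] <;> norm_num
        have h5 : n < 2 := by exact_mod_cast h4.1
        have h6 : -2 < n := by exact_mod_cast h4.2
        obtain ⟨m, hm⟩ := hev
        omega
      rw [this]; simp
    · have h3 : ind A x ≠ ind A y := fun h => hev (h2.2 h)
      have h4 : ind A (p 1) ≠ ind A x := by
        intro h
        have : (n:ℝ) = 0 := by linarith
        have : n = 0 := by exact_mod_cast this
        rw [this] at hev; simp at hev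
      rcases ind_01 A (p 1) with h | h <;> rcases ind_01 A x with h' | h' <;>
        rcases ind_01 A y with h'' | h'' <;> rw [h, h''] <;> rw [h', h''] at h3 <;> rw [h, h'] at h4 <;> simp at h3 h4
  · intro e; exact ⟨ha0 e, by linarith [hw e], hab1 e⟩
  · intro e τ hτ τ' hτ' h
    rw [f1 e τ hτ, f1 e τ' hτ'] at h
    have := (S.inj _ _ _ _ (orr_Ioo _ (u01 e τ hτ)) (orr_Ioo _ (u01 e τ' hτ')) h).2
    have h2 := congrArg (orr (d e)) this
    rw [orr_orr, orr_orr, div_left_inj' (hw e).ne'] at h2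
    linarith
  · rintro e q ⟨u, hu, rfl⟩
    have hu' := orr_Ioo (d e) hu
    have hτ : a e + orr (d e) u * w e ∈ Ioo (a e) (a e + w e) :=
      ⟨by nlinarith [hw e, hu'.1], by nlinarith [hw e, hu'.2]⟩
    refine ⟨_, hτ, ?_⟩
    rw [f1 e _ hτ]
    simp only [go]
    rw [add_sub_cancel_left, mul_div_cancel_right₀ _ (hw e).ne', orr_orr]
  · intro s t hs hst ht
    obtain ⟨e, r, hr, hr'⟩ := hden s t hs hst ht
    exact ⟨r, hr, e.1, e.2, f1ed e r hr'⟩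

end GLP
end

section
open Set Topology Filter Function

namespace GLP

theorem int_const {Δ : ℝ → ℝ} {p q : ℝ} (hpq : p ≤ q) (hc : Continuous Δ)
    (hi : ∀ t ∈ Icc p q, ∃ n : ℤ, Δ t = n) : Δ p = Δ q := by
  have : DiscreteTopology (range ((↑) : ℤ → ℝ)) :=
    Int.isClosedEmbedding_coe_real.isEmbedding.toHomeomorph.symm.isEmbedding.discreteTopology
  exact isPreconnected_Icc.constant_of_mapsTo ⟨this⟩ hc.continuousOn (T := range ((↑) : ℤ → ℝ))
    (fun t ht => by obtain ⟨n, hn⟩ := hi t ht; exact ⟨n, hn.symm⟩)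
    (left_mem_Icc.2 hpq) (right_mem_Icc.2 hpq)

theorem no_return {u : ℝ → ℝ} {a b : ℝ} (hab : a < b) (hc : ContinuousOn u (Icc a b))
    (hi : InjOn u (Ioo a b)) (hne : ∀ t ∈ Ioo a b, u t ≠ u a) : u a ≠ u b := by
  intro heq
  set m := (a + b) / 2 with hm
  have ham : a < m := by rw [hm]; linarith
  have hmb : m < b := by rw [hm]; linarith
  have hum := hne m ⟨ham, hmb⟩
  have h1 := intermediate_value_uIcc (a := a) (b := m) (f := u)
    (hc.mono (by rw [uIcc_of_le ham.le]; exact Icc_subset_Icc_right hmb.le))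
  have h2 := intermediate_value_uIcc (a := m) (b := b) (f := u)
    (hc.mono (by rw [uIcc_of_le hmb.le]; exact Icc_subset_Icc_left ham.le))
  have v1 : (u a + u m) / 2 ∈ uIcc (u a) (u m) := by
    rw [mem_uIcc]
    rcases le_total (u a) (u m) with h | h
    · left; constructor <;> linarith
    · right; constructor <;> linarith
  have v2 : (u a + u m) / 2 ∈ uIcc (u m) (u b) := by
    rw [← heq, uIcc_comm]; exact v1
  obtain ⟨t1, ht1, e1⟩ := h1 v1
  obtain ⟨t2, ht2, e2⟩ := h2 v2
  rw [uIcc_of_le ham.le] at ht1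
  rw [uIcc_of_le hmb.le] at ht2
  have n1 : t1 ≠ a := by rintro rfl; apply hum; linarith
  have n2 : t1 ≠ m := by rintro rfl; apply hum; linarith
  have n3 : t2 ≠ b := by rintro rfl; apply hum; linarith
  have l1 : a < t1 := lt_of_le_of_ne ht1.1 (Ne.symm n1)
  have l2 : t1 < m := lt_of_le_of_ne ht1.2 n2
  have l3 : t2 < b := lt_of_le_of_ne ht2.2 n3
  have := hi ⟨l1, l2.trans hmb⟩ ⟨ham.trans_le ht2.1, l3⟩ (e1.trans e2.symm)
  linarith [ht2.1]

variable {X : Type*} [TopologicalSpace X] {V : Set X} {E : Type*}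

theorem P1 [T2Space X] (S : ES X V E) {f : ℝ → X} (hf : Continuous f) {p q : ℝ}
    (hp : f p ∈ V) (hq : f q ∈ V) (e : E) (hinj : InjOn f (Icc p q ∩ f ⁻¹' S.ed e))
    (hne : S.γ e 0 ≠ S.γ e 1) {t0 : ℝ} (ht0 : t0 ∈ Icc p q) (h0 : f t0 ∈ S.ed e) :
    ∃ a b, p ≤ a ∧ a < b ∧ b ≤ q ∧ (∀ t ∈ Icc p q, f t ∈ S.ed e ↔ t ∈ Ioo a b) ∧
      ((f a = S.γ e 0 ∧ f b = S.γ e 1) ∨ (f a = S.γ e 1 ∧ f b = S.γ e 0)) ∧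
      S.ed e ⊆ f '' Ioo a b := by
  have hcl : IsClosed {t | f t ∉ S.ed e} := ((S.op e).preimage hf).isClosed_compl
  -- a
  have ka : IsCompact (Icc p t0 ∩ {t | f t ∉ S.ed e}) := isCompact_Icc.inter_right hcl
  have kb : IsCompact (Icc t0 q ∩ {t | f t ∉ S.ed e}) := isCompact_Icc.inter_right hcl
  obtain ⟨a, ⟨ha, ha'⟩, hamax⟩ := ka.exists_isMaxOn ⟨p, ⟨le_rfl, ht0.1⟩, fun h => S.ed_V h hp⟩ continuousOn_id
  obtain ⟨b, ⟨hb, hb'⟩, hbmin⟩ := kb.exists_isMinOn ⟨q, ⟨ht0.2, le_rfl⟩, fun h => S.ed_V h hq⟩ continuousOn_id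
  have hat : a < t0 := lt_of_le_of_ne ha.2 (fun h => ha' (h ▸ h0))
  have htb : t0 < b := lt_of_le_of_ne hb.1 (fun h => hb' (h ▸ h0))
  have hab := hat.trans htb
  have hin : ∀ t ∈ Ioo a b, f t ∈ S.ed e := by
    intro t ht
    by_contra hcon
    rcases le_total t t0 with h | h
    · have := hamax ⟨⟨ha.1.trans ht.1.le, h⟩, hcon⟩
      simp only [mem_ofPred_eq, id] at this
      linarith [ht.1]
    · have := hbmin ⟨⟨h, ht.2.le.trans hb.2⟩, hcon⟩
      simp only [mem_ofPred_eq, id] at this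
      linarith [ht.2]
  have hsub : Icc a b ⊆ Icc p q := Icc_subset_Icc ha.1 hb.2
  have himg : ∀ t ∈ Icc a b, f t ∈ S.γ e '' Icc 0 1 := by
    have hcl2 : IsClosed (f ⁻¹' (S.γ e '' Icc 0 1)) :=
      ((isCompact_Icc.image (S.cont e)).isClosed).preimage hf
    have h1 : Ioo a b ⊆ f ⁻¹' (S.γ e '' Icc 0 1) := fun t ht => image_mono Ioo_subset_Icc_self (hin t ht)
    have h2 := closure_minimal h1 hcl2
    rw [closure_Ioo hab.ne] at h2
    exact h2
  have gi : Injective (fun s : Icc (0:ℝ) 1 => S.γ e s.1) := by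
    have key : ∀ s s' : ℝ, s ∈ Icc (0:ℝ) 1 → s' ∈ Icc (0:ℝ) 1 → S.γ e s = S.γ e s' → s = s' := by
      intro s s' hs hs' h
      rcases Icc_cases hs with rfl | rfl | h1 <;> rcases Icc_cases hs' with rfl | rfl | h2
      · rfl
      · exact absurd h hne
      · exact absurd (h ▸ S.g0 e) (S.inV e _ h2)
      · exact absurd h.symm hne
      · rfl
      · exact absurd (h ▸ S.g1 e) (S.inV e _ h2)
      · exact absurd (h ▸ S.g0 e) (S.inV e _ h1)
      · exact absurd (h ▸ S.g1 e) (S.inV e _ h1)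
      · exact (S.inj _ _ _ _ h1 h2 h).2
    intro s s' h
    exact Subtype.ext (key s s' s.2 s'.2 h)
  have emb := ((S.cont e).comp continuous_subtype_val : Continuous (fun s : Icc (0:ℝ) 1 => S.γ e s.1)).isClosedEmbedding gi
  have hex : ∀ t, ∃ u : Icc (0:ℝ) 1, t ∈ Icc a b → S.γ e u = f t := by
    intro t
    by_cases ht : t ∈ Icc a b
    · obtain ⟨u, hu, h⟩ := himg t ht
      exact ⟨⟨u, hu⟩, fun _ => h⟩
    · exact ⟨⟨0, by simp⟩, fun h => absurd h ht⟩
  choose u hu using hex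
  have uc : ContinuousOn u (Icc a b) := by
    rw [emb.isInducing.continuousOn_iff]
    exact hf.continuousOn.congr (fun t ht => hu t ht)
  have uc' : ContinuousOn (fun t => (u t).1) (Icc a b) := continuous_subtype_val.comp_continuousOn uc
  have aI : a ∈ Icc a b := left_mem_Icc.2 hab.le
  have bI : b ∈ Icc a b := right_mem_Icc.2 hab.le
  have uend : ∀ t ∈ Icc a b, f t ∉ S.ed e → (u t).1 = 0 ∨ (u t).1 = 1 := by
    intro t ht h
    rcases Icc_cases (u t).2 with h1 | h1 | h1
    · exact Or.inl h1
    · exact Or.inr h1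
    · exact absurd ⟨_, h1, hu t ht⟩ h
  have uin : ∀ t ∈ Ioo a b, (u t).1 ∈ Ioo (0:ℝ) 1 := by
    intro t ht
    have h1 := hin t ht
    rw [← hu t (Ioo_subset_Icc_self ht)] at h1
    rcases Icc_cases (u t).2 with h2 | h2 | h2
    · rw [h2] at h1; exact absurd (S.g0 e) (S.ed_V h1)
    · rw [h2] at h1; exact absurd (S.g1 e) (S.ed_V h1)
    · exact h2
  have uinj : InjOn (fun t => (u t).1) (Ioo a b) := by
    intro t ht t' ht' h
    have h1 : f t = f t' := by
      rw [← hu t (Ioo_subset_Icc_self ht), ← hu t' (Ioo_subset_Icc_self ht')]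
      simp only at h
      rw [h]
    exact hinj ⟨hsub (Ioo_subset_Icc_self ht), hin t ht⟩ ⟨hsub (Ioo_subset_Icc_self ht'), hin t' ht'⟩ h1
  have une := no_return hab uc' uinj (by
    intro t ht h
    have h1 := uin t ht
    rw [h] at h1
    rcases uend a aI ha' with h2 | h2 <;> rw [h2] at h1 <;> simp at h1)
  have hfa := hu a aI
  have hfb := hu b bI
  have ends : ((u a).1 = 0 ∧ (u b).1 = 1) ∨ ((u a).1 = 1 ∧ (u b).1 = 0) := by
    rcases uend a aI ha' with h2 | h2 <;> rcases uend b bI hb' with h3 | h3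
    · exact absurd (h2.trans h3.symm) une
    · exact Or.inl ⟨h2, h3⟩
    · exact Or.inr ⟨h2, h3⟩
    · exact absurd (h2.trans h3.symm) une
  have hsurj : S.ed e ⊆ f '' Ioo a b := by
    rintro z ⟨s, hs, rfl⟩
    have hiv := intermediate_value_uIcc (a := a) (b := b) (f := fun t => (u t).1)
      (by rw [uIcc_of_le hab.le]; exact uc')
    have hs' : s ∈ uIcc (u a).1 (u b).1 := by
      rcases ends with ⟨h2, h3⟩ | ⟨h2, h3⟩ <;> rw [h2, h3, mem_uIcc]
      · exact Or.inl ⟨hs.1.le, hs.2.le⟩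
      · exact Or.inr ⟨hs.1.le, hs.2.le⟩
    obtain ⟨t, ht, hts⟩ := hiv hs'
    rw [uIcc_of_le hab.le] at ht
    simp only at hts
    have hft : f t = S.γ e s := by rw [← hu t ht, hts]
    have hfe : f t ∈ S.ed e := hft ▸ ⟨s, hs, rfl⟩
    refine ⟨t, ⟨lt_of_le_of_ne ht.1 ?_, lt_of_le_of_ne ht.2 ?_⟩, hft⟩
    · rintro rfl; exact ha' hfe
    · rintro rfl; exact hb' hfe
  refine ⟨a, b, ha.1, hab, hb.2, ?_, ?_, hsurj⟩
  · intro t ht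
    refine ⟨fun h => ?_, hin t⟩
    obtain ⟨t', ht', h'⟩ := hsurj h
    have := hinj ⟨ht, h⟩ ⟨hsub (Ioo_subset_Icc_self ht'), hin t' ht'⟩ h'.symm
    rw [this]; exact ht'
  · rcases ends with ⟨h2, h3⟩ | ⟨h2, h3⟩ <;> rw [← hfa, ← hfb, h2, h3]
    · exact Or.inl ⟨rfl, rfl⟩
    · exact Or.inr ⟨rfl, rfl⟩

open Classical in
theorem lemP [CompactSpace X] [T2Space X] (hV : IsClosed V) (S : ES X V E) {f : ℝ → X}
    (hf : Continuous f) {p q : ℝ} (hpq : p ≤ q)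
    (hp : f p ∈ V) (hq : f q ∈ V) (hinj : ∀ e, InjOn f (Icc p q ∩ f ⁻¹' S.ed e))
    (A : Set V) (hA : IsClopen A) :
    Even {e ∈ cu S.s S.t A | ∃ t ∈ Icc p q, f t ∈ S.ed e}.ncard ↔
      ((⟨f p, hp⟩ : V) ∈ A ↔ (⟨f q, hq⟩ : V) ∈ A) := by
  set D := {e ∈ cu S.s S.t A | ∃ t ∈ Icc p q, f t ∈ S.ed e} with hD
  have hDf : D.Finite := (hfin_of hV S A hA).subset (fun e he => he.1)
  have nl : ∀ e ∈ cu S.s S.t A, S.γ e 0 ≠ S.γ e 1 := by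
    intro e he h
    have : S.s e = S.t e := Subtype.ext h
    simp [cu, this] at he
  have H : ∀ e : D, ∃ a b, p ≤ a ∧ a < b ∧ b ≤ q ∧ (∀ t ∈ Icc p q, f t ∈ S.ed e.1 ↔ t ∈ Ioo a b) ∧
      ((f a = S.γ e.1 0 ∧ f b = S.γ e.1 1) ∨ (f a = S.γ e.1 1 ∧ f b = S.γ e.1 0)) ∧
      S.ed e.1 ⊆ f '' Ioo a b := by
    rintro ⟨e, he, t0, ht0, h0⟩
    exact P1 S hf hp hq e (hinj e) (nl e he) ht0 h0
  choose a b hpa hab hbq hio hends hsurj using H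
  obtain ⟨h, hc, hh, hcon⟩ := hA_exists hV S A hA
  have hFt : Fintype D := hDf.fintype
  let cl : D → ℝ → ℝ := fun e t => max (a e) (min (b e) t)
  have clle : ∀ e t, t ≤ a e → cl e t = a e := fun e t ht => by
    simp only [cl]; rw [min_eq_right (ht.trans (hab e).le), max_eq_left ht]
  have clge : ∀ e t, b e ≤ t → cl e t = b e := fun e t ht => by
    simp only [cl]; rw [min_eq_left ht, max_eq_right (hab e).le]
  have clin : ∀ e t, t ∈ Ioo (a e) (b e) → cl e t = t := fun e t ht => by
    simp only [cl]; rw [min_eq_right ht.2.le, max_eq_right ht.1.le]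
  have vint : ∀ v : V, ∃ n : ℤ, h v = n := by
    intro v; rw [hh]; rcases ind_01 A v with h | h <;> rw [h]
    · exact ⟨0, by simp⟩
    · exact ⟨1, by simp⟩
  have fa : ∀ e, f (a e) ∈ V := by
    intro e; rcases hends e with ⟨h1, _⟩ | ⟨h1, _⟩ <;> rw [h1]
    · exact S.g0 _
    · exact S.g1 _
  have fb : ∀ e, f (b e) ∈ V := by
    intro e; rcases hends e with ⟨_, h1⟩ | ⟨_, h1⟩ <;> rw [h1]
    · exact S.g1 _
    · exact S.g0 _
  let Δ : ℝ → ℝ := fun t => h (f t) - ∑ e : D, (h (f (cl e t)) - h (f (a e)))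
  have Δc : Continuous Δ := by
    refine (hc.comp hf).sub (continuous_finsetSum _ (fun e _ => ?_))
    exact (hc.comp (hf.comp (by simp only [cl]; fun_prop))).sub continuous_const
  have intout : ∀ e t, t ∉ Ioo (a e) (b e) → ∃ n : ℤ, h (f (cl e t)) - h (f (a e)) = n := by
    intro e t ht
    obtain ⟨n, hn⟩ := vint ⟨_, fa e⟩
    obtain ⟨m, hm⟩ := vint ⟨_, fb e⟩
    simp only at hn hm
    rcases le_or_gt t (a e) with h1 | h1
    · exact ⟨0, by rw [clle e t h1]; simp⟩
    · have : b e ≤ t := by by_contra h2; exact ht ⟨h1, not_le.1 h2⟩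
      exact ⟨m - n, by rw [clge e t this, hm, hn]; push_cast; ring⟩
  have sumint : ∀ (K : Finset D) (g : D → ℝ), (∀ e ∈ K, ∃ n : ℤ, g e = n) → ∃ n : ℤ, ∑ e ∈ K, g e = n := by
    intro K g hg
    have : ∀ e, ∃ n : ℤ, e ∈ K → g e = n := fun e => by
      by_cases he : e ∈ K
      · obtain ⟨n, hn⟩ := hg e he; exact ⟨n, fun _ => hn⟩
      · exact ⟨0, fun h => absurd h he⟩
    choose n hn using this
    refine ⟨∑ e ∈ K, n e, ?_⟩
    push_cast
    exact Finset.sum_congr rfl hn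
  have Δint : ∀ t ∈ Icc p q, ∃ n : ℤ, Δ t = n := by
    intro t ht
    by_cases hcase : ∃ e : D, f t ∈ S.ed e.1
    · obtain ⟨e0, he0⟩ := hcase
      have ht0 := (hio e0 t ht).1 he0
      obtain ⟨n, hn⟩ := sumint (Finset.univ.erase e0) (fun e => h (f (cl e t)) - h (f (a e))) (by
        intro e he
        refine intout e t (fun hte => ?_)
        have := S.ed_ed he0 ((hio e t ht).2 hte)
        exact Finset.ne_of_mem_erase he (Subtype.ext this.symm))
      obtain ⟨m, hm⟩ := vint ⟨_, fa e0⟩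
      simp only at hm
      refine ⟨m - n, ?_⟩
      simp only [Δ]
      rw [← Finset.add_sum_erase _ _ (Finset.mem_univ e0), hn, clin e0 t ht0, hm]
      push_cast; ring
    · push Not at hcase
      obtain ⟨n, hn⟩ := sumint Finset.univ (fun e => h (f (cl e t)) - h (f (a e))) (fun e _ =>
        intout e t (fun hte => hcase e ((hio e t ht).2 hte)))
      have : ∃ m : ℤ, h (f t) = m := by
        by_cases hfV : f t ∈ V
        · exact vint ⟨_, hfV⟩
        · obtain ⟨e, s, hs, hfe⟩ := S.surj _ hfV
          have hec : e ∉ cu S.s S.t A := fun hec =>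
            hcase ⟨e, hec, t, ht, s, hs, hfe⟩ ⟨s, hs, hfe⟩
          rw [← hfe, hcon e hec s (Ioo_subset_Icc_self hs), ← hh]
          exact vint _
      obtain ⟨m, hm⟩ := this
      refine ⟨m - n, ?_⟩
      simp only [Δ]
      rw [hn, hm]; push_cast; ring
  have key := int_const hpq Δc Δint
  simp only [Δ] at key
  rw [Finset.sum_eq_zero (fun e _ => by rw [clle e p (hpa e), sub_self]), sub_zero] at key
  rw [Finset.sum_congr rfl (fun e _ => by rw [clge e q (hbq e)])] at key
  obtain ⟨n, hn, hnp⟩ := par_sum Finset.univ (fun e : D => h (f (b e)) - h (f (a e))) (by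
    intro e _
    have hec := e.2.1
    have i0 : h (S.γ e.1 0) = ind A (S.s e.1) := hh (S.s e.1)
    have i1 : h (S.γ e.1 1) = ind A (S.t e.1) := hh (S.t e.1)
    simp only [cu, mem_ofPred_eq] at hec
    rcases hends e with ⟨h1, h2⟩ | ⟨h1, h2⟩ <;> simp only [h1, h2, i0, i1] <;>
      by_cases h3 : S.s e.1 ∈ A <;> by_cases h4 : S.t e.1 ∈ A <;> simp [ind, h3, h4] at hec ⊢)
  have card : (Finset.univ : Finset D).card = D.ncard := by
    rw [Finset.card_univ, ← Nat.card_eq_fintype_card]; rfl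
  rw [hn] at key
  rw [card] at hnp
  rw [← hnp, ← ind_eq_iff]
  have k1 : h (f p) = ind A ⟨f p, hp⟩ := hh ⟨f p, hp⟩
  have k2 : h (f q) = ind A ⟨f q, hq⟩ := hh ⟨f q, hq⟩
  rw [k1, k2] at key
  have hb : (n:ℝ) < 2 ∧ (-2:ℝ) < n ∧ (ind A ⟨f p, hp⟩ = ind A ⟨f q, hq⟩ ↔ (n:ℝ) = 0) := by
    refine ⟨?_, ?_, ?_⟩
    · rcases ind_01 A ⟨f p, hp⟩ with h | h <;> rcases ind_01 A ⟨f q, hq⟩ with h' | h' <;> rw [h, h'] at key <;> linarith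
    · rcases ind_01 A ⟨f p, hp⟩ with h | h <;> rcases ind_01 A ⟨f q, hq⟩ with h' | h' <;> rw [h, h'] at key <;> linarith
    · constructor <;> intro h <;> linarith
  rw [hb.2.2]
  have h5 : n < 2 := by exact_mod_cast hb.1
  have h6 : -2 < n := by exact_mod_cast hb.2.1
  constructor
  · rintro ⟨m, hm⟩
    have : n = 0 := by omega
    rw [this]; simp
  · intro h
    have : n = 0 := by exact_mod_cast h
    rw [this]; simp

end GLP
end

section
open Set Topology Filter Function

namespace GLP

variable {X : Type*} [TopologicalSpace X] {V : Set X} {E : Type*}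

theorem ES.nl (S : ES X V E) {A : Set V} {e : E} (he : e ∈ cu S.s S.t A) : S.γ e 0 ≠ S.γ e 1 := by
  intro h
  have : S.s e = S.t e := Subtype.ext h
  simp [cu, this] at he

theorem ES.cl_ed (S : ES X V E) (e : E) {s : ℝ} (hs : s ∈ Icc (0:ℝ) 1) : S.γ e s ∈ closure (S.ed e) := by
  have := image_closure_subset_closure_image (S.cont e) (s := Ioo 0 1)
  rw [closure_Ioo zero_ne_one] at this
  exact this ⟨s, hs, rfl⟩

theorem ES.ed_ne (S : ES X V E) (e : E) : (S.ed e).Nonempty := ⟨S.γ e (1/2), 1/2, by norm_num, rfl⟩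

theorem bond_inj [CompactSpace X] [T2Space X] (hV : IsClosed V) (S : ES X V E) (C : Set E)
    (hB : Bond S.s S.t C) (f : ℝ → X) (hf : Continuous f) (a b : C → ℝ)
    (hio : ∀ e t, f t ∈ S.ed e.1 ↔ t ∈ Ioo (a e) (b e))
    (hinj : ∀ e, InjOn f (Ioo (a e) (b e))) (hnot : ∀ e ∉ C, ∀ t, f t ∉ S.ed e)
    (hden : ∀ s t, 0 ≤ s → s < t → t ≤ 1 → ∃ r ∈ Ioo s t, ∃ e ∈ C, f r ∈ S.ed e)
    {s t : ℝ} (hs : 0 ≤ s) (hst : s < t) (ht : t ≤ 1) (heq : f s = f t) : s = 0 ∧ t = 1 := by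
  by_contra hcon
  have hsV : f s ∈ V := by
    by_contra h
    obtain ⟨e, he⟩ := S.ed_surj h
    by_cases heC : e ∈ C
    · have := hinj ⟨e, heC⟩ ((hio ⟨e, heC⟩ s).1 he) ((hio ⟨e, heC⟩ t).1 (heq ▸ he)) heq
      linarith
    · exact hnot e heC s he
  have htV : f t ∈ V := heq ▸ hsV
  have nV : ∀ e : C, ∀ r, f r ∈ V → r ∉ Ioo (a e) (b e) := fun e r hr h => S.ed_V ((hio e r).2 h) hr
  obtain ⟨r1, hr1, e1, he1, hre1⟩ := hden s t hs hst ht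
  have h2 : ∃ r2, (r2 < s ∨ t < r2) ∧ ∃ e ∈ C, f r2 ∈ S.ed e := by
    by_cases h : s = 0
    · have : t < 1 := lt_of_le_of_ne ht (fun h' => hcon ⟨h, h'⟩)
      obtain ⟨r, hr, e, he, h⟩ := hden t 1 (by linarith) this le_rfl
      exact ⟨r, Or.inr hr.1, e, he, h⟩
    · have : 0 < s := lt_of_le_of_ne hs (Ne.symm h)
      obtain ⟨r, hr, e, he, h⟩ := hden 0 s le_rfl this (by linarith)
      exact ⟨r, Or.inl hr.2, e, he, h⟩
  obtain ⟨r2, hr2, e2, he2, hre2⟩ := h2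
  -- e2 never hit in [s,t]
  have key : ∀ r ∈ Icc s t, f r ∉ S.ed e2 := by
    intro r hr h
    have i1 := (hio ⟨e2, he2⟩ r).1 h
    have i2 := (hio ⟨e2, he2⟩ r2).1 hre2
    rcases hr2 with h3 | h3
    · exact nV ⟨e2, he2⟩ s hsV ⟨i2.1.trans h3, hr.1.trans_lt i1.2⟩
    · exact nV ⟨e2, he2⟩ t htV ⟨i1.1.trans_le hr.2, h3.trans i2.2⟩
  have hne : e1 ≠ e2 := by
    rintro rfl
    exact key r1 (Ioo_subset_Icc_self hr1) hre1
  obtain ⟨A, hA, hAC⟩ := hB e1 he1 e2 he2 hne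
  have hP := lemP hV S hf hst.le hsV htV (fun e => by
    by_cases heC : e ∈ C
    · intro r hr r' hr' h
      exact hinj ⟨e, heC⟩ ((hio ⟨e, heC⟩ r).1 hr.2) ((hio ⟨e, heC⟩ r').1 hr'.2) h
    · intro r hr
      exact absurd hr.2 (hnot e heC r)) A hA
  have hD : {e ∈ cu S.s S.t A | ∃ t_1 ∈ Icc s t, f t_1 ∈ S.ed e} = {e1} := by
    ext e
    simp only [mem_ofPred_eq, mem_singleton_iff]
    constructor
    · rintro ⟨h1, r, hr, h2⟩
      have heC : e ∈ C := by by_contra h; exact hnot e h r h2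
      have : e ∈ ({e1, e2} : Set E) := hAC ▸ ⟨h1, heC⟩
      rcases this with h | h
      · exact h
      · rw [mem_singleton_iff] at h; subst h; exact absurd h2 (key r hr)
    · rintro rfl
      have : e ∈ cu S.s S.t A ∩ C := by rw [hAC]; simp
      exact ⟨this.1, r1, Ioo_subset_Icc_self hr1, hre1⟩
  rw [hD, ncard_singleton] at hP
  have : ¬ Even 1 := by decide
  apply this
  rw [hP]
  have : (⟨f s, hsV⟩ : V) = ⟨f t, htV⟩ := Subtype.ext heq
  rw [this]

theorem arc_exists [CompactSpace X] [T2Space X] (hV : IsClosed V) [TotallyDisconnectedSpace V]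
    [Countable E] (S : ES X V E) (C : Set E) (hC : C.Nonempty) (x y : V)
    (hpar : Par S.s S.t C x y) (hconn : Conn S.s S.t C x) (hB : Bond S.s S.t C) (hxy : x ≠ y) :
    ∃ K : Set X, Nonempty (K ≃ₜ unitInterval) ∧ ∀ e, S.ed e ⊆ K ↔ e ∈ C := by
  obtain ⟨f, hf, f0, f1, a, b, hab, hio, hinj, hsurj, hnot, hden⟩ := thmT hV S C hC x y hpar hconn
  have key := fun {s t : ℝ} => bond_inj hV S C hB f hf a b hio hinj hnot hden (s := s) (t := t)
  let g : unitInterval → X := fun t => f t.1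
  have gc : Continuous g := hf.comp continuous_subtype_val
  have ne01 : f 0 ≠ f 1 := by rw [f0, f1]; exact fun h => hxy (Subtype.ext h)
  have gi : Injective g := by
    have aux : ∀ s t : unitInterval, s.1 < t.1 → g s ≠ g t := by
      intro s t hst h
      have := key s.2.1 hst t.2.2 h
      apply ne01; rw [← this.1, ← this.2]; exact h
    intro s t h
    rcases lt_trichotomy s.1 t.1 with h1 | h1 | h1
    · exact absurd h (aux s t h1)
    · exact Subtype.ext h1
    · exact absurd h.symm (aux t s h1)
  refine ⟨range g, ⟨(gc.isClosedEmbedding gi).isEmbedding.toHomeomorph.symm⟩, fun e => ⟨fun h => ?_, fun he z hz => ?_⟩⟩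
  · by_contra hc
    obtain ⟨z, hz⟩ := S.ed_ne e
    obtain ⟨t, ht⟩ := h hz
    exact hnot e hc t.1 (by have : f t.1 = z := ht
                            rw [this]; exact hz)
  · obtain ⟨t, ht, rfl⟩ := hsurj ⟨e, he⟩ hz
    have := hab ⟨e, he⟩
    exact ⟨⟨t, by linarith [ht.1], by linarith [ht.2]⟩, rfl⟩

theorem circle_exists [CompactSpace X] [T2Space X] (hV : IsClosed V) [TotallyDisconnectedSpace V]
    [Countable E] (S : ES X V E) (C : Set E) (hC : C.Nonempty) (x : V)
    (hpar : Par S.s S.t C x x) (hconn : Conn S.s S.t C x) (hB : Bond S.s S.t C) :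
    ∃ K : Set X, Nonempty (K ≃ₜ Circle) ∧ ∀ e, S.ed e ⊆ K ↔ e ∈ C := by
  obtain ⟨f, hf, f0, f1, a, b, hab, hio, hinj, hsurj, hnot, hden⟩ := thmT hV S C hC x x hpar hconn
  have key := fun {s t : ℝ} => bond_inj hV S C hB f hf a b hio hinj hnot hden (s := s) (t := t)
  have : Fact ((0:ℝ) < 1) := ⟨one_pos⟩
  let g : AddCircle (1:ℝ) → X := AddCircle.liftIco 1 0 f
  have gc : Continuous g := AddCircle.liftIco_continuous (by rw [zero_add, f0, f1]) hf.continuousOn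
  have gcoe : ∀ t ∈ Ico (0:ℝ) 1, g (t : AddCircle (1:ℝ)) = f t := fun t ht =>
    AddCircle.liftIco_coe_apply (by rwa [zero_add])
  have rep : ∀ z : AddCircle (1:ℝ), ∃ t ∈ Ico (0:ℝ) 1, (t : AddCircle (1:ℝ)) = z := by
    intro z
    have : z ∈ ((↑) : ℝ → AddCircle (1:ℝ)) '' Ico 0 (0 + 1) := by
      rw [AddCircle.coe_image_Ico_eq]; trivial
    rw [zero_add] at this
    exact this
  have gi : Injective g := by
    have aux : ∀ s t : ℝ, s ∈ Ico (0:ℝ) 1 → t ∈ Ico (0:ℝ) 1 → s < t → f s ≠ f t := by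
      intro s t hs ht hst h
      have := key hs.1 hst ht.2.le h
      linarith [ht.2]
    intro z z' h
    obtain ⟨s, hs, rfl⟩ := rep z
    obtain ⟨t, ht, rfl⟩ := rep z'
    rw [gcoe s hs, gcoe t ht] at h
    rcases lt_trichotomy s t with h1 | h1 | h1
    · exact absurd h (aux s t hs ht h1)
    · rw [h1]
    · exact absurd h.symm (aux t s ht hs h1)
  refine ⟨range g, ⟨(gc.isClosedEmbedding gi).isEmbedding.toHomeomorph.symm.trans
    (AddCircle.homeomorphCircle one_ne_zero)⟩, fun e => ⟨fun h => ?_, fun he z hz => ?_⟩⟩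
  · by_contra hc
    obtain ⟨z, hz⟩ := S.ed_ne e
    obtain ⟨u, hu⟩ := h hz
    obtain ⟨t, ht, rfl⟩ := rep u
    rw [gcoe t ht] at hu
    exact hnot e hc t (by rw [hu]; exact hz)
  · obtain ⟨t, ht, rfl⟩ := hsurj ⟨e, he⟩ hz
    have := hab ⟨e, he⟩
    exact ⟨(t : AddCircle (1:ℝ)), gcoe t ⟨by linarith [ht.1], by linarith [ht.2]⟩⟩

theorem arc_par [CompactSpace X] [T2Space X] (hV : IsClosed V) (S : ES X V E) (K : Set X)
    (φ : K ≃ₜ unitInterval) (e0 : E) (he0 : S.ed e0 ⊆ K) :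
    ∃ x y : V, x ≠ y ∧ ∀ A : Set V, IsClopen A →
      (Even {e ∈ cu S.s S.t A | S.ed e ⊆ K}.ncard ↔ (x ∈ A ↔ y ∈ A)) := by
  have hKc : IsClosed K := by
    have : CompactSpace K := φ.symm.compactSpace
    exact (isCompact_iff_compactSpace.2 this).isClosed
  let f : ℝ → X := fun t => (φ.symm (projIcc (0:ℝ) 1 zero_le_one t)).1
  have hf : Continuous f := continuous_subtype_val.comp (φ.symm.continuous.comp continuous_projIcc)
  have finj : InjOn f (Icc 0 1) := by
    intro s hs t ht h
    have := φ.symm.injective (Subtype.ext h)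
    rw [projIcc_of_mem _ hs, projIcc_of_mem _ ht] at this
    exact congrArg Subtype.val this
  have fK : ∀ t, f t ∈ K := fun t => (φ.symm _).2
  -- parametrised edges inside K
  have H : ∀ e, S.ed e ⊆ K → ∃ ψ : ℝ → ℝ, Continuous ψ ∧ (∀ s, ψ s ∈ Icc (0:ℝ) 1) ∧
      (∀ s ∈ Icc (0:ℝ) 1, f (ψ s) = S.γ e s) ∧ ψ 0 ≠ ψ 1 := by
    intro e he
    have hcl : ∀ s : ℝ, S.γ e (projIcc (0:ℝ) 1 zero_le_one s) ∈ K := fun s =>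
      hKc.closure_subset_iff.2 he (S.cl_ed e (projIcc (0:ℝ) 1 zero_le_one s).2)
    let ψ : ℝ → ℝ := fun s => (φ ⟨_, hcl s⟩).1
    have ψc : Continuous ψ := continuous_subtype_val.comp (φ.continuous.comp
      (((S.cont e).comp (continuous_subtype_val.comp continuous_projIcc)).subtype_mk _))
    have ψI : ∀ s, ψ s ∈ Icc (0:ℝ) 1 := fun s => (φ ⟨_, hcl s⟩).2
    have ψf : ∀ s ∈ Icc (0:ℝ) 1, f (ψ s) = S.γ e s := by
      intro s hs
      simp only [f]
      rw [projIcc_of_mem _ (ψI s)]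
      have : (⟨ψ s, ψI s⟩ : Icc (0:ℝ) 1) = φ ⟨_, hcl s⟩ := rfl
      rw [this, φ.symm_apply_apply]
      show S.γ e (projIcc (0:ℝ) 1 zero_le_one s).1 = S.γ e s
      rw [projIcc_of_mem _ hs]
    refine ⟨ψ, ψc, ψI, ψf, no_return one_pos ψc.continuousOn ?_ ?_⟩
    · intro s hs t ht h
      have := congrArg f h
      rw [ψf s (Ioo_subset_Icc_self hs), ψf t (Ioo_subset_Icc_self ht)] at this
      exact (S.inj _ _ _ _ hs ht this).2
    · intro s hs h
      have := congrArg f h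
      rw [ψf s (Ioo_subset_Icc_self hs), ψf 0 (by simp)] at this
      exact S.inV e s hs (this ▸ S.g0 e)
  have kZ : IsCompact (Icc 0 1 ∩ f ⁻¹' V) := isCompact_Icc.inter_right (hV.preimage hf)
  obtain ⟨ψ0, ψ0c, ψ0I, ψ0f, ψ0ne⟩ := H e0 he0
  have Zne : (Icc 0 1 ∩ f ⁻¹' V).Nonempty := ⟨ψ0 0, ψ0I 0, by
    rw [mem_preimage, ψ0f 0 (by simp)]; exact S.g0 e0⟩
  obtain ⟨p, ⟨hp, hpV⟩, hpmin⟩ := kZ.exists_isMinOn Zne continuousOn_id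
  obtain ⟨q, ⟨hq, hqV⟩, hqmax⟩ := kZ.exists_isMaxOn Zne continuousOn_id
  have hZ : ∀ t ∈ Icc (0:ℝ) 1, f t ∈ V → p ≤ t ∧ t ≤ q := fun t ht hV =>
    ⟨hpmin ⟨ht, hV⟩, hqmax ⟨ht, hV⟩⟩
  have hsub : Icc p q ⊆ Icc 0 1 := Icc_subset_Icc hp.1 hq.2
  have hpq : p < q := by
    have h1 := hZ (ψ0 0) (ψ0I 0) (by rw [ψ0f 0 (by simp)]; exact S.g0 e0)
    have h2 := hZ (ψ0 1) (ψ0I 1) (by rw [ψ0f 1 (by simp)]; exact S.g1 e0)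
    by_contra h
    apply ψ0ne
    linarith
  have hPinj : ∀ e, InjOn f (Icc p q ∩ f ⁻¹' S.ed e) := fun e => finj.mono (fun t ht => hsub ht.1)
  refine ⟨⟨f p, hpV⟩, ⟨f q, hqV⟩, ?_, ?_⟩
  · intro h
    have h' : f p = f q := Subtype.mk.inj h
    have := finj hp hq h'
    linarith
  · intro A hA
    rw [← lemP hV S hf hpq.le hpV hqV hPinj A hA]
    have : {e ∈ cu S.s S.t A | S.ed e ⊆ K} = {e ∈ cu S.s S.t A | ∃ t ∈ Icc p q, f t ∈ S.ed e} := by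
      ext e
      simp only [mem_ofPred_eq]
      refine and_congr_right (fun hec => ⟨fun he => ?_, ?_⟩)
      · obtain ⟨ψ, ψc, ψI, ψf, ψne⟩ := H e he
        have h1 := hZ (ψ 0) (ψI 0) (by rw [ψf 0 (by simp)]; exact S.g0 e)
        have h2 := hZ (ψ 1) (ψI 1) (by rw [ψf 1 (by simp)]; exact S.g1 e)
        have hiv := intermediate_value_uIcc (a := (0:ℝ)) (b := 1) (f := ψ) ψc.continuousOn
        have v1 : (ψ 0 + ψ 1) / 2 ∈ uIcc (ψ 0) (ψ 1) := by
          rw [mem_uIcc]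
          rcases le_total (ψ 0) (ψ 1) with h | h
          · left; constructor <;> linarith
          · right; constructor <;> linarith
        obtain ⟨s, hs, hs'⟩ := hiv v1
        rw [uIcc_of_le zero_le_one] at hs
        rcases Icc_cases hs with rfl | rfl | h
        · exact absurd (by linarith) ψne
        · exact absurd (by linarith) ψne
        · refine ⟨ψ s, ⟨by linarith, by linarith⟩, ?_⟩
          rw [ψf s hs]; exact ⟨s, h, rfl⟩
      · rintro ⟨t, ht, h⟩
        obtain ⟨a, b, _, _, _, _, _, h2⟩ := P1 S hf hpV hqV e (hPinj e) (S.nl hec) ht h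
        intro z hz
        obtain ⟨t, _, rfl⟩ := h2 hz
        exact fK t
    rw [this]

theorem circle_par [CompactSpace X] [T2Space X] (hV : IsClosed V) (S : ES X V E) (K : Set X)
    (φ' : K ≃ₜ Circle) (A : Set V) (hA : IsClopen A) :
    Even {e ∈ cu S.s S.t A | S.ed e ⊆ K}.ncard := by
  by_cases hex : ∃ e0, S.ed e0 ⊆ K
  swap
  · push Not at hex
    have : {e ∈ cu S.s S.t A | S.ed e ⊆ K} = ∅ := by
      ext e; simp [hex e]
    rw [this]; simp
  obtain ⟨e0, he0⟩ := hex
  have : Fact ((0:ℝ) < 1) := ⟨one_pos⟩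
  let φ : K ≃ₜ AddCircle (1:ℝ) := φ'.trans (AddCircle.homeomorphCircle one_ne_zero).symm
  have hKc : IsClosed K := by
    have : CompactSpace K := φ.symm.compactSpace
    exact (isCompact_iff_compactSpace.2 this).isClosed
  have hv0 : S.γ e0 0 ∈ K := hKc.closure_subset_iff.2 he0 (S.cl_ed e0 (by simp))
  let f : ℝ → X := fun t => (φ.symm ((t : AddCircle (1:ℝ)) + φ ⟨_, hv0⟩)).1
  have hf : Continuous f := continuous_subtype_val.comp (φ.symm.continuous.comp
    ((AddCircle.continuous_mk' (1:ℝ)).add continuous_const))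
  have f0 : f 0 = S.γ e0 0 := by simp [f]
  have f1 : f 1 = S.γ e0 0 := by simp only [f]; rw [AddCircle.coe_period]; simp
  have finj : InjOn f (Ico 0 1) := by
    intro s hs t ht h
    have := φ.symm.injective (Subtype.ext h)
    have := add_right_cancel this
    rwa [AddCircle.coe_eq_coe_iff_of_mem_Ico (a := 0) (by rwa [zero_add]) (by rwa [zero_add])] at this
  have fK : ∀ t, f t ∈ K := fun t => (φ.symm _).2
  have fsurj : ∀ z ∈ K, ∃ t ∈ Ico (0:ℝ) 1, f t = z := by
    intro z hz
    have : φ ⟨z, hz⟩ - φ ⟨_, hv0⟩ ∈ ((↑) : ℝ → AddCircle (1:ℝ)) '' Ico 0 (0 + 1) := by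
      rw [AddCircle.coe_image_Ico_eq]; trivial
    rw [zero_add] at this
    obtain ⟨t, ht, h⟩ := this
    refine ⟨t, ht, ?_⟩
    simp only [f]
    rw [h]; simp
  have h0V : f 0 ∈ V := by rw [f0]; exact S.g0 e0
  have h1V : f 1 ∈ V := by rw [f1]; exact S.g0 e0
  have hPinj : ∀ e, InjOn f (Icc 0 1 ∩ f ⁻¹' S.ed e) := fun e => finj.mono (fun t ht => by
    refine ⟨ht.1.1, lt_of_le_of_ne ht.1.2 ?_⟩
    rintro rfl
    exact S.ed_V ht.2 h1V)
  have hP := lemP hV S hf zero_le_one h0V h1V hPinj A hA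
  have : {e ∈ cu S.s S.t A | S.ed e ⊆ K} = {e ∈ cu S.s S.t A | ∃ t ∈ Icc (0:ℝ) 1, f t ∈ S.ed e} := by
    ext e
    simp only [mem_ofPred_eq]
    refine and_congr_right (fun hec => ⟨fun he => ?_, ?_⟩)
    · obtain ⟨z, hz⟩ := S.ed_ne e
      obtain ⟨t, ht, rfl⟩ := fsurj z (he hz)
      exact ⟨t, Ico_subset_Icc_self ht, hz⟩
    · rintro ⟨t, ht, h⟩
      obtain ⟨a, b, _, _, _, _, _, h2⟩ := P1 S hf h0V h1V e (hPinj e) (S.nl hec) ht h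
      intro z hz
      obtain ⟨t, _, rfl⟩ := h2 hz
      exact fK t
  rw [this, hP]
  have : (⟨f 0, h0V⟩ : V) = ⟨f 1, h1V⟩ := Subtype.ext (f0.trans f1.symm)
  rw [this]

end GLP
end

section
open Set Topology Filter Function
namespace GLP
section
variable {V E : Type*} [TopologicalSpace V] {s t : E → V}

theorem even_symmDiff {E : Type*} {a b : Set E} (ha : a.Finite) (hb : b.Finite) :
    Even (symmDiff a b).ncard ↔ (Even a.ncard ↔ Even b.ncard) := by
  have h1 := Set.ncard_inter_add_ncard_sdiff_eq_ncard a b ha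
  have h2 := Set.ncard_inter_add_ncard_sdiff_eq_ncard b a hb
  rw [Set.inter_comm b a] at h2
  have h3 : (symmDiff a b).ncard = (a \ b).ncard + (b \ a).ncard := by
    rw [Set.symmDiff_def]
    exact Set.ncard_union_eq (by
      rw [Set.disjoint_left]; rintro e ⟨h, _⟩ ⟨_, h'⟩; exact h' h) ha.sdiff hb.sdiff
  rw [h3, ← h1, ← h2]
  simp only [Nat.even_add]
  tauto

theorem cu_even_symmDiff (hfin : ∀ A, IsClopen A → (cu s t A).Finite) {A B : Set V}
    (hA : IsClopen A) (hB : IsClopen B) :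
    Even (cu s t (symmDiff A B)).ncard ↔ (Even (cu s t A).ncard ↔ Even (cu s t B).ncard) := by
  rw [← even_symmDiff (hfin A hA) (hfin B hB)]
  have : cu s t (symmDiff A B) = symmDiff (cu s t A) (cu s t B) := by
    ext e
    rw [cu_symmDiff, Set.mem_symmDiff]; tauto
  rw [this]

def Good (s t : E → V) (x y : V) (A : Set V) : Prop := Even (cu s t A).ncard ↔ (x ∈ A ↔ y ∈ A)

theorem Good.sd (hfin : ∀ A, IsClopen A → (cu s t A).Finite) {x y : V} {A B : Set V}
    (hA : IsClopen A) (hB : IsClopen B) (h1 : Good s t x y A) (h2 : Good s t x y B) :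
    Good s t x y (symmDiff A B) := by
  unfold Good at *
  rw [cu_even_symmDiff hfin hA hB, h1, h2, Set.mem_symmDiff, Set.mem_symmDiff]
  clear h1 h2
  by_cases a : x ∈ A <;> by_cases b : x ∈ B <;> by_cases c : y ∈ A <;> by_cases d : y ∈ B <;>
    simp [a, b, c, d]

def EvV (s t : E → V) (v : V) : Prop :=
  ∃ A, IsClopen A ∧ v ∈ A ∧ ∀ C, IsClopen C → v ∈ C → C ⊆ A → Even (cu s t C).ncard
def OdV (s t : E → V) (v : V) : Prop :=
  ∃ A, IsClopen A ∧ v ∈ A ∧ ∀ C, IsClopen C → v ∈ C → C ⊆ A → Odd (cu s t C).ncard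

theorem not_both {v : V} (h1 : EvV s t v) (h2 : OdV s t v) : False := by
  obtain ⟨A, hA, hvA, h1⟩ := h1
  obtain ⟨B, hB, hvB, h2⟩ := h2
  have e1 := h1 _ (hA.inter hB) ⟨hvA, hvB⟩ inter_subset_left
  have e2 := h2 _ (hA.inter hB) ⟨hvA, hvB⟩ inter_subset_right
  exact Nat.not_even_iff_odd.2 e2 e1

theorem core_vert [CompactSpace V] [T2Space V] [TotallyDisconnectedSpace V]
    {x y : V} (hxy : x ≠ y)
    (h : ∀ A, IsClopen A → (Even (cu s t A).ncard ↔ (x ∈ A ↔ y ∈ A))) :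
    (∀ v, OdV s t v ↔ v = x ∨ v = y) ∧ ∀ v, v ≠ x → v ≠ y → EvV s t v := by
  have ev : ∀ v, v ≠ x → v ≠ y → EvV s t v := by
    intro v hx hy
    obtain ⟨A, hA, hvA, hxA⟩ := sep hx
    obtain ⟨B, hB, hvB, hyB⟩ := sep hy
    refine ⟨A ∩ B, hA.inter hB, ⟨hvA, hvB⟩, fun C hC hvC hCs => ?_⟩
    rw [h C hC]
    exact ⟨fun hh => (hxA (hCs hh).1).elim, fun hh => (hyB (hCs hh).2).elim⟩
  refine ⟨fun v => ⟨fun ho => ?_, ?_⟩, ev⟩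
  · by_contra hc
    push Not at hc
    exact not_both (ev v hc.1 hc.2) ho
  · rintro (rfl | rfl)
    · obtain ⟨A, hA, hvA, hxA⟩ := sep hxy
      refine ⟨A, hA, hvA, fun C hC hvC hCs => ?_⟩
      rw [← Nat.not_even_iff_odd, h C hC]
      exact fun hh => hxA (hCs (hh.1 hvC))
    · obtain ⟨A, hA, hvA, hxA⟩ := sep hxy.symm
      refine ⟨A, hA, hvA, fun C hC hvC hCs => ?_⟩
      rw [← Nat.not_even_iff_odd, h C hC]
      exact fun hh => hxA (hCs (hh.2 hvC))

theorem vert_core [CompactSpace V] [T2Space V] [TotallyDisconnectedSpace V]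
    (hfin : ∀ A, IsClopen A → (cu s t A).Finite)
    {x y : V} (hxy : x ≠ y) (hx : OdV s t x) (hy : OdV s t y)
    (hev : ∀ v, v ≠ x → v ≠ y → EvV s t v) (A : Set V) (hA : IsClopen A) : Good s t x y A := by
  have loc0 : ∀ v, ∃ A, IsClopen A ∧ v ∈ A ∧ ∀ C, IsClopen C → v ∈ C → C ⊆ A → Good s t x y C := by
    intro v
    by_cases hvx : v = x
    · subst hvx
      obtain ⟨A, hA, hvA, h⟩ := hx
      obtain ⟨B, hB, hvB, hyB⟩ := sep hxy
      refine ⟨A ∩ B, hA.inter hB, ⟨hvA, hvB⟩, fun C hC hvC hCs => ?_⟩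
      have := h C hC hvC (hCs.trans inter_subset_left)
      rw [← Nat.not_even_iff_odd] at this
      have hy : y ∉ C := fun hh => hyB (hCs hh).2
      unfold Good; tauto
    by_cases hvy : v = y
    · subst hvy
      obtain ⟨A, hA, hvA, h⟩ := hy
      obtain ⟨B, hB, hvB, hyB⟩ := sep hvx
      refine ⟨A ∩ B, hA.inter hB, ⟨hvA, hvB⟩, fun C hC hvC hCs => ?_⟩
      have := h C hC hvC (hCs.trans inter_subset_left)
      rw [← Nat.not_even_iff_odd] at this
      have hy : x ∉ C := fun hh => hyB (hCs hh).2
      unfold Good; tauto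
    obtain ⟨A, hA, hvA, h⟩ := hev v hvx hvy
    obtain ⟨B, hB, hvB, hxB⟩ := sep hvx
    obtain ⟨D, hD, hvD, hyD⟩ := sep hvy
    refine ⟨A ∩ (B ∩ D), hA.inter (hB.inter hD), ⟨hvA, hvB, hvD⟩, fun C hC hvC hCs => ?_⟩
    have := h C hC hvC (hCs.trans inter_subset_left)
    have hx : x ∉ C := fun hh => hxB (hCs hh).2.1
    have hy : y ∉ C := fun hh => hyD (hCs hh).2.2
    unfold Good; tauto
  have loc : ∀ v, ∃ A, IsClopen A ∧ v ∈ A ∧ ∀ C, IsClopen C → C ⊆ A → Good s t x y C := by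
    intro v
    obtain ⟨A, hA, hvA, h⟩ := loc0 v
    refine ⟨A, hA, hvA, fun C hC hCs => ?_⟩
    by_cases hvC : v ∈ C
    · exact h C hC hvC hCs
    have e : C = symmDiff A (A \ C) := by
      ext u; rw [Set.mem_symmDiff, Set.mem_sdiff]
      have := @hCs u
      tauto
    rw [e]
    exact Good.sd hfin hA (hA.diff hC) (h A hA hvA subset_rfl)
      (h _ (hA.diff hC) ⟨hvA, hvC⟩ sdiff_subset)
  have : ∃ D, IsClopen D ∧ univ ⊆ D ∧ ∀ C, IsClopen C → C ⊆ D → Good s t x y C := by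
    refine isCompact_univ.induction_on
      (p := fun K : Set V => ∃ D, IsClopen D ∧ K ⊆ D ∧ ∀ C, IsClopen C → C ⊆ D → Good s t x y C)
      ?_ ?_ ?_ ?_
    · refine ⟨∅, isClopen_empty, subset_rfl, fun C _ hC => ?_⟩
      rw [subset_empty_iff.1 hC]
      simp [Good, cu]
    · rintro K L hKL ⟨D, h1, h2, h3⟩
      exact ⟨D, h1, hKL.trans h2, h3⟩
    · rintro K L ⟨D, h1, h2, h3⟩ ⟨D', h1', h2', h3'⟩
      refine ⟨D ∪ D', h1.union h1', union_subset_union h2 h2', fun C hC hCs => ?_⟩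
      have e : C = symmDiff (C ∩ D) (C \ D) := by
        ext u; rw [Set.mem_symmDiff, Set.mem_sdiff, Set.mem_inter_iff]
        tauto
      rw [e]
      refine Good.sd hfin (hC.inter h1) (hC.diff h1) (h3 _ (hC.inter h1) inter_subset_right)
        (h3' _ (hC.diff h1) ?_)
      rintro u ⟨hu, hu'⟩
      exact (hCs hu).resolve_left hu'
    · intro v _
      obtain ⟨A, hA, hvA, h⟩ := loc v
      exact ⟨A, mem_nhdsWithin_of_mem_nhds (hA.isOpen.mem_nhds hvA), A, hA, subset_rfl, h⟩
  obtain ⟨D, -, hD, h⟩ := this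
  exact h A hA ((subset_univ _).trans hD)
end
end GLP
end

section
open Set Topology Filter Function
namespace GLP
section
variable {X : Type*} [TopologicalSpace X] {V : Set X} {E : Type*}

theorem ES.ed_inj (S : ES X V E) : Injective S.ed := by
  intro e e' h
  obtain ⟨p, hp⟩ := S.ed_ne e
  exact S.ed_ed hp (h ▸ hp)

theorem ES.comp (S : ES X V E) {e : E} {p : X} (hp : p ∈ S.ed e) :
    connectedComponentIn Vᶜ p = S.ed e := by
  have hsub : S.ed e ⊆ Vᶜ := fun q hq => S.ed_V hq
  apply Subset.antisymm
  · have hpre : IsPreconnected (connectedComponentIn Vᶜ p) := isPreconnected_connectedComponentIn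
    refine hpre.subset_left_of_subset_union (v := ⋃ e' ∈ {e' | e' ≠ e}, S.ed e') (S.op e)
      (isOpen_biUnion fun e' _ => S.op e') ?_ ?_ ⟨p, mem_connectedComponentIn (hsub hp), hp⟩
    · rw [Set.disjoint_left]
      intro q hq hq'
      obtain ⟨e', he', hqe⟩ := mem_iUnion₂.1 hq'
      exact he' (S.ed_ed hqe hq)
    · intro q hq
      obtain ⟨e', he'⟩ := S.ed_surj (connectedComponentIn_subset _ _ hq)
      by_cases h : e' = e
      · subst h; exact Or.inl he'
      · exact Or.inr (mem_iUnion₂.2 ⟨e', h, he'⟩)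
  · refine IsPreconnected.subset_connectedComponentIn ?_ hp hsub
    exact isPreconnected_Ioo.image _ (S.cont e).continuousOn

theorem ES.closure_ed [T2Space X] (S : ES X V E) (e : E) : closure (S.ed e) = S.γ e '' Icc 0 1 := by
  apply Subset.antisymm
  · exact closure_minimal (image_mono Ioo_subset_Icc_self)
      (isCompact_Icc.image (S.cont e)).isClosed
  · rintro _ ⟨s, hs, rfl⟩
    exact S.cl_ed e hs

theorem ES.closure_meet [T2Space X] (S : ES X V E) (e : E) (A : Set V) :
    (closure (S.ed e) ∩ Subtype.val '' A).Nonempty ↔ S.s e ∈ A ∨ S.t e ∈ A := by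
  rw [S.closure_ed]
  constructor
  · rintro ⟨_, ⟨s, hs, rfl⟩, v, hv, hvs⟩
    rcases Icc_cases hs with rfl | rfl | h
    · left
      have : S.s e = v := Subtype.ext hvs.symm
      rwa [this]
    · right
      have : S.t e = v := Subtype.ext hvs.symm
      rwa [this]
    · exact (S.inV e s h (hvs ▸ v.2)).elim
  · rintro (h | h)
    · exact ⟨S.γ e 0, ⟨0, by simp, rfl⟩, _, h, rfl⟩
    · exact ⟨S.γ e 1, ⟨1, by simp, rfl⟩, _, h, rfl⟩

theorem conn_univ [CompactSpace X] [T2Space X] [ConnectedSpace X] (hV : IsClosed V)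
    (S : ES X V E) (x : V) : Conn S.s S.t univ x := by
  intro A hA hx hcu e _
  obtain ⟨h, hc, hv, he⟩ := hA_exists hV S A hA
  have h01 : ∀ p, h p = 0 ∨ h p = 1 := by
    intro p
    by_cases hp : p ∈ V
    · rw [hv ⟨p, hp⟩]; exact ind_01 _ _
    · obtain ⟨e', s, hs, rfl⟩ := S.ed_surj hp
      rw [he e' (fun hh => by
        have : e' ∈ cu S.s S.t A ∩ univ := ⟨hh, trivial⟩
        rw [hcu] at this; exact this) s (Ioo_subset_Icc_self hs)]
      exact ind_01 _ _
  have heq : h x = h (S.s e) := by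
    by_contra hne
    have hiv : (1/2:ℝ) ∈ range h := by
      have hr := isPreconnected_range hc
      have o := hr.ordConnected
      rcases h01 x with a | a <;> rcases h01 (S.s e) with b | b
      · exact (hne (a.trans b.symm)).elim
      · exact o.out ⟨_, a⟩ ⟨_, b⟩ (by norm_num)
      · exact o.out ⟨_, b⟩ ⟨_, a⟩ (by norm_num)
      · exact (hne (a.trans b.symm)).elim
    obtain ⟨p, hp⟩ := hiv
    rcases h01 p with a | a <;> rw [a] at hp <;> norm_num at hp
  rw [hv, hv, ind_eq_iff] at heq
  exact heq.1 hx

end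

section
variable {X : Type*} [TopologicalSpace X]

theorem getS [CompactSpace X] [T2Space X] (G : GraphLike X) : Nonempty (ES X G.V G.E) := by
  haveI := G.zeroDimV
  letI : TopologicalSpace G.E := ⊥
  haveI : DiscreteTopology G.E := ⟨rfl⟩
  obtain ⟨H⟩ := G.homeo
  obtain ⟨S, -⟩ := ES_exists G.closedV H
  exact ⟨S⟩

theorem isEdge_iff (G : GraphLike X) (S : ES X G.V G.E) (Z : Set X) :
    G.IsEdge Z ↔ ∃ e, Z = S.ed e := by
  constructor
  · rintro ⟨p, hp, rfl⟩
    obtain ⟨e, he⟩ := S.ed_surj hp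
    exact ⟨e, S.comp he⟩
  · rintro ⟨e, rfl⟩
    obtain ⟨p, hp⟩ := S.ed_ne e
    exact ⟨p, S.ed_V hp, (S.comp hp).symm⟩

theorem img_compl (V : Set X) (A : Set V) : V \ (Subtype.val '' A) = Subtype.val '' Aᶜ := by
  ext p
  constructor
  · rintro ⟨hp, hn⟩
    exact ⟨⟨p, hp⟩, fun h => hn ⟨_, h, rfl⟩, rfl⟩
  · rintro ⟨v, hv, rfl⟩
    refine ⟨v.2, ?_⟩
    rintro ⟨w, hw, h⟩
    rw [Subtype.ext h] at hw
    exact hv hw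

theorem clopen_img (G : GraphLike X) (A : Set G.V) (hA : IsClopen A) :
    G.ClopenIn (Subtype.val '' A) := by
  refine ⟨?_, ?_, ?_⟩
  · rintro _ ⟨v, _, rfl⟩; exact v.2
  · exact G.closedV.isClosedEmbedding_subtypeVal.isClosedMap _ hA.isClosed
  · rw [img_compl]
    exact G.closedV.isClosedEmbedding_subtypeVal.isClosedMap _ hA.compl.isClosed

theorem clopen_of (G : GraphLike X) (C : Set X) (hC : G.ClopenIn C) :
    ∃ A : Set G.V, IsClopen A ∧ C = Subtype.val '' A := by
  refine ⟨Subtype.val ⁻¹' C, ⟨hC.2.1.preimage continuous_subtype_val, ?_⟩, ?_⟩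
  · rw [← isClosed_compl_iff]
    have : (Subtype.val ⁻¹' C : Set G.V)ᶜ = Subtype.val ⁻¹' (G.V \ C) := by
      ext v; simp
    rw [this]
    exact hC.2.2.preimage continuous_subtype_val
  · rw [Subtype.image_preimage_coe]
    exact (inter_eq_right.2 hC.1).symm

theorem cut_eq [T2Space X] (G : GraphLike X) (S : ES X G.V G.E) (A : Set G.V) :
    G.cut (Subtype.val '' A) (Subtype.val '' Aᶜ) = S.ed '' cu S.s S.t A := by
  ext Z
  constructor
  · rintro ⟨h1, h2, h3⟩
    obtain ⟨e, rfl⟩ := (isEdge_iff G S Z).1 h1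
    rw [S.closure_meet] at h2 h3
    refine ⟨e, ?_, rfl⟩
    simp only [cu, mem_ofPred_eq, mem_compl_iff] at *
    tauto
  · rintro ⟨e, he, rfl⟩
    refine ⟨(isEdge_iff G S _).2 ⟨e, rfl⟩, ?_⟩
    rw [S.closure_meet, S.closure_meet]
    simp only [cu, mem_ofPred_eq, mem_compl_iff] at *
    tauto

theorem cut_card [T2Space X] (G : GraphLike X) (S : ES X G.V G.E) (A : Set G.V) :
    (G.cut (Subtype.val '' A) (Subtype.val '' Aᶜ)).ncard = (cu S.s S.t A).ncard := by
  rw [cut_eq G S, ncard_image_of_injective _ S.ed_inj]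

theorem cut_fin [CompactSpace X] [T2Space X] (G : GraphLike X) (S : ES X G.V G.E) (A : Set G.V)
    (hA : IsClopen A) :
    (G.cut (Subtype.val '' A) (Subtype.val '' Aᶜ)).Finite := by
  rw [cut_eq G S]; exact (hfin_of G.closedV S A hA).image _

theorem evV_iff [CompactSpace X] [T2Space X] (G : GraphLike X) (S : ES X G.V G.E) (v : G.V) :
    G.EvenVertex v ↔ EvV S.s S.t v := by
  constructor
  · rintro ⟨A', hA', hv, h⟩
    obtain ⟨A, hA, rfl⟩ := clopen_of G A' hA'
    refine ⟨A, hA, Subtype.val_injective.mem_set_image.1 hv, fun C hC hvC hCs => ?_⟩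
    have := (h _ (clopen_img G C hC) ⟨v, hvC, rfl⟩ (image_mono hCs)).2
    rwa [img_compl, cut_card G S] at this
  · rintro ⟨A, hA, hv, h⟩
    refine ⟨_, clopen_img G A hA, ⟨v, hv, rfl⟩, fun C' hC' hvC hCs => ?_⟩
    obtain ⟨C, hC, rfl⟩ := clopen_of G C' hC'
    rw [img_compl, cut_card G S]
    exact ⟨cut_fin G S C hC, h C hC (Subtype.val_injective.mem_set_image.1 hvC)
      ((image_subset_image_iff Subtype.val_injective).1 hCs)⟩

theorem odV_iff [CompactSpace X] [T2Space X] (G : GraphLike X) (S : ES X G.V G.E) (v : G.V) :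
    G.OddVertex v ↔ OdV S.s S.t v := by
  constructor
  · rintro ⟨A', hA', hv, h⟩
    obtain ⟨A, hA, rfl⟩ := clopen_of G A' hA'
    refine ⟨A, hA, Subtype.val_injective.mem_set_image.1 hv, fun C hC hvC hCs => ?_⟩
    have := (h _ (clopen_img G C hC) ⟨v, hvC, rfl⟩ (image_mono hCs)).2
    rwa [img_compl, cut_card G S] at this
  · rintro ⟨A, hA, hv, h⟩
    refine ⟨_, clopen_img G A hA, ⟨v, hv, rfl⟩, fun C' hC' hvC hCs => ?_⟩
    obtain ⟨C, hC, rfl⟩ := clopen_of G C' hC'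
    rw [img_compl, cut_card G S]
    exact ⟨cut_fin G S C hC, h C hC (Subtype.val_injective.mem_set_image.1 hvC)
      ((image_subset_image_iff Subtype.val_injective).1 hCs)⟩

def Core (G : GraphLike X) (S : ES X G.V G.E) : Prop :=
  ∃ x y : G.V, x ≠ y ∧ ∀ A, IsClopen A → (Even (cu S.s S.t A).ncard ↔ (x ∈ A ↔ y ∈ A))

theorem ii_iff [CompactSpace X] [T2Space X] (G : GraphLike X) (S : ES X G.V G.E) :
    (∃ x y, x ∈ G.V ∧ y ∈ G.V ∧ x ≠ y ∧ {v ∈ G.V | G.OddVertex v} = {x, y} ∧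
        ∀ v ∈ G.V, v ≠ x → v ≠ y → G.EvenVertex v) ↔ Core G S := by
  haveI := G.zeroDimV
  haveI : CompactSpace G.V := isCompact_iff_compactSpace.1 G.closedV.isCompact
  constructor
  · rintro ⟨x, y, hx, hy, hxy, ho, he⟩
    have ox : G.OddVertex x := (ho.symm ▸ (by simp) : x ∈ {v ∈ G.V | G.OddVertex v}).2
    have oy : G.OddVertex y := (ho.symm ▸ (by simp) : y ∈ {v ∈ G.V | G.OddVertex v}).2
    have hne : (⟨x, hx⟩ : G.V) ≠ ⟨y, hy⟩ := fun h => hxy (congrArg Subtype.val h)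
    refine ⟨⟨x, hx⟩, ⟨y, hy⟩, hne, fun A hA => ?_⟩
    refine vert_core (hfin_of G.closedV S) hne ((odV_iff G S _).1 ox) ((odV_iff G S _).1 oy)
      (fun v h1 h2 => (evV_iff G S v).1 (he v v.2 (fun h => h1 (Subtype.ext h))
        (fun h => h2 (Subtype.ext h)))) A hA
  · rintro ⟨x, y, hxy, h⟩
    obtain ⟨h1, h2⟩ := core_vert hxy h
    refine ⟨x, y, x.2, y.2, fun h => hxy (Subtype.ext h), ?_, ?_⟩
    · ext v
      constructor
      · rintro ⟨hv, ho⟩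
        have := (h1 ⟨v, hv⟩).1 ((odV_iff G S ⟨v, hv⟩).1 ho)
        rcases this with rfl | rfl
        · exact Or.inl rfl
        · exact Or.inr rfl
      · rintro (rfl | rfl)
        · exact ⟨x.2, (odV_iff G S x).2 ((h1 x).2 (Or.inl rfl))⟩
        · exact ⟨y.2, (odV_iff G S y).2 ((h1 y).2 (Or.inr rfl))⟩
    · intro v hv hx hy
      exact (evV_iff G S ⟨v, hv⟩).2 (h2 ⟨v, hv⟩ (fun h => hx (congrArg Subtype.val h))
        (fun h => hy (congrArg Subtype.val h)))

theorem iii_iff [CompactSpace X] [T2Space X] (G : GraphLike X) (S : ES X G.V G.E) :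
    (∃ x y, x ∈ G.V ∧ y ∈ G.V ∧ x ≠ y ∧
        ∀ S : G.Separation, (G.EvenCut S.A S.B ↔
          ((x ∈ S.A ∧ y ∈ S.A) ∨ (x ∈ S.B ∧ y ∈ S.B)))) ↔ Core G S := by
  have key : ∀ (A : Set G.V), IsClopen A → ∀ x y : G.V,
      (G.EvenCut (Subtype.val '' A) (Subtype.val '' Aᶜ) ↔ Even (cu S.s S.t A).ncard) ∧
      (((x:X) ∈ (Subtype.val '' A) ∧ (y:X) ∈ (Subtype.val '' A)) ∨
        ((x:X) ∈ (Subtype.val '' Aᶜ) ∧ (y:X) ∈ (Subtype.val '' Aᶜ)) ↔ (x ∈ A ↔ y ∈ A)) := by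
    intro A hA x y
    constructor
    · unfold GraphLike.EvenCut
      rw [cut_card G S]
      exact ⟨fun h => h.2, fun h => ⟨cut_fin G S A hA, h⟩⟩
    · simp only [Subtype.val_injective.mem_set_image, mem_compl_iff]
      tauto
  constructor
  · rintro ⟨x, y, hx, hy, hxy, h⟩
    refine ⟨⟨x, hx⟩, ⟨y, hy⟩, fun h => hxy (congrArg Subtype.val h), fun A hA => ?_⟩
    obtain ⟨k1, k2⟩ := key A hA ⟨x, hx⟩ ⟨y, hy⟩
    rw [← k1, ← k2]
    exact h ⟨_, _, clopen_img G A hA, clopen_img G _ hA.compl,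
      by rw [← image_inter Subtype.val_injective]; simp,
      by rw [← image_union]; simp⟩
  · rintro ⟨x, y, hxy, h⟩
    refine ⟨x, y, x.2, y.2, fun h => hxy (Subtype.ext h), fun Sp => ?_⟩
    obtain ⟨A', B', cA, cB, hd, hu⟩ := Sp
    obtain ⟨A, hA, rfl⟩ := clopen_of G A' cA
    have hB : B' = Subtype.val '' Aᶜ := by
      rw [← img_compl]
      ext p
      constructor
      · intro hp
        refine ⟨cB.1 hp, fun hq => ?_⟩
        have : p ∈ Subtype.val '' A ∩ B' := ⟨hq, hp⟩
        rw [hd] at this; exact this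
      · rintro ⟨hp, hq⟩
        have : p ∈ Subtype.val '' A ∪ B' := by rw [hu]; exact hp
        exact this.resolve_left hq
    subst hB
    obtain ⟨k1, k2⟩ := key A hA x y
    exact k1.trans ((h A hA).trans k2.symm)
end
end GLP
end

section
open Set Topology Filter Function
namespace GLP
section
variable {X : Type*} [TopologicalSpace X]

theorem i_core [CompactSpace X] [T2Space X] (G : GraphLike X) (S : ES X G.V G.E)
    (h : ∃ f, G.IsOpenEulerianPath f) : Core G S := by
  obtain ⟨f, ⟨hf, h0, h1, hinj, -⟩, hne, hE⟩ := h
  let g : ℝ → X := fun t => f (projIcc 0 1 zero_le_one t)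
  have gc : Continuous g := hf.comp continuous_projIcc
  have g0 : g 0 = f 0 := congrArg f (projIcc_of_le_left _ le_rfl)
  have g1 : g 1 = f 1 := congrArg f (projIcc_of_right_le _ le_rfl)
  have ginj : ∀ e, InjOn g (Icc 0 1 ∩ g ⁻¹' S.ed e) := by
    rintro e s ⟨hs, hse⟩ t ⟨ht, hte⟩ hst
    have := hinj _ ((isEdge_iff G S _).2 ⟨e, rfl⟩) hse hte hst
    rw [projIcc_of_mem _ hs, projIcc_of_mem _ ht] at this
    exact congrArg Subtype.val this
  have hp : g 0 ∈ G.V := g0 ▸ h0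
  have hq : g 1 ∈ G.V := g1 ▸ h1
  refine ⟨⟨g 0, hp⟩, ⟨g 1, hq⟩, fun h => hne ?_, fun A hA => ?_⟩
  · rw [← g0, ← g1]; exact Subtype.mk_eq_mk.1 h
  · rw [← lemP G.closedV S gc zero_le_one hp hq ginj A hA]
    have : {e ∈ cu S.s S.t A | ∃ t ∈ Icc (0:ℝ) 1, g t ∈ S.ed e} = cu S.s S.t A := by
      ext e
      simp only [mem_ofPred_eq]
      refine ⟨fun h => h.1, fun h => ⟨h, ?_⟩⟩
      obtain ⟨p, hp⟩ := S.ed_ne e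
      obtain ⟨t, rfl⟩ := hE _ ((isEdge_iff G S _).2 ⟨e, rfl⟩) hp
      refine ⟨t, t.2, ?_⟩
      have : g t = f t := congrArg f (projIcc_val _ t)
      rw [this]; exact hp
    rw [this]

theorem core_i [CompactSpace X] [TopologicalSpace.MetrizableSpace X] [ConnectedSpace X]
    (G : GraphLike X) (S : ES X G.V G.E) (h : Core G S) : ∃ f, G.IsOpenEulerianPath f := by
  have := G.zeroDimV
  have : CompactSpace G.V := isCompact_iff_compactSpace.1 G.closedV.isCompact
  have : Countable G.E := E_countable S
  obtain ⟨x, y, hxy, h⟩ := h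
  have hpar : Par S.s S.t univ x y := by
    intro A hA; rw [inter_univ]; exact h A hA
  have hne : (univ : Set G.E).Nonempty := by
    rw [nonempty_iff_ne_empty]
    intro he
    obtain ⟨A, hA, hxA, hyA⟩ := sep hxy
    have := (h A hA).1 (by
      rw [← inter_univ (cu S.s S.t A), he]; simp)
    exact hyA (this.1 hxA)
  obtain ⟨f, hf, f0, f1, a, b, hab, hio, hinj, hsurj, -, hden⟩ :=
    thmT G.closedV S univ hne x y hpar (conn_univ G.closedV S x)
  refine ⟨fun t => f t, ⟨hf.comp continuous_subtype_val, ?_, ?_, ?_, ?_⟩, ?_, ?_⟩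
  · show f 0 ∈ G.V
    rw [f0]; exact x.2
  · show f 1 ∈ G.V
    rw [f1]; exact y.2
  · intro Z hZ
    obtain ⟨e, rfl⟩ := (isEdge_iff G S Z).1 hZ
    intro s hs t ht hst
    exact Subtype.ext (hinj ⟨e, trivial⟩ ((hio ⟨e, trivial⟩ s).1 hs) ((hio ⟨e, trivial⟩ t).1 ht) hst)
  · rw [eq_empty_iff_forall_notMem]
    intro t ht
    rw [mem_interior_iff_mem_nhds, Metric.mem_nhds_iff] at ht
    obtain ⟨ε, hε, hball⟩ := ht
    have key : ∃ p q : ℝ, 0 ≤ p ∧ p < q ∧ q ≤ 1 ∧ ∀ r ∈ Ioo p q, |r - t| < ε := by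
      by_cases ht1 : (t:ℝ) < 1
      · refine ⟨t, min 1 (t + ε), t.2.1, lt_min ht1 (by linarith), min_le_left _ _, ?_⟩
        rintro r ⟨h1, h2⟩
        have := lt_min_iff.1 h2
        rw [abs_lt]; constructor <;> linarith
      · have ht1 : (t:ℝ) = 1 := le_antisymm t.2.2 (not_lt.1 ht1)
        refine ⟨max 0 (1 - ε), 1, le_max_left _ _, max_lt one_pos (by linarith), le_rfl, ?_⟩
        rintro r ⟨h1, h2⟩
        have := max_lt_iff.1 h1
        rw [abs_lt]; constructor <;> linarith
    obtain ⟨p, q, hp, hpq, hq, hr⟩ := key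
    obtain ⟨r, hrm, e, -, hre⟩ := hden p q hp hpq hq
    have hrI : r ∈ Icc (0:ℝ) 1 := ⟨hp.trans hrm.1.le, hrm.2.le.trans hq⟩
    have : (⟨r, hrI⟩ : unitInterval) ∈ Metric.ball t ε := by
      rw [Metric.mem_ball, Subtype.dist_eq, Real.dist_eq]; exact hr r hrm
    exact S.ed_V hre (hball this)
  · show f 0 ≠ f 1
    rw [f0, f1]; exact fun h => hxy (Subtype.ext h)
  · intro Z hZ
    obtain ⟨e, rfl⟩ := (isEdge_iff G S Z).1 hZ
    intro p hp
    obtain ⟨t, ht, rfl⟩ := hsurj ⟨e, trivial⟩ hp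
    have := hab ⟨e, trivial⟩
    exact ⟨⟨t, this.1.trans ht.1.le, ht.2.le.trans this.2.2⟩, rfl⟩

theorem core_iv [CompactSpace X] [TopologicalSpace.MetrizableSpace X]
    (G : GraphLike X) (S : ES X G.V G.E) (h : Core G S) :
    ∃ (A : Set X) (ι : Type) (C : ι → Set X),
        Nonempty (A ≃ₜ unitInterval) ∧
        (∃ e, G.IsEdge e ∧ e ⊆ A) ∧
        (∀ i, Nonempty (C i ≃ₜ Circle)) ∧
        ∀ e, G.IsEdge e →
          (e ⊆ A ∧ ∀ i, ¬ e ⊆ C i) ∨ (¬ e ⊆ A ∧ ∃! i, e ⊆ C i) := by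
  have := G.zeroDimV
  have : CompactSpace G.V := isCompact_iff_compactSpace.1 G.closedV.isCompact
  have : Countable G.E := E_countable S
  have hfin := hfin_of G.closedV S
  obtain ⟨x, y, hxy, h⟩ := h
  obtain ⟨C₀, -, hpar, hconn, hbr⟩ := comb1 hfin univ x y (by
    intro A hA he
    rw [inter_univ] at he
    rw [← h A hA, he]; simp)
  have hne : C₀.Nonempty := by
    rw [nonempty_iff_ne_empty]
    rintro rfl
    obtain ⟨A, hA, hxA, hyA⟩ := sep hxy
    have := (hpar A hA).1 (by simp)
    exact hyA (this.1 hxA)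
  obtain ⟨K, hK, hKe⟩ := arc_exists G.closedV S C₀ hne x y hpar hconn (bond_of_bridge hbr) hxy
  have hrest : ∀ A, IsClopen A → Even (cu S.s S.t A ∩ C₀ᶜ).ncard := by
    intro A hA
    have h1 := Set.ncard_inter_add_ncard_sdiff_eq_ncard (cu S.s S.t A) C₀ (hfin A hA)
    have h2 := hpar A hA
    have h3 := h A hA
    rw [← h1, ← h2, Nat.even_add, sdiff_eq] at h3
    tauto
  obtain ⟨𝒞, h1, h2⟩ := comb3 hfin C₀ᶜ hrest
  have hc : ∀ C : 𝒞, ∃ K : Set X, Nonempty (K ≃ₜ Circle) ∧ ∀ e, S.ed e ⊆ K ↔ e ∈ C.1 := by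
    intro C
    obtain ⟨-, hn, v, p1, p2, p3⟩ := h1 C.1 C.2
    exact circle_exists G.closedV S C.1 hn v p1 p2 p3
  choose D hD1 hD2 using hc
  refine ⟨K, 𝒞, D, hK, ?_, hD1, ?_⟩
  · obtain ⟨e, he⟩ := hne
    exact ⟨S.ed e, (isEdge_iff G S _).2 ⟨e, rfl⟩, (hKe e).2 he⟩
  · intro Z hZ
    obtain ⟨e, rfl⟩ := (isEdge_iff G S Z).1 hZ
    by_cases he : e ∈ C₀
    · left
      refine ⟨(hKe e).2 he, fun C hC => ?_⟩
      exact (h1 C.1 C.2).1 ((hD2 C e).1 hC) he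
    · right
      refine ⟨fun hh => he ((hKe e).1 hh), ?_⟩
      simp only [hD2]
      exact h2 e he

theorem iv_core [CompactSpace X] [T2Space X]
    (G : GraphLike X) (S : ES X G.V G.E) (h : ∃ (A : Set X) (ι : Type) (C : ι → Set X),
        Nonempty (A ≃ₜ unitInterval) ∧
        (∃ e, G.IsEdge e ∧ e ⊆ A) ∧
        (∀ i, Nonempty (C i ≃ₜ Circle)) ∧
        ∀ e, G.IsEdge e →
          (e ⊆ A ∧ ∀ i, ¬ e ⊆ C i) ∨ (¬ e ⊆ A ∧ ∃! i, e ⊆ C i)) : Core G S := by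
  obtain ⟨K, ι, C, ⟨φ⟩, ⟨Z, hZ, hZK⟩, hC, hE⟩ := h
  obtain ⟨e0, rfl⟩ := (isEdge_iff G S Z).1 hZ
  obtain ⟨x, y, hxy, hpar⟩ := arc_par G.closedV S K φ e0 hZK
  refine ⟨x, y, hxy, fun A hA => ?_⟩
  rw [← hpar A hA]
  have hE' := fun e => hE _ ((isEdge_iff G S _).2 ⟨e, rfl⟩)
  have fin := hfin_of G.closedV S A hA
  have h1 := Set.ncard_inter_add_ncard_sdiff_eq_ncard (cu S.s S.t A) {e | S.ed e ⊆ K} fin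
  have h2 : Even (cu S.s S.t A \ {e | S.ed e ⊆ K}).ncard := by
    refine even_family (fun i => {e | S.ed e ⊆ C i}) _ _ fin.sdiff rfl ?_ ?_
    · rintro e ⟨-, he⟩
      exact ((hE' e).resolve_left (fun h => he h.1)).2
    · intro i
      obtain ⟨ψ⟩ := hC i
      have := circle_par G.closedV S (C i) ψ A hA
      convert this using 2
      ext e
      constructor
      · rintro ⟨⟨h1, -⟩, h2⟩
        exact ⟨h1, h2⟩
      · rintro ⟨h1, h2⟩
        refine ⟨⟨h1, fun hK => ?_⟩, h2⟩
        rcases hE' e with h | h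
        · exact h.2 i h2
        · exact h.1 hK
  have h3 : cu S.s S.t A ∩ {e | S.ed e ⊆ K} = {e ∈ cu S.s S.t A | S.ed e ⊆ K} := rfl
  rw [← h1, h3, Nat.even_add]
  tauto
end
end GLP
end

/-- For a graph-like continuum the following are equivalent:
(i) it has an open Eulerian path; (ii) precisely two vertices are odd and all other
vertices are even; (iii) there are vertices `x ≠ y` such that a cut is even exactly when
`x` and `y` lie in the same part of the separation; (iv) the edges decompose into an arc
containing at least one edge and edge-disjoint circles. -/
theorem open_eulerian_path_characterization
    [CompactSpace X] [TopologicalSpace.MetrizableSpace X] [ConnectedSpace X]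
    (G : GraphLike X) :
    ((∃ f, G.IsOpenEulerianPath f) ↔
      ∃ x y, x ∈ G.V ∧ y ∈ G.V ∧ x ≠ y ∧ {v ∈ G.V | G.OddVertex v} = {x, y} ∧
        ∀ v ∈ G.V, v ≠ x → v ≠ y → G.EvenVertex v) ∧
    ((∃ f, G.IsOpenEulerianPath f) ↔
      ∃ x y, x ∈ G.V ∧ y ∈ G.V ∧ x ≠ y ∧
        ∀ S : G.Separation, (G.EvenCut S.A S.B ↔
          ((x ∈ S.A ∧ y ∈ S.A) ∨ (x ∈ S.B ∧ y ∈ S.B)))) ∧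
    ((∃ f, G.IsOpenEulerianPath f) ↔
      ∃ (A : Set X) (ι : Type) (C : ι → Set X),
        Nonempty (A ≃ₜ unitInterval) ∧
        (∃ e, G.IsEdge e ∧ e ⊆ A) ∧
        (∀ i, Nonempty (C i ≃ₜ Circle)) ∧
        ∀ e, G.IsEdge e →
          (e ⊆ A ∧ ∀ i, ¬ e ⊆ C i) ∨ (¬ e ⊆ A ∧ ∃! i, e ⊆ C i)) := by
  obtain ⟨S⟩ := GLP.getS G
  have h : (∃ f, G.IsOpenEulerianPath f) ↔ GLP.Core G S := ⟨GLP.i_core G S, GLP.core_i G S⟩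
  refine ⟨h.trans (GLP.ii_iff G S).symm, h.trans (GLP.iii_iff G S).symm, h.trans ?_⟩
  exact ⟨GLP.core_iv G S, GLP.iv_core G S⟩
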